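/- arXiv:2403.15602 — 3 statements merged into one kernel-verified Lean document; each statement's English description precedes it below -/
import Mathlib

section
/- For every n ≥ 7, there exists an n-vertex rainbow C_4-saturated graph with at most 11n/6 + C edges, where C is an absolute constant; consequently sat*(n, C_4) ≤ 11n/6 + O(1). -/
/-- A proper edge-coloring: any two distinct edges of `G` sharing a vertex
receive different colors. -/
def ProperEdgeColoring {V : Type*} (G : SimpleGraph V) (c : Sym2 V → ℕ) : Prop :=
  ∀ e₁ ∈ G.edgeSet, ∀ e₂ ∈ G.edgeSet, e₁ ≠ e₂ → (∃ v, v ∈ e₁ ∧ v ∈ e₂) → c e₁ ≠ c e₂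

/-- `G` contains a rainbow copy of the cycle `C_k` under the edge-coloring `c`:
there are `k` distinct vertices, cyclically consecutive ones adjacent, whose
`k` cycle edges receive pairwise distinct colors. -/
def HasRainbowCycle {V : Type*} (G : SimpleGraph V) (c : Sym2 V → ℕ) (k : ℕ) : Prop :=
  ∃ f : ZMod k → V, Function.Injective f ∧ (∀ i, G.Adj (f i) (f (i + 1))) ∧
    Function.Injective (fun i : ZMod k => c s(f i, f (i + 1)))

/-- `G` is (properly) rainbow `C_k`-saturated: some proper edge-coloring of `G`
has no rainbow `C_k`-copy, but for every pair of nonadjacent vertices `x, y`,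
every proper edge-coloring of `G + xy` contains a rainbow `C_k`-copy. -/
def RainbowSat {V : Type*} (G : SimpleGraph V) (k : ℕ) : Prop :=
  (∃ c, ProperEdgeColoring G c ∧ ¬ HasRainbowCycle G c k) ∧
  ∀ x y : V, x ≠ y → ¬ G.Adj x y →
    ∀ c, ProperEdgeColoring (G ⊔ SimpleGraph.fromEdgeSet {s(x, y)}) c →
      HasRainbowCycle (G ⊔ SimpleGraph.fromEdgeSet {s(x, y)}) c k

/-- A rainbow `C₄` amounts to four distinct, cyclically adjacent vertices whose four
edges receive distinct colors. -/
lemma hasRainbowCycle_four_iff {V : Type*} (G : SimpleGraph V) (c : Sym2 V → ℕ) :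
    HasRainbowCycle G c 4 ↔ ∃ x y z w : V,
      (x ≠ y ∧ x ≠ z ∧ x ≠ w ∧ y ≠ z ∧ y ≠ w ∧ z ≠ w) ∧
      (G.Adj x y ∧ G.Adj y z ∧ G.Adj z w ∧ G.Adj w x) ∧
      (c s(x, y) ≠ c s(y, z) ∧ c s(x, y) ≠ c s(z, w) ∧ c s(x, y) ≠ c s(w, x) ∧
        c s(y, z) ≠ c s(z, w) ∧ c s(y, z) ≠ c s(w, x) ∧ c s(z, w) ≠ c s(w, x)) := by
  constructor
  · rintro ⟨f, hf, hadj, hc⟩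
    refine ⟨f 0, f 1, f 2, f 3, ?_, ⟨hadj 0, hadj 1, hadj 2, hadj 3⟩, ?_⟩
    · refine ⟨?_, ?_, ?_, ?_, ?_, ?_⟩ <;> exact fun h => absurd (hf h) (by decide)
    · refine ⟨fun h => ?_, fun h => ?_, fun h => ?_, fun h => ?_, fun h => ?_, fun h => ?_⟩
      · exact absurd (@hc 0 1 h) (by decide)
      · exact absurd (@hc 0 2 h) (by decide)
      · exact absurd (@hc 0 3 h) (by decide)
      · exact absurd (@hc 1 2 h) (by decide)
      · exact absurd (@hc 1 3 h) (by decide)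
      · exact absurd (@hc 2 3 h) (by decide)
  · rintro ⟨x, y, z, w, ⟨h1, h2, h3, h4, h5, h6⟩, ⟨a1, a2, a3, a4⟩, ⟨c1, c2, c3, c4, c5, c6⟩⟩
    let f : Fin 4 → V := ![x, y, z, w]
    have f0 : f 0 = x := rfl
    have f1 : f 1 = y := rfl
    have f2 : f 2 = z := rfl
    have f3 : f 3 = w := rfl
    have g0 : (0 : Fin 4) + 1 = 1 := rfl
    have g1 : (1 : Fin 4) + 1 = 2 := rfl
    have g2 : (2 : Fin 4) + 1 = 3 := rfl
    have g3 : (3 : Fin 4) + 1 = 0 := rfl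
    have hinj : Function.Injective f := by
      intro i j h
      fin_cases i <;> fin_cases j <;> simp_all
    have hadj : ∀ i : Fin 4, G.Adj (f i) (f (i + 1)) := by
      intro i
      fin_cases i <;> simp only [Fin.zero_eta, Fin.mk_one, Fin.reduceFinMk, g0, g1, g2, g3, f0, f1,
        f2, f3] <;> assumption
    have hcol : Function.Injective (fun i : Fin 4 => c s(f i, f (i + 1))) := by
      intro i j h
      fin_cases i <;> fin_cases j <;> simp only [Fin.zero_eta, Fin.mk_one, Fin.reduceFinMk, g0, g1,
        g2, g3, f0, f1, f2, f3] at h ⊢ <;> first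
        | exact absurd h (by assumption)
        | exact absurd h.symm (by assumption)
    exact ⟨f, hinj, hadj, hcol⟩

/-- Parent function of a rooted forest on `{0, …, m - 1}` whose trees are spiders with legs of
lengths `1, 2, 2`; the last spider has one leg extended to cover the remaining vertices.
Roots are their own parents. -/
def spiderParent (m i : ℕ) : ℕ :=
  if 6 * (m / 6) ≤ i then i - 1
  else if i % 6 = 0 then i
  else if i % 6 = 3 ∨ i % 6 = 5 then i - 1
  else 6 * (i / 6)

/-- The vertex whose edge to the apex has the same color as the edge from `i` to its parent. -/
def spiderTarget (m i : ℕ) : ℕ :=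
  if 6 * (m / 6) ≤ i then i - 2
  else if i % 6 = 1 then i + 1
  else if i % 6 = 2 then i + 2
  else if i % 6 = 3 ∨ i % 6 = 4 then i - 3
  else i - 5

/-- Adjacency in the spider forest. -/
def SpiderAdj (m i j : ℕ) : Prop :=
  (i < j ∧ spiderParent m j = i) ∨ (j < i ∧ spiderParent m i = j)

lemma SpiderAdj.symm {m i j : ℕ} (h : SpiderAdj m i j) : SpiderAdj m j i := Or.symm h

lemma SpiderAdj.ne {m i j : ℕ} (h : SpiderAdj m i j) : i ≠ j := by
  rcases h with h | h <;> omega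

lemma spiderParent_le (m i : ℕ) : spiderParent m i ≤ i := by
  unfold spiderParent; split_ifs <;> omega

lemma spiderAdj_parent {m i : ℕ} (h : spiderParent m i ≠ i) : SpiderAdj m i (spiderParent m i) :=
  Or.inr ⟨lt_of_le_of_ne (spiderParent_le m i) h, rfl⟩

/-- A child of a root is the first, second or fourth vertex of its spider. -/
lemma eq_of_parent_root {m i : ℕ} (hm : 6 ≤ m) (h : spiderParent m i ≠ i)
    (hr : spiderParent m (spiderParent m i) = spiderParent m i) :
    ∃ k, 6 * k + 5 < m ∧ spiderParent m i = 6 * k ∧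
      (i = 6 * k + 1 ∨ i = 6 * k + 2 ∨ i = 6 * k + 4) := by
  refine ⟨i / 6, ?_⟩
  unfold spiderParent at *
  split_ifs at * <;> omega

/-- Siblings are children of a root. -/
lemma parent_root_of_siblings {m i j : ℕ} (hm : 6 ≤ m) (hi : spiderParent m i ≠ i)
    (hj : spiderParent m j ≠ j) (hij : i ≠ j) (h : spiderParent m i = spiderParent m j) :
    spiderParent m (spiderParent m i) = spiderParent m i := by
  unfold spiderParent at *
  split_ifs at * <;> omega

lemma spiderParent_block {m k : ℕ} (hk : 6 * k + 5 < m) :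
    spiderParent m (6 * k) = 6 * k ∧ spiderParent m (6 * k + 1) = 6 * k ∧
    spiderParent m (6 * k + 2) = 6 * k ∧ spiderParent m (6 * k + 3) = 6 * k + 2 ∧
    spiderParent m (6 * k + 4) = 6 * k ∧ spiderParent m (6 * k + 5) = 6 * k + 4 := by
  unfold spiderParent
  refine ⟨?_, ?_, ?_, ?_, ?_, ?_⟩ <;> split_ifs <;> omega

lemma spiderTarget_block {m k : ℕ} (hk : 6 * k + 5 < m) :
    spiderTarget m (6 * k + 1) = 6 * k + 2 ∧
    spiderTarget m (6 * k + 2) = 6 * k + 4 ∧ spiderTarget m (6 * k + 4) = 6 * k + 1 := by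
  unfold spiderTarget
  refine ⟨?_, ?_, ?_⟩ <;> split_ifs <;> omega

lemma spiderTarget_eq {m i : ℕ} (hm : 6 ≤ m) (h : spiderParent m i ≠ i)
    (h' : spiderParent m (spiderParent m i) ≠ spiderParent m i) :
    spiderTarget m i = spiderParent m (spiderParent m i) := by
  unfold spiderParent spiderTarget at *
  split_ifs at * <;> omega

/-- Color of an edge in terms of its larger and smaller endpoint. -/
def spiderColor (m i j : ℕ) : ℕ := if i = m then j else spiderTarget m i

/-- In each path of length two, one of the edges carries the label of the opposite end. -/
lemma spiderColor_path {m a b c : ℕ} (hm : 6 ≤ m) (ha : a < m) (hc : c < m)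
    (hac : a ≠ c) (h₁ : SpiderAdj m a b) (h₂ : SpiderAdj m b c) :
    spiderColor m (max a b) (min a b) = c ∨ spiderColor m (max b c) (min b c) = a := by
  unfold spiderColor
  rcases h₁ with ⟨l₁, p₁⟩ | ⟨l₁, p₁⟩ <;> rcases h₂ with ⟨l₂, p₂⟩ | ⟨l₂, p₂⟩
  · right
    rw [max_eq_right l₂.le, if_neg hc.ne, spiderTarget_eq hm (by omega) (by rw [p₂]; omega), p₂, p₁]
  · omega
  · have hr := parent_root_of_siblings (i := a) (j := c) hm (by omega) (by omega) hac (by omega)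
    obtain ⟨k, hk, hpa, hka⟩ := eq_of_parent_root (i := a) hm (by omega) hr
    obtain ⟨k', hk', hpc, hkc⟩ := eq_of_parent_root (i := c) hm (by omega) (by rw [p₂, ← p₁, hr])
    obtain rfl : k = k' := by omega
    obtain ⟨t1, t2, t4⟩ := spiderTarget_block hk
    rw [max_eq_left l₁.le, max_eq_right l₂.le, if_neg ha.ne, if_neg hc.ne]
    rcases hka with rfl | rfl | rfl <;> rcases hkc with rfl | rfl | rfl <;> omega
  · left
    rw [max_eq_left l₁.le, if_neg ha.ne, spiderTarget_eq hm (by omega) (by rw [p₁]; omega), p₁, p₂]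

/-- The spider forest together with an apex `m` adjacent to everything. -/
def spiderGraph (m : ℕ) : SimpleGraph (Fin (m + 1)) where
  Adj x y := x ≠ y ∧ ((x : ℕ) = m ∨ (y : ℕ) = m ∨ SpiderAdj m x y)
  symm := ⟨fun x y h => ⟨h.1.symm, by
    rcases h.2 with h | h | h
    · exact Or.inr (Or.inl h)
    · exact Or.inl h
    · exact Or.inr (Or.inr h.symm)⟩⟩
  loopless := ⟨fun x h => h.1 rfl⟩

/-- A proper edge-coloring of the spider graph without rainbow `C₄`. -/
def spiderColoring (m : ℕ) : Sym2 (Fin (m + 1)) → ℕ :=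
  Sym2.lift ⟨fun x y => spiderColor m (max (x : ℕ) y) (min (x : ℕ) y), fun x y => by
    simp only [max_comm (x : ℕ) y, min_comm (x : ℕ) y]⟩

lemma spiderColoring_mk (m : ℕ) (x y : Fin (m + 1)) :
    spiderColoring m s(x, y) = spiderColor m (max (x : ℕ) y) (min (x : ℕ) y) := rfl

lemma spiderTarget_ne {m i : ℕ} (hm : 6 ≤ m) (h : spiderParent m i ≠ i) :
    spiderTarget m i ≠ i ∧ spiderTarget m i ≠ spiderParent m i := by
  unfold spiderParent spiderTarget at *
  split_ifs at * <;> omega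

lemma spiderTarget_ne_of_siblings {m i j : ℕ} (hm : 6 ≤ m) (hi : spiderParent m i ≠ i)
    (hj : spiderParent m j ≠ j) (hij : i ≠ j) (h : spiderParent m i = spiderParent m j) :
    spiderTarget m i ≠ spiderTarget m j := by
  unfold spiderParent spiderTarget at *
  split_ifs at * <;> omega

lemma spiderTarget_ne_parent {m i : ℕ} (hm : 6 ≤ m) (hi : spiderParent m i ≠ i)
    (hj : spiderParent m (spiderParent m i) ≠ spiderParent m i) :
    spiderTarget m i ≠ spiderTarget m (spiderParent m i) := by
  have := (spiderTarget_ne hm hj).2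
  rw [spiderTarget_eq hm hi hj]
  exact this.symm

lemma spiderColoring_ne {m : ℕ} (hm : 6 ≤ m) {x y z : Fin (m + 1)} (hyz : y ≠ z)
    (hy : (spiderGraph m).Adj x y) (hz : (spiderGraph m).Adj x z) :
    spiderColoring m s(x, y) ≠ spiderColoring m s(x, z) := by
  obtain ⟨x, hx⟩ := x
  obtain ⟨y, hy'⟩ := y
  obtain ⟨z, hz'⟩ := z
  obtain ⟨n1, hy⟩ := hy
  obtain ⟨n2, hz⟩ := hz
  simp only [spiderColoring_mk, spiderColor, ne_eq, Fin.mk.injEq] at *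
  have lt_color : ∀ u, SpiderAdj m x u → x < m → u < m →
      (if max x u = m then min x u else spiderTarget m (max x u)) ≠ x := by
    intro u hxu hxm hum
    rw [if_neg (by omega)]
    rcases hxu with ⟨l, p⟩ | ⟨l, p⟩
    · rw [max_eq_right l.le]
      have := (spiderTarget_ne (i := u) hm (by omega)).2
      omega
    · rw [max_eq_left l.le]
      exact (spiderTarget_ne (i := x) hm (by omega)).1
  by_cases hxm : x = m
  · rw [max_eq_left (by omega), max_eq_left (by omega), if_pos hxm, if_pos hxm]
    omega
  by_cases hym : y = m
  · have := lt_color z ((hz.resolve_left hxm).resolve_left (by omega)) (by omega) (by omega)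
    rwa [max_eq_right (a := x) (b := y) (by omega), if_pos hym, min_eq_left (a := x) (b := y)
      (by omega), eq_comm]
  by_cases hzm : z = m
  · have := lt_color y ((hy.resolve_left hxm).resolve_left hym) (by omega) (by omega)
    rwa [max_eq_right (a := x) (b := z) (by omega), if_pos hzm, min_eq_left (a := x) (b := z)
      (by omega)]
  replace hy : SpiderAdj m x y := (hy.resolve_left hxm).resolve_left hym
  replace hz : SpiderAdj m x z := (hz.resolve_left hxm).resolve_left hzm
  rw [if_neg (by omega), if_neg (by omega)]
  rcases hy with ⟨l₁, p₁⟩ | ⟨l₁, p₁⟩ <;> rcases hz with ⟨l₂, p₂⟩ | ⟨l₂, p₂⟩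
  · rw [max_eq_right l₁.le, max_eq_right l₂.le]
    exact spiderTarget_ne_of_siblings hm (by omega) (by omega) hyz (by omega)
  · rw [max_eq_right l₁.le, max_eq_left l₂.le, ← p₁]
    exact spiderTarget_ne_parent hm (by omega) (by rw [p₁]; omega)
  · rw [max_eq_left l₁.le, max_eq_right l₂.le, ← p₂]
    exact (spiderTarget_ne_parent hm (by omega) (by rw [p₂]; omega)).symm
  · omega

lemma spiderColoring_proper {m : ℕ} (hm : 6 ≤ m) :
    ProperEdgeColoring (spiderGraph m) (spiderColoring m) := by
  rintro e₁ h₁ e₂ h₂ hne ⟨v, hv₁, hv₂⟩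
  obtain ⟨y, rfl⟩ := Sym2.mem_iff_exists.1 hv₁
  obtain ⟨z, rfl⟩ := Sym2.mem_iff_exists.1 hv₂
  exact spiderColoring_ne hm (fun h => hne (by rw [h])) h₁ h₂

/-- A four-cycle whose largest vertex is `x` is not rainbow. -/
lemma spiderColoring_cycle {m : ℕ} (hm : 6 ≤ m) {x y z w : Fin (m + 1)} (hyx : y < x)
    (hzx : z < x) (hwx : w < x) (hyw : y ≠ w) (hxy : (spiderGraph m).Adj x y)
    (hyz : (spiderGraph m).Adj y z) (hzw : (spiderGraph m).Adj z w)
    (hwx' : (spiderGraph m).Adj w x) :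
    spiderColoring m s(x, y) = spiderColoring m s(z, w) ∨
      spiderColoring m s(y, z) = spiderColoring m s(w, x) := by
  obtain ⟨x, hx⟩ := x
  obtain ⟨y, hy⟩ := y
  obtain ⟨z, hz⟩ := z
  obtain ⟨w, hw⟩ := w
  simp only [spiderGraph, spiderColoring_mk, Fin.mk_lt_mk, ne_eq, Fin.mk.injEq] at *
  have hyz' : SpiderAdj m y z := by
    rcases hyz.2 with h | h | h
    · omega
    · omega
    · exact h
  have hzw' : SpiderAdj m z w := by
    rcases hzw.2 with h | h | h
    · omega
    · omega
    · exact h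
  by_cases hxm : x = m
  · have := spiderColor_path hm (by omega) (by omega) hyw hyz' hzw'
    rw [max_eq_left hyx.le, min_eq_right hyx.le, max_eq_right hwx.le, min_eq_left hwx.le]
    have e : ∀ i, spiderColor m x i = i := fun i => if_pos hxm
    rw [e, e]
    omega
  · rcases hxy.2 with h | h | h
    · omega
    · omega
    rcases hwx'.2 with h' | h' | h'
    · omega
    · omega
    rcases h with h | h <;> rcases h' with h' | h' <;> omega

lemma spiderColoring_rainbowFree {m : ℕ} (hm : 6 ≤ m) :
    ¬ HasRainbowCycle (spiderGraph m) (spiderColoring m) 4 := by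
  rw [hasRainbowCycle_four_iff]
  rintro ⟨x, y, z, w, ⟨h1, h2, h3, h4, h5, h6⟩, ⟨a1, a2, a3, a4⟩, ⟨-, c2, -, -, c5, -⟩⟩
  have hmax : (y < x ∧ z < x ∧ w < x) ∨ (z < y ∧ w < y ∧ x < y) ∨ (w < z ∧ x < z ∧ y < z) ∨
      (x < w ∧ y < w ∧ z < w) := by omega
  rcases hmax with ⟨l1, l2, l3⟩ | ⟨l1, l2, l3⟩ | ⟨l1, l2, l3⟩ | ⟨l1, l2, l3⟩
  · rcases spiderColoring_cycle hm l1 l2 l3 h5 a1 a2 a3 a4 with h | h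
    exacts [c2 h, c5 h]
  · rcases spiderColoring_cycle hm l1 l2 l3 h2.symm a2 a3 a4 a1 with h | h
    exacts [c5 h, c2 h.symm]
  · rcases spiderColoring_cycle hm l1 l2 l3 h5.symm a3 a4 a1 a2 with h | h
    exacts [c2 h.symm, c5 h.symm]
  · rcases spiderColoring_cycle hm l1 l2 l3 h2 a4 a1 a2 a3 with h | h
    exacts [c5 h.symm, c2 h]

/-- Every vertex of the forest has a neighbor. -/
lemma exists_spiderAdj {m i : ℕ} (hm : 6 ≤ m) (hi : i < m) : ∃ j < m, SpiderAdj m i j := by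
  by_cases h : spiderParent m i = i
  · refine ⟨i + 1, ?_, Or.inl ⟨by omega, ?_⟩⟩ <;> unfold spiderParent at * <;>
      split_ifs at * <;> omega
  · exact ⟨_, (spiderParent_le m i).trans_lt hi, spiderAdj_parent h⟩

/-- The forest contains no four-cycle. -/
lemma spiderAdj_unique_common {m x u y u' : ℕ} (hxy : x ≠ y) (h₁ : SpiderAdj m x u)
    (h₂ : SpiderAdj m y u) (h₃ : SpiderAdj m x u') (h₄ : SpiderAdj m y u') : u = u' := by
  rcases h₁ with h₁ | h₁ <;> rcases h₂ with h₂ | h₂ <;> rcases h₃ with h₃ | h₃ <;>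
    rcases h₄ with h₄ | h₄ <;> omega

/-- No two leaves of the forest share their neighbor. -/
lemma exists_spiderAdj_ne {m x u y : ℕ} (hm : 6 ≤ m) (hx : x < m) (hy : y < m) (hxy : x ≠ y)
    (h₁ : SpiderAdj m x u) (h₂ : SpiderAdj m y u) :
    (∃ w < m, w ≠ u ∧ SpiderAdj m x w) ∨ ∃ w < m, w ≠ u ∧ SpiderAdj m y w := by
  have root : ∀ a, a < m → spiderParent m a = a → ∃ w < m, w ≠ u ∧ SpiderAdj m a w := by
    intro a ha h
    have hk : a = 6 * (a / 6) ∧ 6 * (a / 6) + 5 < m := by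
      unfold spiderParent at h; split_ifs at h <;> omega
    obtain ⟨-, p1, p2, -⟩ := spiderParent_block hk.2
    by_cases hu : u = a + 1
    · exact ⟨a + 2, by omega, by omega, Or.inl ⟨by omega, by rw [hk.1, p2]⟩⟩
    · exact ⟨a + 1, by omega, by omega, Or.inl ⟨by omega, by rw [hk.1, p1]⟩⟩
  have lower : ∀ a, a < m → a < u → ∃ w < m, w ≠ u ∧ SpiderAdj m a w := by
    intro a ha hau
    by_cases h : spiderParent m a = a
    · exact root a ha h
    · exact ⟨spiderParent m a, (spiderParent_le m a).trans_lt ha,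
        ((spiderParent_le m a).trans_lt hau).ne, spiderAdj_parent h⟩
  rcases h₁ with ⟨l₁, p₁⟩ | ⟨l₁, p₁⟩
  · exact Or.inl (lower x hx l₁)
  rcases h₂ with ⟨l₂, p₂⟩ | ⟨l₂, p₂⟩
  · exact Or.inr (lower y hy l₂)
  have hr := parent_root_of_siblings (i := x) (j := y) hm (by omega) (by omega) hxy (by omega)
  obtain ⟨k, hk, hpx, hkx⟩ := eq_of_parent_root (i := x) hm (by omega) hr
  obtain ⟨k', hk', hpy, hky⟩ := eq_of_parent_root (i := y) hm (by omega) (by rw [p₂, ← p₁, hr])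
  obtain rfl : k = k' := by omega
  obtain ⟨-, -, -, q3, -, q5⟩ := spiderParent_block hk
  have h : x = 6 * k + 2 ∨ x = 6 * k + 4 ∨ y = 6 * k + 2 ∨ y = 6 * k + 4 := by omega
  rcases h with h | h | h | h
  · exact Or.inl ⟨6 * k + 3, by omega, by omega, Or.inl ⟨by omega, by omega⟩⟩
  · exact Or.inl ⟨6 * k + 5, by omega, by omega, Or.inl ⟨by omega, by omega⟩⟩
  · exact Or.inr ⟨6 * k + 3, by omega, by omega, Or.inl ⟨by omega, by omega⟩⟩
  · exact Or.inr ⟨6 * k + 5, by omega, by omega, Or.inl ⟨by omega, by omega⟩⟩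

/-- The constraints which a rainbow `C₄`-free proper coloring puts on the labels `κ` of the edges
to the apex and the colors `e` of the edges of the forest. -/
structure SpiderConstraints (m : ℕ) (κ : ℕ → ℕ) (e : ℕ → ℕ → ℕ) : Prop where
  comm : ∀ i j, e i j = e j i
  inj : ∀ i < m, ∀ j < m, κ i = κ j → i = j
  path : ∀ a < m, ∀ b < m, ∀ c < m, a ≠ c → SpiderAdj m a b → SpiderAdj m b c →
    κ a = e b c ∨ κ c = e a b

/-- The edge from `i` to its parent has the label of a vertex other than `i` which is adjacent to
the parent: the grandparent, or a sibling if the parent is a root. -/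
lemma SpiderConstraints.color_parent {m : ℕ} {κ : ℕ → ℕ} {e : ℕ → ℕ → ℕ} (hm : 6 ≤ m)
    (h : SpiderConstraints m κ e) (i : ℕ) (hi : i < m) (hp : spiderParent m i ≠ i) :
    ∃ z < m, z ≠ i ∧ SpiderAdj m z (spiderParent m i) ∧ e i (spiderParent m i) = κ z ∧
      (spiderParent m (spiderParent m i) ≠ spiderParent m i →
        z = spiderParent m (spiderParent m i)) := by
  induction i using Nat.strong_induction_on with
  | _ i ih =>
  have hpm := (spiderParent_le m i).trans_lt hi
  have hlt := lt_of_le_of_ne (spiderParent_le m i) hp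
  by_cases hr : spiderParent m (spiderParent m i) = spiderParent m i
  · obtain ⟨k, hk, hpi, hki⟩ := eq_of_parent_root hm hp hr
    obtain ⟨-, p1, p2, -, p4, -⟩ := spiderParent_block hk
    have a1 : SpiderAdj m (6 * k + 1) (6 * k) := Or.inr ⟨by omega, p1⟩
    have a2 : SpiderAdj m (6 * k + 2) (6 * k) := Or.inr ⟨by omega, p2⟩
    have a4 : SpiderAdj m (6 * k + 4) (6 * k) := Or.inr ⟨by omega, p4⟩
    have r12 := h.path _ (by omega) _ (by omega) _ (by omega) (by omega) a1 a2.symm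
    have r14 := h.path _ (by omega) _ (by omega) _ (by omega) (by omega) a1 a4.symm
    have r24 := h.path _ (by omega) _ (by omega) _ (by omega) (by omega) a2 a4.symm
    have i12 := mt (h.inj (6 * k + 1) (by omega) (6 * k + 2) (by omega)) (by omega)
    have i14 := mt (h.inj (6 * k + 1) (by omega) (6 * k + 4) (by omega)) (by omega)
    have i24 := mt (h.inj (6 * k + 2) (by omega) (6 * k + 4) (by omega)) (by omega)
    rw [h.comm (6 * k)] at r12 r14 r24
    rw [hpi]
    have hk' : 6 * k + 1 < m ∧ 6 * k + 2 < m ∧ 6 * k + 4 < m := by omega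
    rw [hpi] at hr
    rcases hki with rfl | rfl | rfl
    · have : e (6 * k + 1) (6 * k) = κ (6 * k + 2) ∨ e (6 * k + 1) (6 * k) = κ (6 * k + 4) := by
        omega
      rcases this with e' | e'
      · exact ⟨_, hk'.2.1, by omega, a2, e', fun h => absurd hr h⟩
      · exact ⟨_, hk'.2.2, by omega, a4, e', fun h => absurd hr h⟩
    · have : e (6 * k + 2) (6 * k) = κ (6 * k + 1) ∨ e (6 * k + 2) (6 * k) = κ (6 * k + 4) := by
        omega
      rcases this with e' | e'
      · exact ⟨_, hk'.1, by omega, a1, e', fun h => absurd hr h⟩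
      · exact ⟨_, hk'.2.2, by omega, a4, e', fun h => absurd hr h⟩
    · have : e (6 * k + 4) (6 * k) = κ (6 * k + 1) ∨ e (6 * k + 4) (6 * k) = κ (6 * k + 2) := by
        omega
      rcases this with e' | e'
      · exact ⟨_, hk'.1, by omega, a1, e', fun h => absurd hr h⟩
      · exact ⟨_, hk'.2.1, by omega, a2, e', fun h => absurd hr h⟩
  · obtain ⟨z, hz, -, hadj, hcol, -⟩ := ih _ hlt hpm hr
    have hlt' := lt_of_le_of_ne (spiderParent_le m (spiderParent m i)) hr
    have hzi : i ≠ z := by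
      rintro rfl
      rcases hadj with ⟨l, -⟩ | ⟨l, p⟩ <;> omega
    refine ⟨_, hlt'.trans hpm, by omega, (spiderAdj_parent hr).symm, ?_, fun _ => rfl⟩
    rcases h.path i hi _ hpm _ (hlt'.trans hpm) (by omega) (spiderAdj_parent hp)
      (spiderAdj_parent hr) with h' | h'
    · exact absurd (h.inj _ hi _ hz (h'.trans hcol)) hzi
    · exact h'.symm

/-- Each edge of the forest has the label of a vertex adjacent to one of its ends. -/
lemma SpiderConstraints.color_adj {m : ℕ} {κ : ℕ → ℕ} {e : ℕ → ℕ → ℕ} (hm : 6 ≤ m)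
    (h : SpiderConstraints m κ e) {x u : ℕ} (hx : x < m) (hu : u < m) (hxu : SpiderAdj m x u) :
    ∃ z < m, (SpiderAdj m z x ∨ SpiderAdj m z u) ∧ e x u = κ z := by
  rcases hxu with ⟨l, p⟩ | ⟨l, p⟩
  · obtain ⟨z, hz, -, ha, hc, -⟩ := h.color_parent hm u hu (by omega)
    rw [p] at ha hc
    exact ⟨z, hz, Or.inl ha, by rw [h.comm, hc]⟩
  · obtain ⟨z, hz, -, ha, hc, -⟩ := h.color_parent hm x hx (by omega)
    rw [p] at ha hc
    exact ⟨z, hz, Or.inr ha, hc⟩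

/-- In a path of length two, only one of the edges has the label of the opposite end. -/
lemma SpiderConstraints.path_unique {m : ℕ} {κ : ℕ → ℕ} {e : ℕ → ℕ → ℕ} (hm : 6 ≤ m)
    (h : SpiderConstraints m κ e) {x u y : ℕ} (hx : x < m) (hu : u < m) (hy : y < m) (hxy : x ≠ y)
    (hxu : SpiderAdj m x u) (hyu : SpiderAdj m y u) : ¬ (κ y = e x u ∧ κ x = e y u) := by
  rintro ⟨h₁, h₂⟩
  have grandchild : ∀ x y, x < m → y < m → x ≠ y → x < u → spiderParent m u = x →
      y ≠ u → spiderParent m y = u → κ y = e x u → False := by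
    intro x y hx hy hxy l p hyu q h₁
    obtain ⟨z, hz, -, ha, hc, hpp⟩ := h.color_parent hm u hu (by omega)
    rw [p] at hc ha
    obtain rfl := h.inj _ hy _ hz (by rw [h₁, h.comm, hc])
    rcases ha with ha | ha
    · have := spiderParent_le m y
      omega
    · omega
  rcases hxu with ⟨l₁, p₁⟩ | ⟨l₁, p₁⟩ <;> rcases hyu with ⟨l₂, p₂⟩ | ⟨l₂, p₂⟩
  · omega
  · exact grandchild x y hx hy hxy l₁ p₁ (by omega) p₂ h₁
  · exact grandchild y x hy hx hxy.symm l₂ p₂ (by omega) p₁ h₂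
  · have hr := parent_root_of_siblings (i := x) (j := y) hm (by omega) (by omega) hxy (by omega)
    obtain ⟨k, hk, hpx, hkx⟩ := eq_of_parent_root (i := x) hm (by omega) hr
    obtain ⟨k', hk', hpy, hky⟩ := eq_of_parent_root (i := y) hm (by omega) (by rw [p₂, ← p₁, hr])
    obtain rfl : k = k' := by omega
    obtain ⟨-, q1, q2, -, q4, -⟩ := spiderParent_block hk
    obtain ⟨w, hw, hwp, hwk, hwx, hwy⟩ :
        ∃ w < m, spiderParent m w = 6 * k ∧ 6 * k < w ∧ w ≠ x ∧ w ≠ y := by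
      by_cases w1 : x ≠ 6 * k + 1 ∧ y ≠ 6 * k + 1
      · exact ⟨6 * k + 1, by omega, q1, by omega, by omega, by omega⟩
      by_cases w2 : x ≠ 6 * k + 2 ∧ y ≠ 6 * k + 2
      · exact ⟨6 * k + 2, by omega, q2, by omega, by omega, by omega⟩
      · exact ⟨6 * k + 4, by omega, q4, by omega, by omega, by omega⟩
    obtain rfl : u = 6 * k := by omega
    have hwu : SpiderAdj m w (6 * k) := Or.inr ⟨hwk, hwp⟩
    have r₁ := h.path x hx _ hu w hw hwx.symm (Or.inr ⟨l₁, p₁⟩) hwu.symm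
    have r₂ := h.path y hy _ hu w hw hwy.symm (Or.inr ⟨l₂, p₂⟩) hwu.symm
    have i₁ := mt (h.inj x hx y hy) hxy
    have i₂ := mt (h.inj x hx w hw) hwx.symm
    have i₃ := mt (h.inj y hy w hw) hwy.symm
    rw [h.comm (6 * k)] at r₁ r₂
    omega

/-- A new edge `xy` forces an unresolved path of length two. -/
lemma SpiderConstraints.false_of_edge {m : ℕ} {κ : ℕ → ℕ} {e : ℕ → ℕ → ℕ} (hm : 6 ≤ m)
    (h : SpiderConstraints m κ e) {x y : ℕ} (hx : x < m) (hy : y < m) (hxy : x ≠ y)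
    (hna : ¬ SpiderAdj m x y)
    (hpx : ∀ u < m, SpiderAdj m x u → κ u = e x y ∨ κ y = e x u)
    (hpy : ∀ u < m, SpiderAdj m y u → κ u = e x y ∨ κ x = e y u) : False := by
  have hna' : ¬ SpiderAdj m y x := fun h => hna h.symm
  have fx : ∀ u < m, SpiderAdj m x u → ¬ SpiderAdj m y u → κ u = e x y := by
    intro u hu hxu hyu
    refine (hpx u hu hxu).resolve_right fun hc => ?_
    obtain ⟨z, hz, ha, hc'⟩ := h.color_adj hm hx hu hxu
    obtain rfl := h.inj y hy z hz (hc.trans hc')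
    tauto
  have fy : ∀ u < m, SpiderAdj m y u → ¬ SpiderAdj m x u → κ u = e x y := by
    intro u hu hyu hxu
    refine (hpy u hu hyu).resolve_right fun hc => ?_
    obtain ⟨z, hz, ha, hc'⟩ := h.color_adj hm hy hu hyu
    obtain rfl := h.inj x hx z hz (hc.trans hc')
    tauto
  by_cases hcommon : ∃ u < m, SpiderAdj m x u ∧ SpiderAdj m y u
  · obtain ⟨u, hu, hxu, hyu⟩ := hcommon
    obtain ⟨w, hw, hwu, hwe⟩ : ∃ w < m, w ≠ u ∧ κ w = e x y := by
      rcases exists_spiderAdj_ne hm hx hy hxy hxu hyu with ⟨w, hw, hwu, hxw⟩ | ⟨w, hw, hwu, hyw⟩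
      · exact ⟨w, hw, hwu, fx w hw hxw fun hyw =>
          hwu (spiderAdj_unique_common hxy hxu hyu hxw hyw).symm⟩
      · exact ⟨w, hw, hwu, fy w hw hyw fun hxw =>
          hwu (spiderAdj_unique_common hxy hxu hyu hxw hyw).symm⟩
    have hue : κ u ≠ e x y := fun h' => hwu (h.inj w hw u hu (hwe.trans h'.symm))
    exact h.path_unique hm hx hu hy hxy hxu hyu
      ⟨(hpx u hu hxu).resolve_left hue, (hpy u hu hyu).resolve_left hue⟩
  · push Not at hcommon
    obtain ⟨u, hu, hxu⟩ := exists_spiderAdj hm hx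
    obtain ⟨w, hw, hyw⟩ := exists_spiderAdj hm hy
    have hue := fx u hu hxu (hcommon u hu hxu)
    have hwe := fy w hw hyw fun hxw => hcommon w hw hxw hyw
    obtain rfl := h.inj u hu w hw (hue.trans hwe.symm)
    exact hcommon u hu hxu hyw

/-- In a rainbow `C₄`-free proper coloring, a four-cycle has two opposite edges of equal color. -/
lemma ProperEdgeColoring.opposite_eq {V : Type*} {G : SimpleGraph V} {c : Sym2 V → ℕ}
    (hc : ProperEdgeColoring G c) (hr : ¬ HasRainbowCycle G c 4) {v a b d : V}
    (hvb : v ≠ b) (had : a ≠ d) (hva : G.Adj v a) (hab : G.Adj a b) (hbd : G.Adj b d)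
    (hdv : G.Adj d v) : c s(v, a) = c s(b, d) ∨ c s(v, d) = c s(a, b) := by
  by_contra! hne
  refine hr ((hasRainbowCycle_four_iff G c).2 ⟨v, a, b, d,
    ⟨hva.ne, hvb, hdv.ne', hab.ne, had, hbd.ne⟩, ⟨hva, hab, hbd, hdv⟩, ?_, hne.1, ?_, ?_, ?_, ?_⟩)
  · exact hc _ hva _ hab (by simp [hva.ne, hvb]) ⟨a, by simp, by simp⟩
  · exact hc _ hva _ hdv (by simp [hdv.ne', had]) ⟨v, by simp, by simp⟩
  · exact hc _ hab _ hbd (by simp [hab.ne, had]) ⟨b, by simp, by simp⟩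
  · rw [Sym2.eq_swap (a := d)]
    exact hne.2.symm
  · exact hc _ hbd _ hdv (by simp [hbd.ne, hvb.symm]) ⟨d, by simp, by simp⟩

lemma spiderGraph_rainbowSat {m : ℕ} (hm : 6 ≤ m) : RainbowSat (spiderGraph m) 4 := by
  refine ⟨⟨spiderColoring m, spiderColoring_proper hm, spiderColoring_rainbowFree hm⟩, ?_⟩
  intro x y hxy hna c hc
  by_contra hr
  set G := spiderGraph m ⊔ SimpleGraph.fromEdgeSet {s(x, y)} with hG
  obtain ⟨hxm, hym, hna⟩ : (x : ℕ) ≠ m ∧ (y : ℕ) ≠ m ∧ ¬ SpiderAdj m x y := by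
    refine ⟨fun h => hna ⟨hxy, Or.inl h⟩, fun h => hna ⟨hxy, Or.inr (Or.inl h)⟩,
      fun h => hna ⟨hxy, Or.inr (Or.inr h)⟩⟩
  have hGxy : G.Adj x y := by simp [hG, hxy]
  let f : ℕ → Fin (m + 1) := Fin.ofNat (m + 1)
  have fval : ∀ i, i ≤ m → ((f i : Fin (m + 1)) : ℕ) = i := fun i hi =>
    Nat.mod_eq_of_lt (by omega)
  have fx : f x = x := Fin.ext (fval _ (by omega))
  have fy : f y = y := Fin.ext (fval _ (by omega))
  have finj : ∀ i j, i ≤ m → j ≤ m → f i = f j → i = j := fun i j hi hj h => by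
    rw [← fval i hi, ← fval j hj, h]
  have hapex : ∀ i < m, G.Adj (f m) (f i) := fun i hi => Or.inl
    ⟨fun h => hi.ne' (finj _ _ le_rfl hi.le h), Or.inl (fval m le_rfl)⟩
  have hforest : ∀ i < m, ∀ j < m, SpiderAdj m i j → G.Adj (f i) (f j) := fun i hi j hj h =>
    Or.inl ⟨fun h' => h.ne (finj _ _ hi.le hj.le h'), Or.inr (Or.inr (by
      rwa [fval i hi.le, fval j hj.le]))⟩
  have hpath : ∀ a < m, ∀ b < m, ∀ d < m, a ≠ d → G.Adj (f a) (f b) → G.Adj (f b) (f d) →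
      c s(f m, f a) = c s(f b, f d) ∨ c s(f m, f d) = c s(f a, f b) :=
    fun a ha b hb d hd had h₁ h₂ => hc.opposite_eq hr
      (fun h => hb.ne' (finj _ _ le_rfl hb.le h)) (fun h => had (finj _ _ ha.le hd.le h))
      (hapex a ha) h₁ h₂ (hapex d hd).symm
  have hcon : SpiderConstraints m (fun i => c s(f m, f i)) (fun i j => c s(f i, f j)) := by
    refine ⟨fun i j => by rw [Sym2.eq_swap], fun i hi j hj h => ?_, ?_⟩
    · by_contra hij
      refine hc _ (hapex i hi) _ (hapex j hj) ?_ ⟨f m, by simp, by simp⟩ h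
      rw [ne_eq, Sym2.congr_right]
      exact fun h' => hij (finj _ _ hi.le hj.le h')
    · exact fun a ha b hb d hd had h₁ h₂ => hpath a ha b hb d hd had (hforest a ha b hb h₁)
        (hforest b hb d hd h₂)
  have hx : (x : ℕ) < m := by omega
  have hy : (y : ℕ) < m := by omega
  refine hcon.false_of_edge hm hx hy (fun h => hxy (Fin.ext h)) hna ?_ ?_
  · intro u hu hxu
    have huy : u ≠ y := by rintro rfl; exact hna hxu
    have := hpath u hu x hx y hy huy (hforest u hu x hx hxu.symm) (by rwa [fx, fy])
    rwa [Sym2.eq_swap (a := f u)] at this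
  · intro u hu hyu
    have hux : u ≠ x := by rintro rfl; exact hna hyu.symm
    have := hpath u hu y hy x hx hux (hforest u hu y hy hyu.symm) (by rw [fx, fy]; exact hGxy.symm)
    rwa [Sym2.eq_swap (a := f u), Sym2.eq_swap (a := f y) (b := f x)] at this

/-- There are at least `m / 6` roots. -/
lemma card_nonroots_le (m : ℕ) :
    ((Finset.range m).filter (fun i => spiderParent m i ≠ i)).card ≤ m - m / 6 := by
  have hroots : m / 6 ≤ ((Finset.range m).filter (fun i => spiderParent m i = i)).card := by
    rw [← Finset.card_range (m / 6)]
    refine Finset.card_le_card_of_injOn (fun k => 6 * k) (fun k hk => ?_)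
      (fun a _ b _ h => by simpa using h)
    simp only [Finset.coe_range, Set.mem_Iio, Finset.coe_filter, Finset.mem_range,
      Set.mem_ofPred_eq] at hk ⊢
    exact ⟨by omega, (spiderParent_block (by omega)).1⟩
  have := Finset.card_filter_add_card_filter_not (s := Finset.range m)
    (fun i => spiderParent m i = i)
  rw [Finset.card_range] at this
  simp only [ne_eq]
  omega

lemma spiderGraph_ncard_le (m : ℕ) : (spiderGraph m).edgeSet.ncard ≤ m + (m - m / 6) := by
  classical
  let f : ℕ → Fin (m + 1) := Fin.ofNat (m + 1)
  have fval : ∀ x : Fin (m + 1), f x = x := fun x =>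
    Fin.ext (Nat.mod_eq_of_lt x.isLt)
  have fapex : ∀ x : Fin (m + 1), (x : ℕ) = m → f m = x := fun x hx =>
    Fin.ext ((Nat.mod_eq_of_lt (Nat.lt_succ_self m)).trans hx.symm)
  let S := (Finset.range m).image (fun i => s(f i, f m)) ∪
    ((Finset.range m).filter (fun i => spiderParent m i ≠ i)).image
      (fun i => s(f i, f (spiderParent m i)))
  have hsub : (spiderGraph m).edgeSet ⊆ (S : Set (Sym2 (Fin (m + 1)))) := by
    intro e
    induction e using Sym2.ind with
    | _ x y =>
    rintro ⟨hne, h⟩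
    dsimp only at hne h
    have hne' : (x : ℕ) ≠ y := fun h => hne (Fin.ext h)
    simp only [S, Finset.coe_union, Finset.coe_image, Set.mem_union, Set.mem_image,
      Finset.coe_range, Set.mem_Iio, Finset.coe_filter, Finset.mem_range, Set.mem_ofPred_eq]
    by_cases hx : (x : ℕ) = m
    · exact Or.inl ⟨y, by omega, by rw [fapex x hx, fval, Sym2.eq_swap]⟩
    by_cases hy : (y : ℕ) = m
    · exact Or.inl ⟨x, by omega, by rw [fapex y hy, fval]⟩
    rcases (h.resolve_left hx).resolve_left hy with ⟨l, p⟩ | ⟨l, p⟩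
    · exact Or.inr ⟨y, ⟨by omega, by omega⟩, by rw [p, fval, fval, Sym2.eq_swap]⟩
    · exact Or.inr ⟨x, ⟨by omega, by omega⟩, by rw [p, fval, fval]⟩
  calc (spiderGraph m).edgeSet.ncard ≤ (S : Set (Sym2 (Fin (m + 1)))).ncard :=
        Set.ncard_le_ncard hsub (Finset.finite_toSet S)
    _ = S.card := Set.ncard_coe_finset S
    _ ≤ _ := (Finset.card_union_le _ _).trans (add_le_add
        (Finset.card_image_le.trans_eq (Finset.card_range m))
        (Finset.card_image_le.trans (card_nonroots_le m)))

/-- There is an absolute constant `C` such that for every `n ≥ 7` there exists an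
`n`-vertex rainbow `C₄`-saturated graph with at most `11n/6 + C` edges; consequently
`sat*(n, C₄) ≤ 11n/6 + O(1)`. -/
theorem rainbow_sat_C4_upper : ∃ C : ℝ, ∀ n : ℕ, 7 ≤ n →
    ∃ G : SimpleGraph (Fin n), RainbowSat G 4 ∧
      (G.edgeSet.ncard : ℝ) ≤ 11 / 6 * n + C := by
  refine ⟨0, fun n hn => ?_⟩
  obtain ⟨m, rfl⟩ : ∃ m, n = m + 1 := ⟨n - 1, by omega⟩
  refine ⟨spiderGraph m, spiderGraph_rainbowSat (by omega), ?_⟩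
  have h₁ := spiderGraph_ncard_le m
  have h₂ : 6 * (spiderGraph m).edgeSet.ncard ≤ 11 * (m + 1) := by omega
  have h₃ : (6 : ℝ) * (spiderGraph m).edgeSet.ncard ≤ 11 * ((m + 1 : ℕ) : ℝ) := by
    exact_mod_cast h₂
  linarith
end

section
/- For every real ε with 0 < ε < 11/45, there exists n_0 ∈ ℕ such that for all n ≥ n_0, every n-vertex rainbow C_4-saturated graph has more than (11/6 − ε)·n edges; consequently sat*(n, C_4) > (11/6 − ε)·n for all n ≥ n_0. -/
set_option linter.unusedSectionVars false

namespace RainbowC4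

section Coloring

variable {V : Type*} {G : SimpleGraph V}

/-- A proper edge-coloring in which every 4-cycle repeats a color on opposite edges. -/
structure GoodColoring (G : SimpleGraph V) (c : Sym2 V → ℕ) : Prop where
  proper : ∀ {a b b' : V}, G.Adj a b → G.Adj a b' → b ≠ b' → c s(a, b) ≠ c s(a, b')
  cycle : ∀ {p q r s : V}, G.Adj p q → G.Adj q r → G.Adj r s → G.Adj s p → p ≠ r → q ≠ s →
    c s(p, q) = c s(r, s) ∨ c s(q, r) = c s(s, p)

theorem properEdgeColoring_of_forall {c : Sym2 V → ℕ}
    (h : ∀ a b b' : V, G.Adj a b → G.Adj a b' → b ≠ b' → c s(a, b) ≠ c s(a, b')) :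
    ProperEdgeColoring G c := by
  intro e₁ he₁ e₂ he₂ hne hv
  obtain ⟨v, hv1, hv2⟩ := hv
  obtain ⟨a, rfl⟩ := Sym2.mem_iff_exists.1 hv1
  obtain ⟨b, rfl⟩ := Sym2.mem_iff_exists.1 hv2
  refine h v a b he₁ he₂ ?_
  rintro rfl
  exact hne rfl

theorem hasRainbowCycle_four {c : Sym2 V → ℕ} {p q r s : V}
    (hp : ∀ {a b b' : V}, G.Adj a b → G.Adj a b' → b ≠ b' → c s(a, b) ≠ c s(a, b'))
    (hpq : G.Adj p q) (hqr : G.Adj q r) (hrs : G.Adj r s) (hsp : G.Adj s p)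
    (hpr : p ≠ r) (hqs : q ≠ s)
    (h1 : c s(p, q) ≠ c s(r, s)) (h2 : c s(q, r) ≠ c s(s, p)) : HasRainbowCycle G c 4 := by
  have e1 : c s(p, q) ≠ c s(q, r) := by rw [Sym2.eq_swap]; exact hp hpq.symm hqr hpr
  have e2 : c s(q, r) ≠ c s(r, s) := by
    rw [Sym2.eq_swap (a := q)]; exact hp hqr.symm hrs hqs
  have e3 : c s(r, s) ≠ c s(s, p) := by
    rw [Sym2.eq_swap (a := r)]; exact hp hrs.symm hsp hpr.symm
  have e4 : c s(s, p) ≠ c s(p, q) := by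
    rw [Sym2.eq_swap (a := s)]; exact hp hsp.symm hpq hqs.symm
  have n1 := hpq.ne
  have n2 := hqr.ne
  have n3 := hrs.ne
  have n4 := hsp.ne
  refine ⟨fun i : Fin 4 => ![p, q, r, s] i, ?_, ?_, ?_⟩
  · intro (i : Fin 4) (j : Fin 4) hij
    change (![p, q, r, s] i) = ![p, q, r, s] j at hij
    fin_cases i <;> fin_cases j <;> first | rfl | (exfalso; simp_all)
  · intro (i : Fin 4)
    change G.Adj (![p, q, r, s] i) (![p, q, r, s] (i + 1))
    fin_cases i
    · exact hpq
    · exact hqr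
    · exact hrs
    · exact hsp
  · intro (i : Fin 4) (j : Fin 4) hij
    change c s(![p, q, r, s] i, ![p, q, r, s] (i + 1)) =
      c s(![p, q, r, s] j, ![p, q, r, s] (j + 1)) at hij
    fin_cases i <;> fin_cases j
    · rfl
    · exact absurd hij e1
    · exact absurd hij h1
    · exact absurd hij.symm e4
    · exact absurd hij.symm e1
    · rfl
    · exact absurd hij e2
    · exact absurd hij h2
    · exact absurd hij.symm h1
    · exact absurd hij.symm e2
    · rfl
    · exact absurd hij e3
    · exact absurd hij e4
    · exact absurd hij.symm h2
    · exact absurd hij.symm e3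
    · rfl

theorem exists_goodColoring (hG : RainbowSat G 4) : ∃ c, GoodColoring G c := by
  obtain ⟨⟨c, hc, hr⟩, -⟩ := hG
  have hp : ∀ {a b b' : V}, G.Adj a b → G.Adj a b' → b ≠ b' → c s(a, b) ≠ c s(a, b') := by
    intro a b b' hab hab' hne
    refine hc _ hab _ hab' ?_ ⟨a, by simp, by simp⟩
    intro h
    exact hne (Sym2.congr_right.1 h)
  refine ⟨c, hp, ?_⟩
  intro p q r s hpq hqr hrs hsp hpr hqs
  by_contra! hcon
  exact hr (hasRainbowCycle_four hp hpq hqr hrs hsp hpr hqs hcon.1 hcon.2)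

theorem GoodColoring.not_hasRainbowCycle {c : Sym2 V → ℕ} (hc : GoodColoring G c) {p q r s : V}
    (hpq : G.Adj p q) (hqr : G.Adj q r) (hrs : G.Adj r s) (hsp : G.Adj s p)
    (hpr : p ≠ r) (hqs : q ≠ s) (h1 : c s(p, q) ≠ c s(r, s)) (h2 : c s(q, r) ≠ c s(s, p)) :
    False :=
  (hc.cycle hpq hqr hrs hsp hpr hqs).elim h1 h2

/-- Adding a nonedge `xy` with an admissible color `γ` to a good coloring creates a rainbow
4-cycle, hence a suitable path of length three from `x` to `y`. -/
theorem exists_path (hG : RainbowSat G 4) {c : Sym2 V → ℕ} (hc : GoodColoring G c) {x y : V}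
    (hxy : x ≠ y) (hnadj : ¬ G.Adj x y) (γ : ℕ) (hx : ∀ a, G.Adj x a → c s(x, a) ≠ γ)
    (hy : ∀ b, G.Adj y b → c s(y, b) ≠ γ) :
    ∃ a b, G.Adj x a ∧ G.Adj a b ∧ G.Adj y b ∧ c s(x, a) ≠ c s(y, b) ∧ c s(a, b) ≠ γ := by
  classical
  set H := G ⊔ SimpleGraph.fromEdgeSet {s(x, y)} with hH
  set c' : Sym2 V → ℕ := Function.update c s(x, y) γ with hc'
  have hHadj : ∀ a b, H.Adj a b ↔ G.Adj a b ∨ s(a, b) = s(x, y) := by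
    intro a b
    simp only [hH, SimpleGraph.sup_adj, SimpleGraph.fromEdgeSet_adj, Set.mem_singleton_iff]
    constructor
    · rintro (h | h)
      exacts [Or.inl h, Or.inr h.1]
    · rintro (h | h)
      · exact Or.inl h
      · refine Or.inr ⟨h, ?_⟩
        rintro rfl
        rcases Sym2.eq_iff.1 h with ⟨h1, h2⟩ | ⟨h1, h2⟩ <;> exact hxy (by simp_all)
  have hval : ∀ a b, G.Adj a b → c' s(a, b) = c s(a, b) := by
    intro a b hab
    refine Function.update_of_ne ?_ _ _
    intro h
    rcases Sym2.eq_iff.1 h with ⟨rfl, rfl⟩ | ⟨rfl, rfl⟩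
    exacts [hnadj hab, hnadj hab.symm]
  have hval' : ∀ e, e = s(x, y) → c' e = γ := by
    rintro e rfl
    simp [hc']
  have hγ : ∀ a b b', G.Adj a b → s(a, b') = s(x, y) → c s(a, b) ≠ γ := by
    intro a b b' hab h
    rcases Sym2.eq_iff.1 h with ⟨rfl, rfl⟩ | ⟨rfl, rfl⟩
    exacts [hx _ hab, hy _ hab]
  have hprop : ProperEdgeColoring H c' := by
    refine properEdgeColoring_of_forall ?_
    intro a b b' hab hab' hne
    rcases (hHadj _ _).1 hab with h | h <;> rcases (hHadj _ _).1 hab' with h' | h'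
    · rw [hval _ _ h, hval _ _ h']
      exact hc.proper h h' hne
    · rw [hval _ _ h, hval' _ h']
      exact hγ _ _ _ h h'
    · rw [hval' _ h, hval _ _ h']
      exact (hγ _ _ _ h' h).symm
    · exact absurd (Sym2.congr_right.1 (h.trans h'.symm)) hne
  obtain ⟨f, hf, hadj, hcol⟩ := hG.2 x y hxy hnadj c' hprop
  have key : ∀ i : ZMod 4, s(f i, f (i + 1)) = s(x, y) →
      G.Adj (f (i + 1)) (f (i + 2)) ∧ G.Adj (f (i + 2)) (f (i + 3)) ∧ G.Adj (f (i + 3)) (f i) ∧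
      c s(f (i + 1), f (i + 2)) ≠ c s(f (i + 3), f i) ∧ c s(f (i + 2), f (i + 3)) ≠ γ := by
    intro i hi
    have e1 : i + 1 + 1 = i + 2 := by ring
    have e2 : i + 2 + 1 = i + 3 := by ring
    have e3 : i + 3 + 1 = i := by
      have : (4 : ZMod 4) = 0 := by decide
      linear_combination this
    have hG' : ∀ j, j ≠ i → G.Adj (f j) (f (j + 1)) := by
      intro j hj
      rcases (hHadj _ _).1 (hadj j) with h | h
      · exact h
      · refine absurd (hcol ?_) hj
        change c' _ = c' _
        rw [h, hi]
    have n1 : i + 1 ≠ i := (by decide : ∀ i : ZMod 4, i + 1 ≠ i) i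
    have n2 : i + 2 ≠ i := (by decide : ∀ i : ZMod 4, i + 2 ≠ i) i
    have n3 : i + 3 ≠ i := (by decide : ∀ i : ZMod 4, i + 3 ≠ i) i
    have n4 : i + 1 ≠ i + 3 := (by decide : ∀ i : ZMod 4, i + 1 ≠ i + 3) i
    have a1 := hG' _ n1
    have a2 := hG' _ n2
    have a3 := hG' _ n3
    have c1 : c' s(f (i + 1), f (i + 1 + 1)) ≠ c' s(f (i + 3), f (i + 3 + 1)) :=
      fun h => n4 (hcol h)
    have c2 : c' s(f (i + 2), f (i + 2 + 1)) ≠ c' s(f i, f (i + 1)) := fun h => n2 (hcol h)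
    rw [hval _ _ a1, hval _ _ a3] at c1
    rw [hval _ _ a2, hval' _ hi] at c2
    rw [e1] at a1 c1
    rw [e2] at a2 c2
    rw [e3] at a3 c1
    exact ⟨a1, a2, a3, c1, c2⟩
  by_cases hex : ∃ i : ZMod 4, s(f i, f (i + 1)) = s(x, y)
  · obtain ⟨i, hi⟩ := hex
    obtain ⟨a1, a2, a3, c1, c2⟩ := key i hi
    rcases Sym2.eq_iff.1 hi with ⟨h1, h2⟩ | ⟨h1, h2⟩
    · rw [h1] at a3 c1
      rw [h2] at a1 c1
      refine ⟨f (i + 3), f (i + 2), a3.symm, a2.symm, a1, ?_, ?_⟩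
      · rw [Sym2.eq_swap]; exact c1.symm
      · rw [Sym2.eq_swap]; exact c2
    · rw [h1] at a3 c1
      rw [h2] at a1 c1
      refine ⟨f (i + 2), f (i + 3), a1, a2, a3.symm, ?_, c2⟩
      rw [Sym2.eq_swap (a := y)]; exact c1
  · exfalso
    have hG' : ∀ j, G.Adj (f j) (f (j + 1)) := by
      intro j
      rcases (hHadj _ _).1 (hadj j) with h | h
      · exact h
      · exact absurd ⟨j, h⟩ hex
    have e1 : c s(f 0, f 1) ≠ c s(f 2, f 3) := by
      have := fun h => (by decide : (0 : ZMod 4) ≠ 2) (hcol h)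
      change c' s(f 0, f (0 + 1)) ≠ c' s(f 2, f (2 + 1)) at this
      rw [hval _ _ (hG' 0), hval _ _ (hG' 2)] at this
      exact this
    have e2 : c s(f 1, f 2) ≠ c s(f 3, f 0) := by
      have := fun h => (by decide : (1 : ZMod 4) ≠ 3) (hcol h)
      change c' s(f 1, f (1 + 1)) ≠ c' s(f 3, f (3 + 1)) at this
      rw [hval _ _ (hG' 1), hval _ _ (hG' 3)] at this
      exact this
    exact hc.not_hasRainbowCycle (hG' 0) (hG' 1) (hG' 2) (hG' 3)
      (fun h => absurd (hf h) (by decide)) (fun h => absurd (hf h) (by decide)) e1 e2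

/-- Recoloring a single edge. -/
theorem GoodColoring.update [DecidableEq V] {c : Sym2 V → ℕ} (hc : GoodColoring G c) {a b : V}
    {κ : ℕ} (ha : ∀ d, G.Adj a d → d ≠ b → c s(a, d) ≠ κ)
    (hb : ∀ d, G.Adj b d → d ≠ a → c s(b, d) ≠ κ)
    (hcyc : ∀ q p, G.Adj b q → G.Adj q p → G.Adj p a → q ≠ a → p ≠ b →
      c s(q, p) = κ ∨ c s(b, q) = c s(p, a)) :
    GoodColoring G (Function.update c s(a, b) κ) := by
  have hval : ∀ e, e ≠ s(a, b) → Function.update c s(a, b) κ e = c e :=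
    fun e he => Function.update_of_ne he _ _
  have hval' : Function.update c s(a, b) κ s(a, b) = κ := Function.update_self ..
  have hcyc' : ∀ p q r s, s(p, q) = s(a, b) → G.Adj q r → G.Adj r s → G.Adj s p → p ≠ r → q ≠ s →
      c s(r, s) = κ ∨ c s(q, r) = c s(s, p) := by
    intro p q r s h hqr hrs hsp hpr hqs
    rcases Sym2.eq_iff.1 h with ⟨rfl, rfl⟩ | ⟨rfl, rfl⟩
    · exact hcyc r s hqr hrs hsp hpr.symm hqs.symm
    · have := hcyc s r hsp.symm hrs.symm hqr.symm hqs.symm hpr.symm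
      rw [Sym2.eq_swap (a := s), Sym2.eq_swap (a := p), Sym2.eq_swap (a := r) (b := q)] at this
      exact this.imp id Eq.symm
  have hprop : ∀ {d e e' : V}, G.Adj d e → G.Adj d e' → e ≠ e' → s(d, e) = s(a, b) →
      c s(d, e') ≠ κ := by
    intro d e e' hde hde' hne h
    rcases Sym2.eq_iff.1 h with ⟨rfl, rfl⟩ | ⟨rfl, rfl⟩
    · exact ha _ hde' hne.symm
    · exact hb _ hde' hne.symm
  constructor
  · intro d e e' hde hde' hne
    by_cases h : s(d, e) = s(a, b)
    · have h' : s(d, e') ≠ s(a, b) := fun h' => hne (Sym2.congr_right.1 (h.trans h'.symm))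
      rw [hval _ h', h, hval']
      exact (hprop hde hde' hne h).symm
    · by_cases h' : s(d, e') = s(a, b)
      · rw [hval _ h, h', hval']
        exact hprop hde' hde hne.symm h'
      · rw [hval _ h, hval _ h']
        exact hc.proper hde hde' hne
  · intro p q r s hpq hqr hrs hsp hpr hqs
    have n1 : s(p, q) ≠ s(q, r) := fun h => by
      rcases Sym2.eq_iff.1 h with ⟨h1, h2⟩ | ⟨h1, h2⟩
      exacts [hpq.ne h1, hpr h1]
    have n2 : s(q, r) ≠ s(r, s) := fun h => by
      rcases Sym2.eq_iff.1 h with ⟨h1, h2⟩ | ⟨h1, h2⟩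
      exacts [hqr.ne h1, hqs h1]
    have n3 : s(r, s) ≠ s(s, p) := fun h => by
      rcases Sym2.eq_iff.1 h with ⟨h1, h2⟩ | ⟨h1, h2⟩
      exacts [hrs.ne h1, hpr h1.symm]
    have n4 : s(s, p) ≠ s(p, q) := fun h => by
      rcases Sym2.eq_iff.1 h with ⟨h1, h2⟩ | ⟨h1, h2⟩
      exacts [hsp.ne h1, hqs h1.symm]
    have n5 : s(p, q) ≠ s(r, s) := fun h => by
      rcases Sym2.eq_iff.1 h with ⟨h1, h2⟩ | ⟨h1, h2⟩
      exacts [hpr h1, hsp.ne h1.symm]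
    have n6 : s(q, r) ≠ s(s, p) := fun h => by
      rcases Sym2.eq_iff.1 h with ⟨h1, h2⟩ | ⟨h1, h2⟩
      exacts [hqs h1, hpq.ne h1.symm]
    by_cases h1 : s(p, q) = s(a, b)
    · rw [h1] at n1 n4 n5
      rw [hval _ n5.symm, hval _ n1.symm, hval _ n4, h1, hval']
      exact (hcyc' p q r s h1 hqr hrs hsp hpr hqs).imp Eq.symm id
    by_cases h2 : s(q, r) = s(a, b)
    · rw [h2] at n2 n6
      rw [hval _ h1, hval _ n2.symm, hval _ n6.symm, h2, hval']
      exact (hcyc' q r s p h2 hrs hsp hpq hqs hpr.symm).symm.imp Eq.symm Eq.symm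
    by_cases h3 : s(r, s) = s(a, b)
    · rw [h3] at n3
      rw [hval _ h1, hval _ h2, hval _ n3.symm, h3, hval']
      exact (hcyc' r s p q h3 hsp hpq hqr hpr.symm hqs.symm).imp id Eq.symm
    by_cases h4 : s(s, p) = s(a, b)
    · rw [hval _ h1, hval _ h2, hval _ h3, h4, hval']
      exact (hcyc' s p q r h4 hpq hqr hrs hqs.symm hpr).symm
    rw [hval _ h1, hval _ h2, hval _ h3, hval _ h4]
    exact hc.cycle hpq hqr hrs hsp hpr hqs

end Coloring

section Structure

variable {V : Type*} [Fintype V] [DecidableEq V] {G : SimpleGraph V} [DecidableRel G.Adj] {D : ℕ}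

/-- Neighbors of degree less than `D`. -/
def lowNbrs (G : SimpleGraph V) [DecidableRel G.Adj] (D : ℕ) (x : V) : Finset V :=
  (G.neighborFinset x).filter (fun y => G.degree y < D)

/-- Neighbors of degree at least `D`. -/
def hubNbrs (G : SimpleGraph V) [DecidableRel G.Adj] (D : ℕ) (x : V) : Finset V :=
  (G.neighborFinset x).filter (fun y => ¬ G.degree y < D)

theorem mem_lowNbrs {x y : V} : y ∈ lowNbrs G D x ↔ G.Adj x y ∧ G.degree y < D := by
  simp [lowNbrs]

theorem mem_hubNbrs {x y : V} : y ∈ hubNbrs G D x ↔ G.Adj x y ∧ D ≤ G.degree y := by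
  simp [hubNbrs]

theorem card_lowNbrs_add_card_hubNbrs (x : V) :
    (lowNbrs G D x).card + (hubNbrs G D x).card = G.degree x := by
  rw [lowNbrs, hubNbrs, Finset.card_filter_add_card_filter_not, G.card_neighborFinset_eq_degree]

/-- Ball of radius one along low-degree vertices. -/
def lowBall (G : SimpleGraph V) [DecidableRel G.Adj] (D : ℕ) (x : V) : Finset V :=
  insert x (lowNbrs G D x)

/-- Ball of radius three along low-degree vertices. -/
def lowBallThree (G : SimpleGraph V) [DecidableRel G.Adj] (D : ℕ) (x : V) : Finset V :=
  ((lowBall G D x).biUnion (lowBall G D)).biUnion (lowBall G D)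

theorem mem_lowBall {x y : V} : y ∈ lowBall G D x ↔ y = x ∨ (G.Adj x y ∧ G.degree y < D) := by
  rw [lowBall, Finset.mem_insert, mem_lowNbrs]

theorem card_lowBall_le {x : V} (hx : G.degree x < D) : (lowBall G D x).card ≤ D := by
  have h1 := Finset.card_insert_le x (lowNbrs G D x)
  have h2 := card_lowNbrs_add_card_hubNbrs (G := G) (D := D) x
  rw [lowBall]
  omega

theorem degree_lt_of_mem_lowBall {x y : V} (hx : G.degree x < D) (hy : y ∈ lowBall G D x) :
    G.degree y < D := by
  rcases mem_lowBall.1 hy with rfl | h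
  exacts [hx, h.2]

theorem card_lowBallThree_le {x : V} (hx : G.degree x < D) :
    (lowBallThree G D x).card ≤ D ^ 3 := by
  have h1 : ((lowBall G D x).biUnion (lowBall G D)).card ≤ D * D :=
    (Finset.card_biUnion_le_card_mul _ _ D
      fun y hy => card_lowBall_le (degree_lt_of_mem_lowBall hx hy)).trans
      (Nat.mul_le_mul_right _ (card_lowBall_le hx))
  have h2 : (lowBallThree G D x).card ≤ ((lowBall G D x).biUnion (lowBall G D)).card * D := by
    refine Finset.card_biUnion_le_card_mul _ _ D fun y hy => card_lowBall_le ?_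
    obtain ⟨z, hz, hy⟩ := Finset.mem_biUnion.1 hy
    exact degree_lt_of_mem_lowBall (degree_lt_of_mem_lowBall hx hz) hy
  calc _ ≤ _ := h2
    _ ≤ D * D * D := Nat.mul_le_mul_right _ h1
    _ = D ^ 3 := by ring

theorem mem_lowBallThree {x a b y : V} (ha : a ∈ lowBall G D x) (hb : b ∈ lowBall G D a)
    (hy : y ∈ lowBall G D b) : y ∈ lowBallThree G D x :=
  Finset.mem_biUnion.2 ⟨b, Finset.mem_biUnion.2 ⟨a, ha, hb⟩, hy⟩

/-- `x` is a vertex of degree two whose neighbors are the hub `v` and the low-degree vertex `z`,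
and `h` is the only hub adjacent to `z`. -/
structure Pendant (G : SimpleGraph V) [DecidableRel G.Adj] (D : ℕ) (x v z h : V) : Prop where
  low : G.degree x < D
  adj_hub : G.Adj x v
  adj_mid : G.Adj x z
  eq_or_eq : ∀ {a}, G.Adj x a → a = v ∨ a = z
  hub : D ≤ G.degree v
  mid_low : G.degree z < D
  mid_adj : G.Adj z h
  hub' : D ≤ G.degree h
  mid_unique : ∀ {b}, G.Adj z b → D ≤ G.degree b → b = h

theorem ne_of_low_hub {a b : V} (ha : G.degree a < D) (hb : D ≤ G.degree b) : a ≠ b := by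
  rintro rfl
  omega

/-- Facts about two pendant vertices which are far apart. -/
structure Apart (G : SimpleGraph V) (x z y u : V) : Prop where
  ne : x ≠ y
  not_adj : ¬ G.Adj x y
  ne_mid : y ≠ z
  ne_mid' : x ≠ u
  mid_ne : z ≠ u
  mid_not_adj : ¬ G.Adj z u

theorem Pendant.apart {x v z h y w u k : V} (hx : Pendant G D x v z h) (hy : Pendant G D y w u k)
    (hfar : y ∉ lowBallThree G D x) : Apart G x z y u := by
  have self : ∀ a, a ∈ lowBall G D a := fun a => mem_lowBall.2 (Or.inl rfl)
  have hnadj : ¬ G.Adj x y := fun h =>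
    hfar (mem_lowBallThree (self x) (self x) (mem_lowBall.2 (Or.inr ⟨h, hy.low⟩)))
  refine ⟨?_, hnadj, ?_, ?_, ?_, ?_⟩
  · rintro rfl
    exact hfar (mem_lowBallThree (self _) (self _) (self _))
  · rintro rfl
    exact hnadj hx.adj_mid
  · rintro rfl
    exact hnadj hy.adj_mid.symm
  · rintro rfl
    exact hfar (mem_lowBallThree (mem_lowBall.2 (Or.inr ⟨hx.adj_mid, hx.mid_low⟩)) (self _)
      (mem_lowBall.2 (Or.inr ⟨hy.adj_mid.symm, hy.low⟩)))
  · intro h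
    exact hfar (mem_lowBallThree (mem_lowBall.2 (Or.inr ⟨hx.adj_mid, hx.mid_low⟩))
      (mem_lowBall.2 (Or.inr ⟨h, hy.mid_low⟩))
      (mem_lowBall.2 (Or.inr ⟨hy.adj_mid.symm, hy.low⟩)))

theorem exists_fresh (c : Sym2 V → ℕ) : ∃ γ, ∀ e, c e ≠ γ := by
  obtain ⟨γ, hγ⟩ := Infinite.exists_notMem_finset (Finset.univ.image c)
  exact ⟨γ, fun e he => hγ (Finset.mem_image.2 ⟨e, Finset.mem_univ _, he⟩)⟩

/-- A vertex cannot be the middle vertex of two pendants of the same type. -/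
theorem Pendant.eq_of_same (hG : RainbowSat G 4) {a b v z : V} (ha : Pendant G D a v z v)
    (hb : Pendant G D b v z v) : a = b := by
  obtain ⟨c, hc⟩ := exists_goodColoring hG
  by_contra hne
  have hnadj : ¬ G.Adj a b := by
    intro h
    rcases ha.eq_or_eq h with rfl | rfl
    · exact ne_of_low_hub hb.low ha.hub rfl
    · exact G.irrefl hb.adj_mid
  have hcol : ∀ {x}, Pendant G D x v z v → ∀ d, G.Adj x d → c s(x, d) ≠ c s(v, z) := by
    intro x hx d hd
    rcases hx.eq_or_eq hd with rfl | rfl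
    · rw [Sym2.eq_swap]
      exact hc.proper hd.symm hx.mid_adj.symm hx.adj_mid.ne
    · rw [Sym2.eq_swap, Sym2.eq_swap (a := v)]
      exact hc.proper hd.symm hx.mid_adj hx.adj_hub.ne
  obtain ⟨p, q, hp, hpq, hq, h1, h2⟩ :=
    exists_path hG hc hne hnadj (c s(v, z)) (hcol ha) (hcol hb)
  rcases ha.eq_or_eq hp with rfl | rfl <;> rcases hb.eq_or_eq hq with rfl | rfl
  · exact G.irrefl hpq
  · exact h2 rfl
  · exact h2 (by rw [Sym2.eq_swap])
  · exact G.irrefl hpq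

/-- Two far apart pendants with the same hub cannot both have a middle vertex attached to a
different hub. -/
theorem Pendant.not_apart_of_same_hub (hG : RainbowSat G 4) {x v z h y u k : V}
    (hx : Pendant G D x v z h) (hy : Pendant G D y v u k) (hh : h ≠ v) (hk : k ≠ v)
    (hap : Apart G x z y u) : False := by
  obtain ⟨c, hc⟩ := exists_goodColoring hG
  obtain ⟨γ, hγ⟩ := exists_fresh c
  obtain ⟨p, q, hp, hpq, hq, -, -⟩ :=
    exists_path hG hc hap.ne hap.not_adj γ (fun _ _ => hγ _) (fun _ _ => hγ _)
  rcases hx.eq_or_eq hp with rfl | rfl <;> rcases hy.eq_or_eq hq with rfl | rfl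
  · exact G.irrefl hpq
  · exact hk (hy.mid_unique hpq.symm hx.hub).symm
  · exact hh (hx.mid_unique hpq hx.hub).symm
  · exact hap.mid_not_adj hpq

/-- Two far apart pendants with different hubs, neither middle vertex being attached to the hub of
the other pendant: the color of the edge between the hubs must occur on one of the pendants. -/
theorem Pendant.not_apart_of_ne_hub (hG : RainbowSat G 4) {c : Sym2 V → ℕ} (hc : GoodColoring G c)
    {x v z h y w u k : V} (hx : Pendant G D x v z h) (hy : Pendant G D y w u k)
    (hh : h ≠ w) (hk : k ≠ v) (hap : Apart G x z y u)
    (hcol : G.Adj v w → c s(v, w) ≠ c s(x, z) ∧ c s(v, w) ≠ c s(y, u)) : False := by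
  have hxw := ne_of_low_hub hx.low hy.hub
  have hyv := ne_of_low_hub hy.low hx.hub
  obtain ⟨γ, hγx, hγy, hγ⟩ : ∃ γ, (∀ a, G.Adj x a → c s(x, a) ≠ γ) ∧
      (∀ b, G.Adj y b → c s(y, b) ≠ γ) ∧ (G.Adj v w → c s(v, w) = γ) := by
    by_cases hvw : G.Adj v w
    · refine ⟨c s(v, w), ?_, ?_, fun _ => rfl⟩
      · intro a ha
        rcases hx.eq_or_eq ha with rfl | rfl
        · rw [Sym2.eq_swap]
          exact hc.proper ha.symm hvw hxw
        · exact (hcol hvw).1.symm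
      · intro a ha
        rcases hy.eq_or_eq ha with rfl | rfl
        · rw [Sym2.eq_swap, Sym2.eq_swap (a := v)]
          exact hc.proper ha.symm hvw.symm hyv
        · exact (hcol hvw).2.symm
    · obtain ⟨γ, hγ⟩ := exists_fresh c
      exact ⟨γ, fun _ _ => hγ _, fun _ _ => hγ _, fun h => absurd h hvw⟩
  obtain ⟨p, q, hp, hpq, hq, -, h2⟩ := exists_path hG hc hap.ne hap.not_adj γ hγx hγy
  rcases hx.eq_or_eq hp with rfl | rfl <;> rcases hy.eq_or_eq hq with rfl | rfl
  · exact h2 (hγ hpq)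
  · exact hk (hy.mid_unique hpq.symm hx.hub).symm
  · exact hh (hx.mid_unique hpq hy.hub).symm
  · exact hap.mid_not_adj hpq

/-- The edge `xz` of a pendant can be recolored to differ from a given other edge at the hub. -/
theorem Pendant.exists_recoloring {c : Sym2 V → ℕ} (hc : GoodColoring G c) {x v z w : V}
    (hx : Pendant G D x v z v) (hw : D ≤ G.degree w) (hvw : G.Adj v w) :
    ∃ c', GoodColoring G c' ∧ (∀ e, e ≠ s(x, z) → c' e = c e) ∧ c' s(v, w) ≠ c' s(x, z) := by
  by_cases hne : c s(v, w) = c s(x, z)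
  · obtain ⟨κ, hκ⟩ := exists_fresh c
    refine ⟨Function.update c s(x, z) κ, hc.update (fun _ _ _ => hκ _) (fun _ _ _ => hκ _) ?_,
      fun e he => Function.update_of_ne he _ _, ?_⟩
    · intro q p hzq hqp hpx hqx hpz
      rcases hx.eq_or_eq hpx.symm with rfl | rfl
      · right
        rcases hc.cycle hx.adj_mid hzq hqp hpx hqx.symm hpz.symm with h | h
        · exfalso
          have hqw : q = w := by
            by_contra hqw
            refine hc.proper hqp.symm hvw hqw ?_
            rw [hne, h, Sym2.eq_swap]
          subst hqw
          exact hvw.ne (hx.mid_unique hzq hw).symm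
        · exact h
      · exact absurd rfl hpz
    · rw [Function.update_self, Function.update_of_ne]
      · exact hκ _
      · intro h
        have : x ∈ s(v, w) := h ▸ Sym2.mem_mk_left x z
        rcases Sym2.mem_iff.1 this with h | h
        · exact hx.adj_hub.ne h
        · exact ne_of_low_hub hx.low hw h
  · exact ⟨c, hc, fun _ _ => rfl, hne⟩

theorem Pendant.not_apart_of_pure (hG : RainbowSat G 4) {x v z y w u : V}
    (hx : Pendant G D x v z v) (hy : Pendant G D y w u w) (hvw : v ≠ w)
    (hap : Apart G x z y u) : False := by
  obtain ⟨c, hc⟩ := exists_goodColoring hG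
  by_cases hadj : G.Adj v w
  · obtain ⟨c₁, hc₁, -, hne₁⟩ := hx.exists_recoloring hc hy.hub hadj
    obtain ⟨c₂, hc₂, heq₂, hne₂⟩ := hy.exists_recoloring hc₁ hx.hub hadj.symm
    have e1 : s(v, w) ≠ s(y, u) := by
      intro h
      have : v ∈ s(y, u) := h ▸ Sym2.mem_mk_left v w
      rcases Sym2.mem_iff.1 this with h | h
      · exact ne_of_low_hub hy.low hx.hub h.symm
      · exact ne_of_low_hub hy.mid_low hx.hub h.symm
    have e2 : s(x, z) ≠ s(y, u) := by
      intro h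
      have : x ∈ s(y, u) := h ▸ Sym2.mem_mk_left x z
      rcases Sym2.mem_iff.1 this with h | h
      exacts [hap.ne h, hap.ne_mid' h]
    refine Pendant.not_apart_of_ne_hub hG hc₂ hx hy hvw hvw.symm hap fun _ => ⟨?_, ?_⟩
    · rwa [heq₂ _ e1, heq₂ _ e2]
    · rwa [Sym2.eq_swap (a := v)]
  · exact Pendant.not_apart_of_ne_hub hG hc hx hy hvw hvw.symm hap fun h => absurd h hadj

end Structure

section Gadgets

variable {V : Type*} [Fintype V] [DecidableEq V] {G : SimpleGraph V} [DecidableRel G.Adj] {D : ℕ}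

open Classical in
/-- The pendants with hub `v` whose middle vertex is attached to `v` only. -/
noncomputable def pureSet (G : SimpleGraph V) [DecidableRel G.Adj] (D : ℕ) (v : V) : Finset V :=
  Finset.univ.filter fun y => ∃ u, Pendant G D y v u v

theorem mem_pureSet {v y : V} : y ∈ pureSet G D v ↔ ∃ u, Pendant G D y v u v := by
  simp [pureSet]

/-- If the pendant edge `xz` lies in no 4-cycle restricting its color, then there are few pendants
at the hub. -/
theorem Pendant.false_of_flexible (hG : RainbowSat G 4) {c : Sym2 V → ℕ} (hc : GoodColoring G c)
    {x v z : V} (hx : Pendant G D x v z v)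
    (hflex : ∀ q, G.Adj z q → G.Adj v q → q ≠ x → c s(z, q) = c s(v, x))
    (hL : D ^ 3 + D < (pureSet G D v).card) : False := by
  have hcard : D < (pureSet G D v \ lowBallThree G D x).card := by
    have h1 := Finset.le_card_sdiff (lowBallThree G D x) (pureSet G D v)
    have h2 := card_lowBallThree_le hx.low
    omega
  obtain ⟨y, hy, hyc⟩ : ∃ y ∈ pureSet G D v \ lowBallThree G D x,
      ∀ q, G.Adj z q → c s(z, q) ≠ c s(v, y) := by
    by_contra! hcon
    have hsub : (pureSet G D v \ lowBallThree G D x).image (fun y => c s(v, y)) ⊆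
        (G.neighborFinset z).image (fun q => c s(z, q)) := by
      intro k hk
      obtain ⟨y, hy, rfl⟩ := Finset.mem_image.1 hk
      obtain ⟨q, hq, h⟩ := hcon y hy
      exact Finset.mem_image.2 ⟨q, by simpa using hq, h⟩
    have hinj : Set.InjOn (fun y => c s(v, y)) (pureSet G D v \ lowBallThree G D x : Finset V) := by
      intro a ha b hb hab
      obtain ⟨_, ha'⟩ := mem_pureSet.1 (Finset.mem_sdiff.1 (Finset.mem_coe.1 ha)).1
      obtain ⟨_, hb'⟩ := mem_pureSet.1 (Finset.mem_sdiff.1 (Finset.mem_coe.1 hb)).1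
      by_contra hne
      exact hc.proper ha'.adj_hub.symm hb'.adj_hub.symm hne hab
    have h1 := Finset.card_le_card hsub
    rw [Finset.card_image_of_injOn hinj] at h1
    have h2 := h1.trans Finset.card_image_le
    rw [G.card_neighborFinset_eq_degree] at h2
    have := hx.mid_low
    omega
  obtain ⟨hyL, hyfar⟩ := Finset.mem_sdiff.1 hy
  obtain ⟨u, hyp⟩ := mem_pureSet.1 hyL
  have hap := hx.apart hyp hyfar
  have hcol : ∀ {a b}, G.Adj v a → G.Adj v b → a ≠ b → c s(a, v) ≠ c s(v, b) := by
    intro a b ha hb hne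
    rw [Sym2.eq_swap]
    exact hc.proper ha hb hne
  have hxne : ∀ b, G.Adj x b → b ≠ z → c s(x, b) ≠ c s(v, y) := by
    intro b hb hbz
    rcases hx.eq_or_eq hb with rfl | rfl
    · exact hcol hx.adj_hub.symm hyp.adj_hub.symm hap.ne
    · exact absurd rfl hbz
  have hc' : GoodColoring G (Function.update c s(x, z) (c s(v, y))) := by
    refine hc.update hxne (fun d hd _ => hyc d hd) ?_
    intro q p hzq hqp hpx hqx hpz
    rcases hx.eq_or_eq hpx.symm with rfl | rfl
    · exact Or.inr (hflex q hzq hqp.symm hqx)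
    · exact absurd rfl hpz
  have hval : ∀ {a b}, x ≠ a → x ≠ b →
      Function.update c s(x, z) (c s(v, y)) s(a, b) = c s(a, b) := by
    intro a b ha hb
    refine Function.update_of_ne ?_ _ _
    intro h
    rcases Sym2.eq_iff.1 h with ⟨h1, h2⟩ | ⟨h1, h2⟩
    exacts [ha h1.symm, hb h2.symm]
  set c' := Function.update c s(x, z) (c s(v, y)) with hc'def
  have hxz : c' s(x, z) = c s(v, y) := Function.update_self ..
  have hyv : c' s(y, v) = c s(v, y) := by
    rw [hval hap.ne hx.adj_hub.ne, Sym2.eq_swap]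
  have hyu : y ≠ u := hyp.adj_mid.ne
  have hvu : G.Adj v u := hyp.mid_adj.symm
  have hvuval : c' s(v, u) = c s(v, u) := hval hx.adj_hub.ne hap.ne_mid'
  obtain ⟨p, q, hp, hpq, hq, h1, h2⟩ := exists_path hG hc' hap.ne hap.not_adj (c' s(v, u)) (by
      intro a ha
      rcases hx.eq_or_eq ha with rfl | rfl
      · rw [Sym2.eq_swap]
        exact hc'.proper ha.symm hvu hap.ne_mid'
      · rw [hxz, hvuval]
        exact hc.proper hyp.adj_hub.symm hvu hyu) (by
      intro b hb
      rcases hyp.eq_or_eq hb with rfl | rfl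
      · rw [Sym2.eq_swap]
        exact hc'.proper hb.symm hvu hyu
      · rw [Sym2.eq_swap, Sym2.eq_swap (a := v)]
        exact hc'.proper hb.symm hvu.symm hyp.adj_hub.ne)
  rcases hx.eq_or_eq hp with rfl | rfl <;> rcases hyp.eq_or_eq hq with rfl | rfl
  · exact G.irrefl hpq
  · exact h2 rfl
  · exact h1 (hxz.trans hyv.symm)
  · exact hap.mid_not_adj hpq

/-- No pendant has a middle vertex of degree two. -/
theorem Pendant.false_of_mid_degree_two (hG : RainbowSat G 4) {x v z : V}
    (hx : Pendant G D x v z v) (hz : ∀ a, G.Adj z a → a = v ∨ a = x)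
    (hL : D ^ 3 + D < (pureSet G D v).card) : False := by
  obtain ⟨c, hc⟩ := exists_goodColoring hG
  refine hx.false_of_flexible hG hc ?_ hL
  intro q hq hvq hne
  rcases hz q hq with rfl | rfl
  · exact absurd hvq G.irrefl
  · exact absurd rfl hne

/-- Colors around a pendant whose middle vertex has degree three. -/
theorem Pendant.mid_degree_three (hG : RainbowSat G 4) {c : Sym2 V → ℕ} (hc : GoodColoring G c)
    {x v z q : V} (hx : Pendant G D x v z v) (hz : ∀ a, G.Adj z a → a = v ∨ a = x ∨ a = q)
    (hL : D ^ 3 + D < (pureSet G D v).card) :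
    G.Adj v q ∧ c s(x, z) = c s(q, v) ∧ c s(z, q) ≠ c s(v, x) := by
  by_contra hcon
  refine hx.false_of_flexible hG hc ?_ hL
  intro p hp hvp hne
  rcases hz p hp with rfl | rfl | rfl
  · exact absurd hvp G.irrefl
  · exact absurd rfl hne
  · by_contra hzp
    rcases hc.cycle hx.adj_mid hp hvp.symm hx.adj_hub.symm hne.symm hx.mid_adj.ne with h | h
    · exact hcon ⟨hvp, h, hzp⟩
    · exact hzp h

/-- Two middle vertices of degree three are not adjacent. -/
theorem Pendant.false_of_mid_adj (hG : RainbowSat G 4) {x v z x' z' : V}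
    (hx : Pendant G D x v z v) (hx' : Pendant G D x' v z' v) (hzz : G.Adj z z')
    (hxz : x ≠ z') (hz : ∀ a, G.Adj z a → a = v ∨ a = x ∨ a = z')
    (hz' : ∀ a, G.Adj z' a → a = v ∨ a = x' ∨ a = z)
    (hL : D ^ 3 + D < (pureSet G D v).card) : False := by
  obtain ⟨c, hc⟩ := exists_goodColoring hG
  obtain ⟨-, e1, -⟩ := hx.mid_degree_three hG hc hz hL
  obtain ⟨-, e2, -⟩ := hx'.mid_degree_three hG hc hz' hL
  have hvx := hx.adj_hub.symm
  have hvx' := hx'.adj_hub.symm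
  have hvz := hx.mid_adj.symm
  have hvz' := hx'.mid_adj.symm
  have hc' : GoodColoring G (Function.update c s(z, z') (c s(v, x))) := by
    refine hc.update ?_ ?_ ?_
    · intro d hd hne
      rcases hz d hd with rfl | rfl | rfl
      · rw [Sym2.eq_swap]
        exact hc.proper hvz hvx hx.adj_mid.ne.symm
      · rw [Sym2.eq_swap, Sym2.eq_swap (a := v)]
        exact hc.proper hd.symm hx.adj_hub hvz.ne.symm
      · exact absurd rfl hne
    · intro d hd hne
      rcases hz' d hd with rfl | rfl | rfl
      · rw [Sym2.eq_swap]
        exact hc.proper hvz' hvx hxz.symm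
      · rw [Sym2.eq_swap, e2, Sym2.eq_swap]
        exact hc.proper hvz hvx hx.adj_mid.ne.symm
      · exact absurd rfl hne
    · intro q p hq hqp hp hqz hpz
      rcases hz' q hq with rfl | rfl | rfl
      · rcases hz p hp.symm with rfl | rfl | rfl
        · exact absurd hqp G.irrefl
        · exact Or.inl rfl
        · exact absurd rfl hpz
      · rcases hz p hp.symm with rfl | rfl | rfl
        · right
          rw [Sym2.eq_swap, e2, Sym2.eq_swap]
        · rcases hx.eq_or_eq hqp.symm with rfl | rfl
          · exact absurd rfl hx'.adj_hub.ne
          · exact absurd rfl hqz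
        · exact absurd rfl hpz
      · exact absurd rfl hqz
  obtain ⟨-, -, h⟩ := hx.mid_degree_three hG hc' hz hL
  apply h
  rw [Function.update_self, Function.update_of_ne]
  intro h
  have : v ∈ s(z, z') := h ▸ Sym2.mem_mk_left v x
  exact (Sym2.mem_iff.1 this).elim (fun h => hvz.ne h) (fun h => hvz'.ne h)

/-- Two middle vertices of degree three have no common neighbor of degree three with a single
hub. -/
theorem Pendant.false_of_common_nbr (hG : RainbowSat G 4) {x v z x' z' m : V}
    (hx : Pendant G D x v z v) (hx' : Pendant G D x' v z' v) (hzm : G.Adj m z) (hzm' : G.Adj m z')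
    (hne : z ≠ z') (hz : ∀ a, G.Adj z a → a = v ∨ a = x ∨ a = m)
    (hz' : ∀ a, G.Adj z' a → a = v ∨ a = x' ∨ a = m)
    (hm : G.Adj m v → ∀ a, G.Adj m a → a = v ∨ a = z ∨ a = z')
    (hxm : x ≠ m) (hxm' : x' ≠ m)
    (hL : D ^ 3 + D < (pureSet G D v).card) : False := by
  obtain ⟨c, hc, hmz⟩ : ∃ c, GoodColoring G c ∧ c s(m, z') = c s(z, v) := by
    obtain ⟨c, hc⟩ := exists_goodColoring hG
    obtain ⟨hvm, e1, -⟩ := hx.mid_degree_three hG hc hz hL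
    obtain ⟨-, e2, -⟩ := hx'.mid_degree_three hG hc hz' hL
    have hm' := hm hvm.symm
    rcases hc.cycle hx.mid_adj.symm hzm.symm hzm' hx'.mid_adj hvm.ne hne with h | h
    · exact ⟨c, hc, by rw [← h, Sym2.eq_swap]⟩
    · refine ⟨Function.update c s(m, z') (c s(z, v)), hc.update ?_ ?_ ?_, ?_⟩
      · intro d hd hdz
        rcases hm' d hd with rfl | rfl | rfl
        · rw [Sym2.eq_swap, Sym2.eq_swap (a := z)]
          exact hc.proper hvm hx.mid_adj.symm hzm.ne
        · rw [Sym2.eq_swap]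
          exact hc.proper hd.symm hx.mid_adj hvm.ne.symm
        · exact absurd rfl hdz
      · intro d hd hdm
        rcases hz' d hd with rfl | rfl | rfl
        · rw [Sym2.eq_swap, Sym2.eq_swap (a := z)]
          exact hc.proper hd.symm hx.mid_adj.symm hne.symm
        · rw [Sym2.eq_swap, e2, Sym2.eq_swap, Sym2.eq_swap (a := z)]
          exact hc.proper hvm hx.mid_adj.symm hzm.ne
        · exact absurd rfl hdm
      · intro q p hq hqp hp hqm hpz
        rcases hz' q hq with rfl | rfl | rfl
        · rcases hm' p hp.symm with rfl | rfl | rfl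
          · exact absurd hqp G.irrefl
          · exact Or.inl (by rw [Sym2.eq_swap])
          · exact absurd rfl hpz
        · rcases hm' p hp.symm with rfl | rfl | rfl
          · right
            rw [Sym2.eq_swap, e2, Sym2.eq_swap]
          · rcases hx'.eq_or_eq hqp with h | h
            · exact absurd h hx.mid_adj.ne
            · exact absurd h hpz
          · exact absurd rfl hpz
        · exact absurd rfl hqm
      · rw [Function.update_self, Function.update_of_ne]
        intro h
        have : v ∈ s(m, z') := h ▸ Sym2.mem_mk_right z v
        rcases Sym2.mem_iff.1 this with h | h
        exacts [hvm.ne h, hx'.mid_adj.ne h.symm]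
  obtain ⟨hvm, e1, -⟩ := hx.mid_degree_three hG hc hz hL
  have hm' := hm hvm.symm
  have hc' : GoodColoring G (Function.update c s(z, m) (c s(v, x))) := by
    refine hc.update ?_ ?_ ?_
    · intro d hd hdm
      rcases hz d hd with rfl | rfl | rfl
      · rw [Sym2.eq_swap]
        exact hc.proper hd.symm hx.adj_hub.symm hx.adj_mid.ne.symm
      · rw [Sym2.eq_swap, Sym2.eq_swap (a := v)]
        exact hc.proper hd.symm hx.adj_hub hx.mid_adj.ne
      · exact absurd rfl hdm
    · intro d hd hdz
      rcases hm' d hd with rfl | rfl | rfl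
      · rw [Sym2.eq_swap]
        exact hc.proper hvm hx.adj_hub.symm hxm.symm
      · exact absurd rfl hdz
      · rw [hmz, Sym2.eq_swap]
        exact hc.proper hx.mid_adj.symm hx.adj_hub.symm hx.adj_mid.ne.symm
    · intro q p hq hqp hp hqz hpm
      rcases hm' q hq with rfl | rfl | rfl
      · rcases hz p hp.symm with rfl | rfl | rfl
        · exact absurd hqp G.irrefl
        · exact Or.inl rfl
        · exact absurd rfl hpm
      · exact absurd rfl hqz
      · rcases hz p hp.symm with rfl | rfl | rfl
        · right
          rw [hmz, Sym2.eq_swap]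
        · rcases hx.eq_or_eq hqp.symm with h | h
          · exact absurd h hx'.mid_adj.ne
          · exact absurd h hqz
        · exact absurd rfl hpm
  obtain ⟨-, -, h⟩ := hx.mid_degree_three hG hc' hz hL
  apply h
  rw [Function.update_self, Function.update_of_ne]
  intro h
  have : v ∈ s(z, m) := h ▸ Sym2.mem_mk_left v x
  rcases Sym2.mem_iff.1 this with h | h
  exacts [hx.mid_adj.ne h.symm, hvm.ne h]

end Gadgets

section Counting

variable {V : Type*} [Fintype V] [DecidableEq V] {G : SimpleGraph V} [DecidableRel G.Adj] {D : ℕ}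

open Classical in
/-- The pendants with hub `w` whose middle vertex is attached to another hub. -/
noncomputable def mixedClass (G : SimpleGraph V) [DecidableRel G.Adj] (D : ℕ) (w : V) : Finset V :=
  Finset.univ.filter fun y => ∃ u k, k ≠ w ∧ Pendant G D y w u k

open Classical in
/-- The pendants whose middle vertex is attached to another hub. -/
noncomputable def mixedSet (G : SimpleGraph V) [DecidableRel G.Adj] (D : ℕ) : Finset V :=
  Finset.univ.filter fun y => ∃ w u k, k ≠ w ∧ Pendant G D y w u k

/-- The low-degree vertices without hubs. -/
def hublessSet (G : SimpleGraph V) [DecidableRel G.Adj] (D : ℕ) : Finset V :=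
  Finset.univ.filter fun y => G.degree y < D ∧ hubNbrs G D y = ∅

/-- The vertices of degree one attached to a hub. -/
def leafSet (G : SimpleGraph V) [DecidableRel G.Adj] (D : ℕ) : Finset V :=
  Finset.univ.filter fun y => G.degree y < D ∧ lowNbrs G D y = ∅ ∧ (hubNbrs G D y).card = 1

theorem mem_mixedClass {w y : V} :
    y ∈ mixedClass G D w ↔ ∃ u k, k ≠ w ∧ Pendant G D y w u k := by
  simp [mixedClass]

theorem mem_mixedSet {y : V} :
    y ∈ mixedSet G D ↔ ∃ w u k, k ≠ w ∧ Pendant G D y w u k := by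
  simp [mixedSet]

theorem card_mixedClass_le (hG : RainbowSat G 4) (w : V) : (mixedClass G D w).card ≤ D ^ 3 := by
  rcases (mixedClass G D w).eq_empty_or_nonempty with h | ⟨x, hx⟩
  · simp [h]
  · obtain ⟨z, h, hh, hp⟩ := mem_mixedClass.1 hx
    refine (Finset.card_le_card fun y hy => ?_).trans (card_lowBallThree_le hp.low)
    obtain ⟨u, k, hk, hq⟩ := mem_mixedClass.1 hy
    by_contra hfar
    exact Pendant.not_apart_of_same_hub hG hp hq hh hk (hp.apart hq hfar)

theorem card_le_of_semicomplete {α : Type*} [DecidableEq α] (S : Finset α) (r : α → α → Prop)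
    [DecidableRel r] (k : ℕ) (hr : ∀ x ∈ S, ∀ y ∈ S, r x y ∨ r y x)
    (hk : ∀ x ∈ S, (S.filter fun y => r x y).card ≤ k) : S.card ≤ 2 * k := by
  have h1 : ∀ x ∈ S, S.card ≤ (S.filter fun y => r x y).card + (S.filter fun y => r y x).card := by
    intro x hx
    have : S ⊆ (S.filter fun y => r x y) ∪ (S.filter fun y => r y x) := by
      intro y hy
      rcases hr x hx y hy with h | h
      · exact Finset.mem_union_left _ (Finset.mem_filter.2 ⟨hy, h⟩)
      · exact Finset.mem_union_right _ (Finset.mem_filter.2 ⟨hy, h⟩)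
    exact (Finset.card_le_card this).trans (Finset.card_union_le _ _)
  have h2 := Finset.sum_le_sum h1
  rw [Finset.sum_add_distrib] at h2
  have h3 : ∑ x ∈ S, (S.filter fun y => r y x).card = ∑ x ∈ S, (S.filter fun y => r x y).card :=
    (Finset.sum_card_bipartiteAbove_eq_sum_card_bipartiteBelow r).symm
  have h4 : ∑ x ∈ S, (S.filter fun y => r x y).card ≤ S.card * k := by
    simpa using Finset.sum_le_card_nsmul S _ k hk
  rw [h3, Finset.sum_const, smul_eq_mul] at h2
  by_contra! hlt
  have : 0 < S.card := by omega
  nlinarith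

theorem card_mixedSet_le (hG : RainbowSat G 4) : (mixedSet G D).card ≤ 6 * D ^ 3 := by
  classical
  obtain ⟨c, hc⟩ := exists_goodColoring hG
  let r : V → V → Prop := fun x y => y ∈ lowBallThree G D x ∨
    ∃ v z h w u k, h ≠ v ∧ k ≠ w ∧ Pendant G D x v z h ∧ Pendant G D y w u k ∧
      (h = w ∨ (G.Adj v w ∧ c s(v, w) = c s(x, z)))
  have key := card_le_of_semicomplete (mixedSet G D) r (3 * D ^ 3) ?_ ?_
  · omega
  · intro x hx y hy
    obtain ⟨v, z, h, hh, hp⟩ := mem_mixedSet.1 hx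
    obtain ⟨w, u, k, hk, hq⟩ := mem_mixedSet.1 hy
    by_contra! hcon
    obtain ⟨h1, h2⟩ := hcon
    have hfar : y ∉ lowBallThree G D x := fun h => h1 (Or.inl h)
    have hap := hp.apart hq hfar
    have n1 : h ≠ w := fun e => h1 (Or.inr ⟨v, z, h, w, u, k, hh, hk, hp, hq, Or.inl e⟩)
    have n2 : k ≠ v := fun e => h2 (Or.inr ⟨w, u, k, v, z, h, hk, hh, hq, hp, Or.inl e⟩)
    refine Pendant.not_apart_of_ne_hub hG hc hp hq n1 n2 hap fun hadj => ⟨?_, ?_⟩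
    · exact fun e => h1 (Or.inr ⟨v, z, h, w, u, k, hh, hk, hp, hq, Or.inr ⟨hadj, e⟩⟩)
    · intro e
      rw [Sym2.eq_swap] at e
      exact h2 (Or.inr ⟨w, u, k, v, z, h, hk, hh, hq, hp, Or.inr ⟨hadj.symm, e⟩⟩)
  · intro x hx
    obtain ⟨v, z, h, hh, hp⟩ := mem_mixedSet.1 hx
    have huniq : ∀ {v' z' h'}, Pendant G D x v' z' h' → v' = v ∧ z' = z ∧ h' = h := by
      intro v' z' h' hp'
      have e1 : v' = v := (hp.eq_or_eq hp'.adj_hub).resolve_right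
        (ne_of_low_hub hp.mid_low hp'.hub).symm
      have e2 : z' = z := (hp.eq_or_eq hp'.adj_mid).resolve_left
        (ne_of_low_hub hp'.mid_low hp.hub)
      subst e2
      exact ⟨e1, rfl, hp.mid_unique hp'.mid_adj hp'.hub'⟩
    obtain ⟨f, hf⟩ : ∃ f, ∀ w, G.Adj v w → c s(v, w) = c s(x, z) → w = f := by
      by_cases hex : ∃ w, G.Adj v w ∧ c s(v, w) = c s(x, z)
      · obtain ⟨f, hvf, hf⟩ := hex
        refine ⟨f, fun w hw hwc => ?_⟩
        by_contra hne
        exact hc.proper hw hvf hne (hwc.trans hf.symm)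
      · exact ⟨v, fun w hw hwc => absurd ⟨w, hw, hwc⟩ hex⟩
    have hsub : ((mixedSet G D).filter fun y => r x y) ⊆
        lowBallThree G D x ∪ (mixedClass G D h ∪ mixedClass G D f) := by
      intro y hy
      rcases (Finset.mem_filter.1 hy).2 with hy | ⟨v', z', h', w, u, k, -, hk, hp', hq, hw⟩
      · exact Finset.mem_union_left _ hy
      · obtain ⟨rfl, rfl, rfl⟩ := huniq hp'
        have hyw : y ∈ mixedClass G D w :=
          mem_mixedClass.2 ⟨u, k, hk, hq⟩
        refine Finset.mem_union_right _ (Finset.mem_union.2 ?_)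
        rcases hw with rfl | ⟨hadj, hcol⟩
        · exact Or.inl hyw
        · exact Or.inr (hf w hadj hcol ▸ hyw)
    have h1 := Finset.card_le_card hsub
    have h2 := Finset.card_union_le (lowBallThree G D x) (mixedClass G D h ∪ mixedClass G D f)
    have h3 := Finset.card_union_le (mixedClass G D h) (mixedClass G D f)
    have h4 := card_lowBallThree_le hp.low
    have h5 := card_mixedClass_le (D := D) hG h
    have h6 := card_mixedClass_le (D := D) hG f
    omega

theorem mem_hubNbrs_or_mem_lowNbrs {x a : V} (h : G.Adj x a) :
    a ∈ hubNbrs G D x ∨ a ∈ lowNbrs G D x := by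
  rw [mem_hubNbrs, mem_lowNbrs]
  rcases lt_or_ge (G.degree a) D with h' | h'
  exacts [Or.inr ⟨h, h'⟩, Or.inl ⟨h, h'⟩]

theorem card_hublessSet_le (hG : RainbowSat G 4) : (hublessSet G D).card ≤ D ^ 3 := by
  obtain ⟨c, hc⟩ := exists_goodColoring hG
  rcases (hublessSet G D).eq_empty_or_nonempty with h | ⟨x, hx⟩
  · simp [h]
  · obtain ⟨hxD, hxh⟩ := (Finset.mem_filter.1 hx).2
    refine (Finset.card_le_card fun y hy => ?_).trans (card_lowBallThree_le hxD)
    obtain ⟨hyD, hyh⟩ := (Finset.mem_filter.1 hy).2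
    have self : ∀ a, a ∈ lowBall G D a := fun a => mem_lowBall.2 (Or.inl rfl)
    by_cases hxy : x = y
    · subst hxy
      exact mem_lowBallThree (self _) (self _) (self _)
    by_cases hadj : G.Adj x y
    · exact mem_lowBallThree (self _) (self _) (mem_lowBall.2 (Or.inr ⟨hadj, hyD⟩))
    obtain ⟨γ, hγ⟩ := exists_fresh c
    obtain ⟨a, b, ha, hab, hb, -, -⟩ :=
      exists_path hG hc hxy hadj γ (fun _ _ => hγ _) (fun _ _ => hγ _)
    have ha' := (mem_hubNbrs_or_mem_lowNbrs (D := D) ha).resolve_left (by simp [hxh])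
    have hb' := (mem_hubNbrs_or_mem_lowNbrs (D := D) hb).resolve_left (by simp [hyh])
    exact mem_lowBallThree (mem_lowBall.2 (Or.inr (mem_lowNbrs.1 ha')))
      (mem_lowBall.2 (Or.inr ⟨hab, (mem_lowNbrs.1 hb').2⟩))
      (mem_lowBall.2 (Or.inr ⟨hb.symm, hyD⟩))

theorem card_leafSet_le (hG : RainbowSat G 4) : (leafSet G D).card ≤ 1 := by
  obtain ⟨c, hc⟩ := exists_goodColoring hG
  refine Finset.card_le_one.2 fun x hx y hy => ?_
  by_contra hxy
  obtain ⟨hxD, hxl, hxh⟩ := (Finset.mem_filter.1 hx).2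
  obtain ⟨hyD, hyl, hyh⟩ := (Finset.mem_filter.1 hy).2
  obtain ⟨v, hv⟩ := Finset.card_eq_one.1 hxh
  obtain ⟨w, hw⟩ := Finset.card_eq_one.1 hyh
  have hxa : ∀ {a}, G.Adj x a → a = v := fun h => by
    simpa [hxl, hv] using mem_hubNbrs_or_mem_lowNbrs (D := D) h
  have hya : ∀ {a}, G.Adj y a → a = w := fun h => by
    simpa [hyl, hw] using mem_hubNbrs_or_mem_lowNbrs (D := D) h
  have hv' := mem_hubNbrs.1 (show v ∈ hubNbrs G D x by simp [hv])
  have hw' := mem_hubNbrs.1 (show w ∈ hubNbrs G D y by simp [hw])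
  have hadj : ¬ G.Adj x y := fun h => ne_of_low_hub hyD hv'.2 (hxa h)
  obtain ⟨γ, hγx, hγy, hγ⟩ : ∃ γ, (∀ a, G.Adj x a → c s(x, a) ≠ γ) ∧
      (∀ b, G.Adj y b → c s(y, b) ≠ γ) ∧ (G.Adj v w → c s(v, w) = γ) := by
    by_cases hvw : G.Adj v w
    · refine ⟨c s(v, w), ?_, ?_, fun _ => rfl⟩
      · intro a ha
        obtain rfl := hxa ha
        rw [Sym2.eq_swap]
        exact hc.proper ha.symm hvw (ne_of_low_hub hxD hw'.2)
      · intro a ha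
        obtain rfl := hya ha
        rw [Sym2.eq_swap, Sym2.eq_swap (a := v)]
        exact hc.proper ha.symm hvw.symm (ne_of_low_hub hyD hv'.2)
    · obtain ⟨γ, hγ⟩ := exists_fresh c
      exact ⟨γ, fun _ _ => hγ _, fun _ _ => hγ _, fun h => absurd h hvw⟩
  obtain ⟨a, b, ha, hab, hb, -, h2⟩ := exists_path hG hc hxy hadj γ hγx hγy
  obtain rfl := hxa ha
  obtain rfl := hya hb
  exact h2 (hγ hab)

open Classical in
/-- The pendants whose middle vertex is attached to the same hub only. -/
noncomputable def allPure (G : SimpleGraph V) [DecidableRel G.Adj] (D : ℕ) : Finset V :=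
  Finset.univ.filter fun y => ∃ v u, Pendant G D y v u v

theorem mem_allPure {y : V} : y ∈ allPure G D ↔ ∃ v u, Pendant G D y v u v := by
  simp [allPure]

theorem allPure_dichotomy (hG : RainbowSat G 4) :
    (∃ v, D ^ 3 + D < (pureSet G D v).card ∧ allPure G D = pureSet G D v) ∨
      (allPure G D).card ≤ 2 * D ^ 3 + D := by
  have key : ∀ {v w x z}, Pendant G D x v z v → v ≠ w →
      pureSet G D w ⊆ lowBallThree G D x := by
    intro v w x z hp hvw y hy
    obtain ⟨u, hq⟩ := mem_pureSet.1 hy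
    by_contra hfar
    exact Pendant.not_apart_of_pure hG hp hq hvw (hp.apart hq hfar)
  by_cases hbig : ∃ v, D ^ 3 + D < (pureSet G D v).card
  · obtain ⟨v, hv⟩ := hbig
    refine Or.inl ⟨v, hv, ?_⟩
    ext x
    rw [mem_pureSet]
    constructor
    · intro hx
      obtain ⟨w, z, hp⟩ := mem_allPure.1 hx
      have hwv : w = v := by
        by_contra hne
        have h1 := (Finset.card_le_card (key hp hne)).trans (card_lowBallThree_le hp.low)
        omega
      subst hwv
      exact ⟨z, hp⟩
    · rintro ⟨z, hp⟩
      exact mem_allPure.2 ⟨v, z, hp⟩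
  · push Not at hbig
    right
    rcases (allPure G D).eq_empty_or_nonempty with h | ⟨x, hx⟩
    · simp [h]
    · obtain ⟨v, z, hp⟩ := mem_allPure.1 hx
      have hsub : allPure G D ⊆ pureSet G D v ∪ lowBallThree G D x := by
        intro y hy
        obtain ⟨w, u, hq⟩ := mem_allPure.1 hy
        by_cases hvw : v = w
        · subst hvw
          exact Finset.mem_union_left _ (mem_pureSet.2 ⟨u, hq⟩)
        · exact Finset.mem_union_right _ (key hp hvw (mem_pureSet.2 ⟨u, hq⟩))
      have h1 := Finset.card_le_card hsub
      have h2 := Finset.card_union_le (pureSet G D v) (lowBallThree G D x)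
      have h3 := card_lowBallThree_le hp.low
      have h4 := hbig v
      omega

end Counting

section Discharging

variable {V : Type*} [Fintype V] [DecidableEq V] {G : SimpleGraph V} [DecidableRel G.Adj] {D : ℕ}

theorem Pendant.lowNbrs_eq {x v z h : V} (hx : Pendant G D x v z h) : lowNbrs G D x = {z} := by
  ext a
  rw [mem_lowNbrs, Finset.mem_singleton]
  constructor
  · rintro ⟨ha, hlow⟩
    exact (hx.eq_or_eq ha).resolve_left (ne_of_low_hub hlow hx.hub)
  · rintro rfl
    exact ⟨hx.adj_mid, hx.mid_low⟩

theorem Pendant.hubNbrs_mid_eq {x v z h : V} (hx : Pendant G D x v z h) :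
    hubNbrs G D z = {h} := by
  ext a
  rw [mem_hubNbrs, Finset.mem_singleton]
  constructor
  · rintro ⟨ha, hhub⟩
    exact hx.mid_unique ha hhub
  · rintro rfl
    exact ⟨hx.mid_adj, hx.hub'⟩

theorem exists_pendant {x z : V} (hxD : G.degree x < D) (ht : (hubNbrs G D x).card = 1)
    (hs : (lowNbrs G D x).card = 1) (hz : z ∈ lowNbrs G D x) (hzt : (hubNbrs G D z).card = 1) :
    ∃ v h, Pendant G D x v z h := by
  obtain ⟨v, hv⟩ := Finset.card_eq_one.1 ht
  obtain ⟨z', hz'⟩ := Finset.card_eq_one.1 hs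
  obtain ⟨h, hh⟩ := Finset.card_eq_one.1 hzt
  obtain rfl : z = z' := by simpa [hz'] using hz
  have hv' := mem_hubNbrs.1 (show v ∈ hubNbrs G D x by simp [hv])
  have hh' := mem_hubNbrs.1 (show h ∈ hubNbrs G D z by simp [hh])
  have hz'' := mem_lowNbrs.1 hz
  refine ⟨v, h, hxD, hv'.1, hz''.1, fun ha => ?_, hv'.2, hz''.2, hh'.1, hh'.2, fun hb hbD => ?_⟩
  · simpa [hv, hz'] using mem_hubNbrs_or_mem_lowNbrs (D := D) ha
  · simpa [hh] using mem_hubNbrs.2 ⟨hb, hbD⟩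

/-- A small exceptional set outside of which the local structure of low-degree vertices is
controlled. -/
structure Controlled (G : SimpleGraph V) [DecidableRel G.Adj] (D : ℕ) (v : V)
    (L X : Finset V) : Prop where
  pendant : ∀ x ∈ L, ∃ z, Pendant G D x v z v
  big : ∀ x ∈ L, D ^ 3 + D < (pureSet G D v).card
  one_le_hub : ∀ x, G.degree x < D → x ∉ X → 1 ≤ (hubNbrs G D x).card
  one_le_low : ∀ x, G.degree x < D → x ∉ X → (hubNbrs G D x).card = 1 →
    1 ≤ (lowNbrs G D x).card
  mem : ∀ x z, G.degree x < D → x ∉ X → (hubNbrs G D x).card = 1 → (lowNbrs G D x).card = 1 →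
    z ∈ lowNbrs G D x → (hubNbrs G D z).card = 1 → x ∈ L

theorem exists_controlled [Nonempty V] (hG : RainbowSat G 4) :
    ∃ v L X, Controlled G D v L X ∧ X.card ≤ 9 * D ^ 3 + D + 1 := by
  have hX0 := card_hublessSet_le (D := D) hG
  have hX1 := card_leafSet_le (D := D) hG
  have hX2 := card_mixedSet_le (D := D) hG
  have main : ∀ v (L Y : Finset V), (∀ x ∈ L, ∃ z, Pendant G D x v z v) →
      (∀ x ∈ L, D ^ 3 + D < (pureSet G D v).card) → allPure G D ⊆ L ∪ Y →
      Y.card ≤ 2 * D ^ 3 + D → ∃ v L X, Controlled G D v L X ∧ X.card ≤ 9 * D ^ 3 + D + 1 := by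
    intro v L Y hL hbig hsub hY
    refine ⟨v, L, (hublessSet G D ∪ leafSet G D) ∪ (mixedSet G D ∪ Y), ⟨hL, hbig, ?_, ?_, ?_⟩, ?_⟩
    · intro x hxD hx
      rw [Nat.one_le_iff_ne_zero]
      intro h0
      refine hx (Finset.mem_union_left _ (Finset.mem_union_left _ ?_))
      exact Finset.mem_filter.2 ⟨Finset.mem_univ _, hxD, Finset.card_eq_zero.1 h0⟩
    · intro x hxD hx h1
      rw [Nat.one_le_iff_ne_zero]
      intro h0
      refine hx (Finset.mem_union_left _ (Finset.mem_union_right _ ?_))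
      exact Finset.mem_filter.2 ⟨Finset.mem_univ _, hxD, Finset.card_eq_zero.1 h0, h1⟩
    · intro x z hxD hx ht hs hz hzt
      obtain ⟨w, h, hp⟩ := exists_pendant hxD ht hs hz hzt
      by_cases hw : h = w
      · subst hw
        rcases Finset.mem_union.1 (hsub (mem_allPure.2 ⟨_, _, hp⟩)) with h | h
        · exact h
        · exact absurd (Finset.mem_union_right _ (Finset.mem_union_right _ h)) hx
      · exact absurd (Finset.mem_union_right _ (Finset.mem_union_left _
          (mem_mixedSet.2 ⟨_, _, _, hw, hp⟩))) hx
    · have h1 := Finset.card_union_le (hublessSet G D ∪ leafSet G D) (mixedSet G D ∪ Y)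
      have h2 := Finset.card_union_le (hublessSet G D) (leafSet G D)
      have h3 := Finset.card_union_le (mixedSet G D) Y
      omega
  rcases allPure_dichotomy (D := D) hG with ⟨v, hbig, heq⟩ | hle
  · exact main v (pureSet G D v) ∅ (fun x hx => mem_pureSet.1 hx) (fun _ _ => hbig)
      (by simp [heq]) (by simp)
  · exact main (Classical.arbitrary V) ∅ (allPure G D) (by simp) (by simp) (by simp) hle

/-- Vertices with one hub and one low-degree neighbor, outside the exceptional set. -/
def Deficient (G : SimpleGraph V) [DecidableRel G.Adj] (D : ℕ) (X : Finset V) (x : V) : Prop :=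
  (hubNbrs G D x).card = 1 ∧ (lowNbrs G D x).card = 1 ∧ x ∉ X

/-- Degree-three vertices with one hub that are the middle vertex of a pendant in `L`. -/
def Middle (G : SimpleGraph V) [DecidableRel G.Adj] (D : ℕ) (L : Finset V) (z : V) : Prop :=
  (hubNbrs G D z).card = 1 ∧ (lowNbrs G D z).card = 2 ∧ ∃ y ∈ lowNbrs G D z, y ∈ L

open Classical in
/-- The charge sent from `y` to its low-degree neighbor `x`. -/
noncomputable def flow (G : SimpleGraph V) [DecidableRel G.Adj] (D : ℕ) (L X : Finset V)
    (y x : V) : ℤ :=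
  if Deficient G D X x then 2 else if Middle G D L x ∧ ¬ Deficient G D X y then 1 else 0

theorem flow_nonneg (L X : Finset V) (y x : V) : 0 ≤ flow G D L X y x := by
  unfold flow
  split_ifs <;> norm_num

theorem flow_le_two (L X : Finset V) (y x : V) : flow G D L X y x ≤ 2 := by
  unfold flow
  split_ifs <;> norm_num

namespace Controlled

variable {v : V} {L X : Finset V}

theorem pendant_of_mem (hC : Controlled G D v L X) {x z : V} (hx : x ∈ L)
    (hz : z ∈ lowNbrs G D x) : Pendant G D x v z v := by
  obtain ⟨z', hp⟩ := hC.pendant x hx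
  obtain rfl : z = z' := by simpa [hp.lowNbrs_eq] using hz
  exact hp

theorem card_lowNbrs (hC : Controlled G D v L X) {x : V} (hx : x ∈ L) :
    (lowNbrs G D x).card = 1 := by
  obtain ⟨z', hp⟩ := hC.pendant x hx
  simp [hp.lowNbrs_eq]

theorem mem_lowNbrs_symm {x z : V} (hxD : G.degree x < D) (hz : z ∈ lowNbrs G D x) :
    x ∈ lowNbrs G D z :=
  mem_lowNbrs.2 ⟨(mem_lowNbrs.1 hz).1.symm, hxD⟩

theorem eq_of_mem (hC : Controlled G D v L X) (hG : RainbowSat G 4) {z a b : V}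
    (hzD : G.degree z < D) (ha : a ∈ lowNbrs G D z) (hb : b ∈ lowNbrs G D z)
    (haL : a ∈ L) (hbL : b ∈ L) : a = b :=
  (hC.pendant_of_mem haL (mem_lowNbrs_symm hzD ha)).eq_of_same hG
    (hC.pendant_of_mem hbL (mem_lowNbrs_symm hzD hb))

theorem mem_of_deficient (hC : Controlled G D v L X) {x a : V} (hxD : G.degree x < D)
    (ht : (hubNbrs G D x).card = 1) (ha : a ∈ lowNbrs G D x) (hdef : Deficient G D X a) :
    a ∈ L :=
  hC.mem a x (mem_lowNbrs.1 ha).2 hdef.2.2 hdef.1 hdef.2.1 (mem_lowNbrs_symm hxD ha) ht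

theorem eq_of_adj_mid (hC : Controlled G D v L X) {x a b d : V} (hxD : G.degree x < D)
    (hx : lowNbrs G D x = {a, b}) (ha : a ∈ L) (hd : G.Adj x d) : d = v ∨ d = a ∨ d = b := by
  have hp := hC.pendant_of_mem ha (mem_lowNbrs_symm hxD (by simp [hx] : a ∈ lowNbrs G D x))
  simpa [hp.hubNbrs_mid_eq, hx] using mem_hubNbrs_or_mem_lowNbrs (D := D) hd

/-- The low-degree neighbors of a middle vertex are its pendant and one more vertex. -/
theorem exists_lowNbrs_eq (hC : Controlled G D v L X) {z x : V}
    (hz : Middle G D L z) (hx : x ∈ lowNbrs G D z) (hxs : (lowNbrs G D x).card ≠ 1) :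
    ∃ b ∈ L, b ≠ x ∧ lowNbrs G D z = {b, x} := by
  obtain ⟨-, hs, b, hb, hbL⟩ := hz
  have hne : b ≠ x := by
    rintro rfl
    exact hxs (hC.card_lowNbrs hbL)
  refine ⟨b, hbL, hne, (Finset.eq_of_subset_of_card_le ?_ ?_).symm⟩
  · intro d hd
    rcases Finset.mem_insert.1 hd with rfl | hd
    · exact hb
    · rwa [Finset.mem_singleton.1 hd]
  · rw [hs, Finset.card_pair hne]

/-- Outside the exceptional set the final charge is nonnegative. -/
theorem charge_nonneg (hC : Controlled G D v L X) (hG : RainbowSat G 4) {x : V}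
    (hxD : G.degree x < D) (hxX : x ∉ X) :
    0 ≤ (3 * ((lowNbrs G D x).card : ℤ) + 6 * (hubNbrs G D x).card - 11) +
      ∑ y ∈ lowNbrs G D x, flow G D L X y x - ∑ y ∈ lowNbrs G D x, flow G D L X x y := by
  have hin : 0 ≤ ∑ y ∈ lowNbrs G D x, flow G D L X y x :=
    Finset.sum_nonneg fun y _ => flow_nonneg ..
  have hout : ∑ y ∈ lowNbrs G D x, flow G D L X x y ≤ (lowNbrs G D x).card * 2 := by
    simpa using Finset.sum_le_card_nsmul (lowNbrs G D x) _ 2 fun y _ => flow_le_two L X x y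
  have ht1 := hC.one_le_hub x hxD hxX
  rcases ht1.eq_or_lt with ht | ht
  swap
  · have : (2 : ℤ) ≤ (hubNbrs G D x).card := by exact_mod_cast ht
    have : (0 : ℤ) ≤ (lowNbrs G D x).card := by positivity
    linarith
  have ht := ht.symm
  have hs1 := hC.one_le_low x hxD hxX ht
  rcases hs1.eq_or_lt with hs | hs
  · have hs := hs.symm
    obtain ⟨z, hz⟩ := Finset.card_eq_one.1 hs
    have hzm : z ∈ lowNbrs G D x := by simp [hz]
    have hzD := (mem_lowNbrs.1 hzm).2
    have hdef : Deficient G D X x := ⟨ht, hs, hxX⟩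
    have hzdef : ¬ Deficient G D X z := by
      intro hzdef
      have hxL := hC.mem_of_deficient hzD hzdef.1 (mem_lowNbrs_symm hxD hzm) hdef
      have hp := hC.pendant_of_mem hxL hzm
      refine hp.false_of_mid_degree_two hG ?_ (hC.big x hxL)
      intro a ha
      obtain ⟨x', hx'⟩ := Finset.card_eq_one.1 hzdef.2.1
      obtain rfl : x = x' := by simpa [hx'] using mem_lowNbrs_symm hxD hzm
      simpa [hp.hubNbrs_mid_eq, hx'] using mem_hubNbrs_or_mem_lowNbrs (D := D) ha
    rw [hz, Finset.sum_singleton, Finset.sum_singleton, ht]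
    simp [flow, hdef, hzdef]
  have hndef : ¬ Deficient G D X x := fun h => by
    have := h.2.1
    omega
  have hflow : ∀ y ∈ lowNbrs G D x, y ∉ L → flow G D L X x y ≤ 1 := by
    intro y hy hyL
    have hy' : ¬ Deficient G D X y := fun h => hyL (hC.mem_of_deficient hxD ht hy h)
    rw [flow, if_neg hy']
    split_ifs <;> norm_num
  have hflow' : ∀ y ∈ lowNbrs G D x, y ∉ L → ¬ Middle G D L y → flow G D L X x y = 0 := by
    intro y hy hyL hmid
    have hy' : ¬ Deficient G D X y := fun h => hyL (hC.mem_of_deficient hxD ht hy h)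
    rw [flow, if_neg hy', if_neg fun h => hmid h.1]
  rcases (show 2 ≤ (lowNbrs G D x).card from hs).eq_or_lt with hs | hs
  · have hs := hs.symm
    rw [hs, ht]
    by_cases hex : ∃ a ∈ lowNbrs G D x, a ∈ L
    · have hmx : Middle G D L x := ⟨ht, hs, hex⟩
      obtain ⟨a, ha, haL⟩ := hex
      obtain ⟨b, hab, hx⟩ : ∃ b, a ≠ b ∧ lowNbrs G D x = {a, b} := by
        obtain ⟨p, q, hpq, hx⟩ := Finset.card_eq_two.1 hs
        rcases (by simpa [hx] using ha : a = p ∨ a = q) with rfl | rfl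
        · exact ⟨q, hpq, hx⟩
        · exact ⟨p, hpq.symm, by rw [hx, Finset.pair_comm]⟩
      have hb : b ∈ lowNbrs G D x := by simp [hx]
      have hbD := (mem_lowNbrs.1 hb).2
      have hbL : b ∉ L := fun hbL => hab (hC.eq_of_mem hG hxD ha hb haL hbL)
      have hbdef : ¬ Deficient G D X b := fun h => hbL (hC.mem_of_deficient hxD ht hb h)
      have hbmid : ¬ Middle G D L b := by
        intro hbmid
        obtain ⟨b', hb'L, hne, hblow⟩ := hC.exists_lowNbrs_eq hbmid (mem_lowNbrs_symm hxD hb)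
          (by omega)
        have hpa := hC.pendant_of_mem haL (mem_lowNbrs_symm hxD ha)
        have hpb := hC.pendant_of_mem hb'L
          (mem_lowNbrs_symm hbD (by simp [hblow] : b' ∈ lowNbrs G D b))
        exact hpa.false_of_mid_adj hG hpb (mem_lowNbrs.1 hb).1 hab
          (fun d hd => hC.eq_of_adj_mid hxD hx haL hd)
          (fun d hd => hC.eq_of_adj_mid hbD hblow hb'L hd) (hC.big a haL)
      have e1 : flow G D L X b x = 1 := by
        rw [flow, if_neg hndef, if_pos ⟨hmx, hbdef⟩]
      have e2 := hflow' b hb hbL hbmid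
      have e3 := flow_nonneg (G := G) (D := D) L X a x
      have e4 := flow_le_two (G := G) (D := D) L X x a
      rw [hx, Finset.sum_pair hab, Finset.sum_pair hab, e1, e2]
      push_cast
      linarith
    · push Not at hex
      obtain ⟨a, b, hab, hx⟩ := Finset.card_eq_two.1 hs
      have ha : a ∈ lowNbrs G D x := by simp [hx]
      have hb : b ∈ lowNbrs G D x := by simp [hx]
      have haD := (mem_lowNbrs.1 ha).2
      have hbD := (mem_lowNbrs.1 hb).2
      have hnot : ¬ (Middle G D L a ∧ Middle G D L b) := by
        rintro ⟨hma, hmb⟩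
        obtain ⟨a', ha'L, hane, halow⟩ := hC.exists_lowNbrs_eq hma (mem_lowNbrs_symm hxD ha)
          (by omega)
        obtain ⟨b', hb'L, hbne, hblow⟩ := hC.exists_lowNbrs_eq hmb (mem_lowNbrs_symm hxD hb)
          (by omega)
        have hpa := hC.pendant_of_mem ha'L
          (mem_lowNbrs_symm haD (by simp [halow] : a' ∈ lowNbrs G D a))
        have hpb := hC.pendant_of_mem hb'L
          (mem_lowNbrs_symm hbD (by simp [hblow] : b' ∈ lowNbrs G D b))
        refine hpa.false_of_common_nbr hG hpb (mem_lowNbrs.1 ha).1 (mem_lowNbrs.1 hb).1 hab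
          (fun d hd => hC.eq_of_adj_mid haD halow ha'L hd)
          (fun d hd => hC.eq_of_adj_mid hbD hblow hb'L hd) ?_ hane hbne (hC.big a' ha'L)
        intro hxv d hd
        obtain ⟨w, hw⟩ := Finset.card_eq_one.1 ht
        obtain rfl : v = w := by simpa [hw] using mem_hubNbrs.2 ⟨hxv, hpa.hub⟩
        simpa [hw, hx] using mem_hubNbrs_or_mem_lowNbrs (D := D) hd
      have e : flow G D L X x a + flow G D L X x b ≤ 1 := by
        by_cases hma : Middle G D L a
        · rw [hflow' b hb (hex b hb) fun hmb => hnot ⟨hma, hmb⟩, add_zero]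
          exact hflow a ha (hex a ha)
        · rw [hflow' a ha (hex a ha) hma, zero_add]
          exact hflow b hb (hex b hb)
      have e' : ∑ y ∈ lowNbrs G D x, flow G D L X x y ≤ 1 := by
        rwa [hx, Finset.sum_pair hab]
      push_cast
      linarith
  · have h1 : ∑ y ∈ lowNbrs G D x, flow G D L X x y ≤
        ∑ y ∈ lowNbrs G D x, (1 + if y ∈ L then (1 : ℤ) else 0) := by
      refine Finset.sum_le_sum fun y hy => ?_
      split_ifs with hyL
      · exact flow_le_two ..
      · simpa using hflow y hy hyL
    have h2 : ((lowNbrs G D x).filter fun y => y ∈ L).card ≤ 1 := by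
      refine Finset.card_le_one.2 fun a ha b hb => ?_
      rw [Finset.mem_filter] at ha hb
      exact hC.eq_of_mem hG hxD ha.1 hb.1 ha.2 hb.2
    rw [Finset.sum_add_distrib, ← Finset.sum_filter, Finset.sum_const, Finset.sum_const] at h1
    simp only [nsmul_eq_mul, mul_one] at h1
    have h3 : (((lowNbrs G D x).filter fun y => y ∈ L).card : ℤ) ≤ 1 := by exact_mod_cast h2
    have h4 : (3 : ℤ) ≤ (lowNbrs G D x).card := by exact_mod_cast hs
    rw [ht]
    push_cast
    linarith

/-- The total weight of the low-degree vertices is bounded below up to the exceptional set. -/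
theorem sum_weight_ge (hC : Controlled G D v L X) (hG : RainbowSat G 4) :
    -((2 * D + 11) * (X.card : ℤ)) ≤ ∑ x ∈ Finset.univ.filter (fun x => G.degree x < D),
      (3 * ((lowNbrs G D x).card : ℤ) + 6 * (hubNbrs G D x).card - 11) := by
  set R := Finset.univ.filter (fun x => G.degree x < D) with hR
  have hswap : ∑ x ∈ R, ∑ y ∈ lowNbrs G D x, flow G D L X y x =
      ∑ x ∈ R, ∑ y ∈ lowNbrs G D x, flow G D L X x y := by
    refine Finset.sum_comm' ?_
    intro x y
    simp only [hR, Finset.mem_filter, Finset.mem_univ, true_and, mem_lowNbrs, G.adj_comm x y]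
    tauto
  have hterm : ∀ x ∈ R, (if x ∈ X then -(2 * (D : ℤ) + 11) else 0) ≤
      (3 * ((lowNbrs G D x).card : ℤ) + 6 * (hubNbrs G D x).card - 11) +
      ∑ y ∈ lowNbrs G D x, flow G D L X y x - ∑ y ∈ lowNbrs G D x, flow G D L X x y := by
    intro x hx
    have hxD : G.degree x < D := (Finset.mem_filter.1 hx).2
    split_ifs with hxX
    · have hin : 0 ≤ ∑ y ∈ lowNbrs G D x, flow G D L X y x :=
        Finset.sum_nonneg fun y _ => flow_nonneg ..
      have hout : ∑ y ∈ lowNbrs G D x, flow G D L X x y ≤ (lowNbrs G D x).card * 2 := by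
        simpa using Finset.sum_le_card_nsmul (lowNbrs G D x) _ 2 fun y _ => flow_le_two L X x y
      have h1 := card_lowNbrs_add_card_hubNbrs (G := G) (D := D) x
      have h2 : ((lowNbrs G D x).card : ℤ) ≤ D := by
        have : (lowNbrs G D x).card ≤ D := by omega
        exact_mod_cast this
      have h3 : (0 : ℤ) ≤ (lowNbrs G D x).card := by positivity
      have h4 : (0 : ℤ) ≤ (hubNbrs G D x).card := by positivity
      linarith
    · exact hC.charge_nonneg hG hxD hxX
  have hsum := Finset.sum_le_sum hterm
  rw [Finset.sum_sub_distrib, Finset.sum_add_distrib, hswap, add_sub_cancel_right,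
    ← Finset.sum_filter, Finset.sum_const, nsmul_eq_mul] at hsum
  refine le_trans ?_ hsum
  have hle : (((R.filter fun x => x ∈ X).card : ℕ) : ℤ) ≤ X.card := by
    have : (R.filter fun x => x ∈ X).card ≤ X.card :=
      Finset.card_le_card fun x hx => (Finset.mem_filter.1 hx).2
    exact_mod_cast this
  have hD : (0 : ℤ) ≤ D := by positivity
  nlinarith

end Controlled

/-- Counting edges by low-degree vertices. -/
theorem sum_low_le_two_mul_card_edges :
    ∑ x ∈ Finset.univ.filter (fun x => G.degree x < D),
      ((lowNbrs G D x).card + 2 * (hubNbrs G D x).card) ≤ 2 * G.edgeFinset.card := by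
  have hdeg := G.sum_degrees_eq_twice_card_edges
  rw [← Finset.sum_filter_add_sum_filter_not Finset.univ (fun x => G.degree x < D)] at hdeg
  have h1 : ∑ x ∈ Finset.univ.filter (fun x => G.degree x < D), (hubNbrs G D x).card ≤
      ∑ x ∈ Finset.univ.filter (fun x => ¬ G.degree x < D), G.degree x := by
    calc _ = ∑ x ∈ Finset.univ.filter (fun x => ¬ G.degree x < D), (lowNbrs G D x).card := by
          simp only [Finset.card_eq_sum_ones]
          refine Finset.sum_comm' ?_
          intro x y
          simp only [Finset.mem_filter, Finset.mem_univ, true_and, mem_lowNbrs, mem_hubNbrs,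
            G.adj_comm x y, not_lt]
          tauto
      _ ≤ _ := Finset.sum_le_sum fun x _ => by
          have := card_lowNbrs_add_card_hubNbrs (G := G) (D := D) x
          omega
  have h2 : ∑ x ∈ Finset.univ.filter (fun x => G.degree x < D),
      ((lowNbrs G D x).card + 2 * (hubNbrs G D x).card) =
      ∑ x ∈ Finset.univ.filter (fun x => G.degree x < D), G.degree x +
      ∑ x ∈ Finset.univ.filter (fun x => G.degree x < D), (hubNbrs G D x).card := by
    rw [← Finset.sum_add_distrib]
    refine Finset.sum_congr rfl fun x _ => ?_
    rw [← card_lowNbrs_add_card_hubNbrs (G := G) (D := D) x]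
    ring
  omega

theorem mul_card_hubs_le :
    D * (Finset.univ.filter (fun x => ¬ G.degree x < D)).card ≤ 2 * G.edgeFinset.card := by
  rw [← G.sum_degrees_eq_twice_card_edges]
  calc _ = ∑ _x ∈ Finset.univ.filter (fun x => ¬ G.degree x < D), D := by
        rw [Finset.sum_const, smul_eq_mul, mul_comm]
    _ ≤ ∑ x ∈ Finset.univ.filter (fun x => ¬ G.degree x < D), G.degree x :=
        Finset.sum_le_sum fun x hx => not_lt.1 (Finset.mem_filter.1 hx).2
    _ ≤ ∑ x, G.degree x :=
        Finset.sum_le_sum_of_subset (Finset.filter_subset _ _)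

/-- Lower bound on the number of edges in terms of the number of hubs. -/
theorem eleven_mul_card_le [Nonempty V] (hG : RainbowSat G 4) :
    11 * (Fintype.card V : ℤ) ≤ 6 * G.edgeFinset.card +
      11 * (Finset.univ.filter (fun x => ¬ G.degree x < D)).card +
      (2 * D + 11) * (9 * D ^ 3 + D + 1) := by
  obtain ⟨v, L, X, hC, hX⟩ := exists_controlled (D := D) hG
  have h1 := hC.sum_weight_ge hG
  have h2 := sum_low_le_two_mul_card_edges (G := G) (D := D)
  have h3 := Finset.card_filter_add_card_filter_not (s := (Finset.univ : Finset V))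
    (fun x => G.degree x < D)
  rw [Finset.card_univ] at h3
  rw [Finset.sum_sub_distrib, Finset.sum_const, nsmul_eq_mul] at h1
  have h4 : ∑ x ∈ Finset.univ.filter (fun x => G.degree x < D),
      (3 * ((lowNbrs G D x).card : ℤ) + 6 * (hubNbrs G D x).card) ≤ 6 * G.edgeFinset.card := by
    have : (∑ x ∈ Finset.univ.filter (fun x => G.degree x < D),
      (((lowNbrs G D x).card : ℤ) + 2 * (hubNbrs G D x).card)) ≤ 2 * G.edgeFinset.card := by
      exact_mod_cast h2
    calc _ = 3 * ∑ x ∈ Finset.univ.filter (fun x => G.degree x < D),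
          (((lowNbrs G D x).card : ℤ) + 2 * (hubNbrs G D x).card) := by
          rw [Finset.mul_sum]
          exact Finset.sum_congr rfl fun x _ => by ring
      _ ≤ _ := by linarith
  have h5 : (2 * (D : ℤ) + 11) * X.card ≤ (2 * D + 11) * (9 * D ^ 3 + D + 1) := by
    have : (X.card : ℤ) ≤ 9 * D ^ 3 + D + 1 := by exact_mod_cast hX
    exact mul_le_mul_of_nonneg_left this (by positivity)
  have h6 : ((Finset.univ.filter (fun x => G.degree x < D)).card : ℤ) +
      (Finset.univ.filter (fun x => ¬ G.degree x < D)).card = Fintype.card V := by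
    exact_mod_cast h3
  linarith

end Discharging

end RainbowC4

/-- For every `0 < ε < 11/45` there exists `n₀` such that for all `n ≥ n₀`, every
`n`-vertex rainbow `C₄`-saturated graph has more than `(11/6 − ε)·n` edges. -/
theorem rainbow_sat_C4_lower (ε : ℝ) (hε0 : 0 < ε) (hε1 : ε < 11 / 45) :
    ∃ n₀ : ℕ, ∀ n : ℕ, n₀ ≤ n → ∀ G : SimpleGraph (Fin n),
      RainbowSat G 4 → (11 / 6 - ε) * n < (G.edgeSet.ncard : ℝ) := by
  classical
  obtain ⟨D, hD⟩ := exists_nat_gt (44 / (3 * ε))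
  have hDpos : (0 : ℝ) < D := lt_trans (by positivity) hD
  set C : ℝ := (2 * D + 11) * (9 * D ^ 3 + D + 1) with hC
  have hCpos : 0 < C := by positivity
  obtain ⟨N, hN⟩ := exists_nat_gt (C / (3 * ε))
  refine ⟨N + 1, fun n hn G hG => ?_⟩
  have : Nonempty (Fin n) := ⟨⟨0, by omega⟩⟩
  by_contra! hle
  have hcard : G.edgeSet.ncard = G.edgeFinset.card := by
    rw [← SimpleGraph.coe_edgeFinset, Set.ncard_coe_finset]
  rw [hcard] at hle
  have h1 := RainbowC4.eleven_mul_card_le (D := D) hG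
  have h2 := RainbowC4.mul_card_hubs_le (G := G) (D := D)
  rw [Fintype.card_fin] at h1
  set B := (Finset.univ.filter (fun x => ¬ G.degree x < D)).card
  have h1' : 11 * (n : ℝ) ≤ 6 * G.edgeFinset.card + 11 * B + C := by
    rw [hC]
    exact_mod_cast h1
  have h2' : (D : ℝ) * B ≤ 2 * G.edgeFinset.card := by exact_mod_cast h2
  have hnN : (N : ℝ) < n := by exact_mod_cast hn
  have hn0 : (0 : ℝ) < n := lt_of_le_of_lt (Nat.cast_nonneg N) hnN
  have h3 : C < 3 * ε * n := by
    have := hN.trans hnN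
    rw [div_lt_iff₀ (by positivity)] at this
    linarith
  have h4 : 44 < 3 * ε * D := by
    rw [div_lt_iff₀ (by positivity)] at hD
    linarith
  have h5 : (D : ℝ) * B ≤ 4 * n := by nlinarith
  have h6 : 11 * (B : ℝ) ≤ 3 * ε * n := by
    have : (D : ℝ) * (11 * B) ≤ D * (3 * ε * n) := by nlinarith
    exact le_of_mul_le_mul_left this hDpos
  linarith
end

section
/- There exist constants C and n_0 such that for all n ≥ n_0, there exists an n-vertex rainbow C_6-saturated graph with at most 7n/3 + C edges; consequently sat*(n, C_6) ≤ 7n/3 + O(1). -/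
/-- Vertices of the base graph: two hubs `u`, `v`, the vertices `w`, `x`, `y₁`, `y₂`, `y₃` of the
fixed part, `r` leaves, and the vertices `a i`, `b i`, `c i` of `m` triangles. -/
inductive Vert (m r : ℕ) : Type
  | u | v | w | x | y₁ | y₂ | y₃
  | leaf (j : Fin r)
  | a (i : Fin m)
  | b (i : Fin m)
  | c (i : Fin m)

namespace Vert

variable {m r : ℕ}

/-- The edges of the base graph, each listed in one orientation. -/
inductive Edge : Vert m r → Vert m r → Prop
  | ua (i : Fin m) : Edge u (a i)
  | va (i : Fin m) : Edge v (a i)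
  | vb (i : Fin m) : Edge v (b i)
  | vc (i : Fin m) : Edge v (c i)
  | ab (i : Fin m) : Edge (a i) (b i)
  | ac (i : Fin m) : Edge (a i) (c i)
  | bc (i : Fin m) : Edge (b i) (c i)
  | uw : Edge u w
  | ux : Edge u x
  | wx : Edge w x
  | wy₁ : Edge w y₁
  | wy₂ : Edge w y₂
  | wy₃ : Edge w y₃
  | vy₁ : Edge v y₁
  | vy₂ : Edge v y₂
  | vy₃ : Edge v y₃
  | wl (j : Fin r) : Edge w (leaf j)

/-- The base graph. -/
def base (m r : ℕ) : SimpleGraph (Vert m r) where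
  Adj p q := Edge p q ∨ Edge q p
  symm := ⟨fun _ _ h => h.symm⟩
  loopless := ⟨fun p h => by rcases h with h | h <;> cases h⟩

/-- The color of an edge of the base graph, in the orientation of `Edge`. -/
def hue : Vert m r → Vert m r → ℕ
  | u, a i => 4 * i + 10
  | v, a i => 4 * i + 11
  | v, b i => 4 * i + 10
  | v, c i => 4 * i + 12
  | a i, b _ => 4 * i + 12
  | a _, c _ => 1
  | b i, c _ => 4 * i + 11
  | u, w => 1
  | u, x => 2
  | w, x => 3
  | w, y₁ => 4
  | w, y₂ => 2
  | w, y₃ => 5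
  | v, y₁ => 3
  | v, y₂ => 6
  | v, y₃ => 2
  | w, leaf j => 4 * j + 13
  | _, _ => 0

/-- A proper edge-coloring of the base graph without rainbow `C₆`. -/
def baseColoring (m r : ℕ) : Sym2 (Vert m r) → ℕ :=
  Sym2.lift ⟨fun p q => hue p q + hue q p, fun _ _ => Nat.add_comm _ _⟩

@[simp] lemma baseColoring_mk (p q : Vert m r) :
    baseColoring m r s(p, q) = hue p q + hue q p := rfl

end Vert

/-- Properness of an edge-coloring, read off at a vertex. -/
lemma properEdgeColoring_iff {V : Type*} {G : SimpleGraph V} {col : Sym2 V → ℕ} :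
    ProperEdgeColoring G col ↔
      ∀ p q s, G.Adj p q → G.Adj p s → q ≠ s → col s(p, q) ≠ col s(p, s) := by
  constructor
  · intro h p q s hq hs hne
    refine h _ hq _ hs (fun he => hne ?_) ⟨p, by simp, by simp⟩
    rwa [Sym2.congr_right] at he
  · rintro h e₁ h₁ e₂ h₂ hne ⟨p, hp₁, hp₂⟩
    obtain ⟨q, rfl⟩ := hp₁
    obtain ⟨s, rfl⟩ := hp₂
    exact h p q s h₁ h₂ (fun he => hne (by rw [he]))

namespace Vert

variable {m r : ℕ}

lemma baseColoring_proper : ProperEdgeColoring (base m r) (baseColoring m r) := by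
  rw [properEdgeColoring_iff]
  intro p q s hq hs hne
  rcases hq with h | h <;> cases h <;> rcases hs with h | h <;> cases h <;>
    simp only [baseColoring_mk, hue, ne_eq, not_true_eq_false, a.injEq, b.injEq, c.injEq,
      leaf.injEq, ← Fin.val_inj] at hne ⊢ <;> omega

lemma no_rainbow_at_v {p₁ p₂ p₃ p₄ p₅ : Vert m r}
    (h₀ : (base m r).Adj v p₁) (h₁ : (base m r).Adj p₁ p₂) (h₂ : (base m r).Adj p₂ p₃)
    (h₃ : (base m r).Adj p₃ p₄) (h₄ : (base m r).Adj p₄ p₅) (h₅ : (base m r).Adj p₅ v)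
    (hn : [v, p₁, p₂, p₃, p₄, p₅].Nodup)
    (hc : [baseColoring m r s(v, p₁), baseColoring m r s(p₁, p₂), baseColoring m r s(p₂, p₃),
      baseColoring m r s(p₃, p₄), baseColoring m r s(p₄, p₅), baseColoring m r s(p₅, v)].Nodup) :
    False := by
  rcases h₀ with h | h <;> cases h <;> rcases h₁ with h | h <;> cases h <;>
    (try solve | simp at hn) <;>
    rcases h₅ with h | h <;> cases h <;> rcases h₂ with h | h <;> cases h <;>
    (try solve | simp at hn) <;>
    rcases h₄ with h | h <;> cases h <;>
    (try solve | simp at hn) <;>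
    rcases h₃ with h | h <;> cases h <;>
    (try solve | simp at hn) <;>
    (try solve | simp [hue] at hc)

lemma no_cycle_at_u {p₁ p₂ p₃ p₄ p₅ : Vert m r}
    (h₀ : (base m r).Adj u p₁) (h₁ : (base m r).Adj p₁ p₂) (h₂ : (base m r).Adj p₂ p₃)
    (h₃ : (base m r).Adj p₃ p₄)
    (hn : [v, u, p₁, p₂, p₃, p₄, p₅].Nodup) : False := by
  rcases h₀ with h | h <;> cases h <;> rcases h₁ with h | h <;> cases h <;>
    (try solve | simp at hn) <;> rcases h₂ with h | h <;> cases h <;>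
    (try solve | simp at hn) <;> rcases h₃ with h | h <;> cases h <;>
    (try solve | simp at hn)

lemma no_cycle_avoiding {p₀ p₁ p₂ p₃ : Vert m r}
    (h₀ : (base m r).Adj p₀ p₁) (h₁ : (base m r).Adj p₁ p₂) (h₂ : (base m r).Adj p₂ p₃)
    (hn : [v, u, p₀, p₁, p₂, p₃].Nodup) : False := by
  rcases h₀ with h | h <;> cases h <;>
    (try solve | simp at hn) <;> rcases h₁ with h | h <;> cases h <;>
    (try solve | simp at hn) <;> rcases h₂ with h | h <;> cases h <;>
    (try solve | simp at hn)

lemma baseColoring_rainbow_free : ¬ HasRainbowCycle (base m r) (baseColoring m r) 6 := by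
  rintro ⟨f, hf, hadj, hcol⟩
  have key (k : ZMod 6) :
      (base m r).Adj (f k) (f (k + 1)) ∧ (base m r).Adj (f (k + 1)) (f (k + 2)) ∧
      (base m r).Adj (f (k + 2)) (f (k + 3)) ∧ (base m r).Adj (f (k + 3)) (f (k + 4)) ∧
      (base m r).Adj (f (k + 4)) (f (k + 5)) ∧ (base m r).Adj (f (k + 5)) (f k) := by
    have e₁ : k + 1 + 1 = k + 2 := by ring
    have e₂ : k + 2 + 1 = k + 3 := by ring
    have e₃ : k + 3 + 1 = k + 4 := by ring
    have e₄ : k + 4 + 1 = k + 5 := by ring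
    have e₅ : k + 5 + 1 = k := by rw [add_assoc]; exact add_eq_left.2 (by decide)
    refine ⟨hadj k, e₁ ▸ hadj (k + 1), e₂ ▸ hadj (k + 2), e₃ ▸ hadj (k + 3), e₄ ▸ hadj (k + 4), ?_⟩
    have := hadj (k + 5)
    rwa [e₅] at this
  have hnodup (k : ZMod 6) : [k, k + 1, k + 2, k + 3, k + 4, k + 5].Nodup := by
    revert k; decide
  have hverts (k : ZMod 6) : [f k, f (k + 1), f (k + 2), f (k + 3), f (k + 4), f (k + 5)].Nodup :=
    (hnodup k).map hf
  have hcolors (k : ZMod 6) :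
      [baseColoring m r s(f k, f (k + 1)), baseColoring m r s(f (k + 1), f (k + 2)),
        baseColoring m r s(f (k + 2), f (k + 3)), baseColoring m r s(f (k + 3), f (k + 4)),
        baseColoring m r s(f (k + 4), f (k + 5)), baseColoring m r s(f (k + 5), f k)].Nodup := by
    have e₁ : k + 1 + 1 = k + 2 := by ring
    have e₂ : k + 2 + 1 = k + 3 := by ring
    have e₃ : k + 3 + 1 = k + 4 := by ring
    have e₄ : k + 4 + 1 = k + 5 := by ring
    have e₅ : k + 5 + 1 = k := by rw [add_assoc]; exact add_eq_left.2 (by decide)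
    have := (hnodup k).map hcol
    simpa only [List.map_cons, List.map_nil, e₁, e₂, e₃, e₄, e₅] using this
  have hv (k : ZMod 6) : f k ≠ v := by
    intro hk
    obtain ⟨h₀, h₁, h₂, h₃, h₄, h₅⟩ := key k
    have h₆ := hverts k
    have h₇ := hcolors k
    rw [hk] at h₀ h₅ h₆ h₇
    exact no_rainbow_at_v h₀ h₁ h₂ h₃ h₄ h₅ h₆ h₇
  have hu (k : ZMod 6) : f k ≠ u := by
    intro hk
    obtain ⟨h₀, h₁, h₂, h₃, -, -⟩ := key k
    have h₆ := hverts k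
    rw [hk] at h₀ h₆
    refine no_cycle_at_u h₀ h₁ h₂ h₃ (List.nodup_cons.2 ⟨?_, h₆⟩)
    simp [(hv _).symm]
  obtain ⟨h₀, h₁, h₂, -⟩ := key 0
  have h₆ := hverts 0
  refine no_cycle_avoiding h₀ h₁ h₂ (List.nodup_cons.2 ⟨?_, List.nodup_cons.2 ⟨?_, ?_⟩⟩)
  · simp [(hv _).symm]
  · simp [(hu _).symm]
  · simp only [List.nodup_cons, List.mem_cons, List.not_mem_nil] at h₆ ⊢
    tauto

end Vert

/-- Six vertices forming a cycle whose edge colors are distinct give a rainbow `C₆`. -/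
lemma hasRainbowCycle_six {V : Type*} {G : SimpleGraph V} {col : Sym2 V → ℕ}
    {p₀ p₁ p₂ p₃ p₄ p₅ : V} (h₀ : G.Adj p₀ p₁) (h₁ : G.Adj p₁ p₂) (h₂ : G.Adj p₂ p₃)
    (h₃ : G.Adj p₃ p₄) (h₄ : G.Adj p₄ p₅) (h₅ : G.Adj p₅ p₀)
    (hn : [p₀, p₁, p₂, p₃, p₄, p₅].Nodup)
    (hc : [col s(p₀, p₁), col s(p₁, p₂), col s(p₂, p₃), col s(p₃, p₄), col s(p₄, p₅),
      col s(p₅, p₀)].Nodup) : HasRainbowCycle G col 6 := by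
  let f : ZMod 6 → V := (![p₀, p₁, p₂, p₃, p₄, p₅] : Fin 6 → V)
  refine ⟨f, ?_, ?_, ?_⟩
  · have key : Function.Injective (![p₀, p₁, p₂, p₃, p₄, p₅] : Fin 6 → V) :=
      List.nodup_ofFn.1 (by simpa using hn)
    exact key
  · intro i
    fin_cases i
    exacts [h₀, h₁, h₂, h₃, h₄, h₅]
  · have key : Function.Injective (![col s(p₀, p₁), col s(p₁, p₂), col s(p₂, p₃), col s(p₃, p₄),
        col s(p₄, p₅), col s(p₅, p₀)] : Fin 6 → ℕ) :=
      List.nodup_ofFn.1 (by simpa using hc)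
    have e : ∀ i : ZMod 6, col s(f i, f (i + 1)) =
        (![col s(p₀, p₁), col s(p₁, p₂), col s(p₂, p₃), col s(p₃, p₄), col s(p₄, p₅),
          col s(p₅, p₀)] : Fin 6 → ℕ) i := by
      intro i
      fin_cases i <;> rfl
    exact fun i j hij => key ((e i).symm.trans (hij.trans (e j)))

/-- A proper edge-coloring without rainbow `C₆`. -/
def Good {V : Type*} (G : SimpleGraph V) (col : Sym2 V → ℕ) : Prop :=
  ProperEdgeColoring G col ∧ ¬ HasRainbowCycle G col 6

lemma Good.ne {V : Type*} {G : SimpleGraph V} {col : Sym2 V → ℕ} (h : Good G col) {p q s : V}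
    (hq : G.Adj p q) (hs : G.Adj p s) (hne : q ≠ s) : col s(p, q) ≠ col s(p, s) :=
  properEdgeColoring_iff.1 h.1 p q s hq hs hne

/-- At most one edge of each color leaves each vertex. -/
lemma Good.exists_hits {V : Type*} [Fintype V] {G : SimpleGraph V} {col : Sym2 V → ℕ}
    (h : Good G col) (W : Finset V) (F : Finset ℕ) :
    ∃ P : Finset V, P.card ≤ W.card * F.card ∧
      ∀ p ∈ W, ∀ q, G.Adj p q → q ∉ P → col s(p, q) ∉ F := by
  classical
  refine ⟨(W ×ˢ F).biUnion fun t => {q | G.Adj t.1 q ∧ col s(t.1, q) = t.2}, ?_, ?_⟩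
  · refine (Finset.card_biUnion_le_card_mul _ _ 1 fun t _ => ?_).trans ?_
    · refine Finset.card_le_one.2 fun q hq s hs => ?_
      simp only [Finset.mem_filter, Finset.mem_univ, true_and] at hq hs
      by_contra hne
      exact h.ne hq.1 hs.1 hne (hq.2.trans hs.2.symm)
    · simp
  · intro p hp q hq hP hF
    refine hP (Finset.mem_biUnion.2 ⟨(p, col s(p, q)), ?_, ?_⟩)
    · simp [hp, hF]
    · simp [hq]

namespace Vert

variable {m r : ℕ}

/-- The vertices, sorted by kind. -/
def equivSum (m r : ℕ) : Vert m r ≃ Fin 7 ⊕ Fin r ⊕ Fin m ⊕ Fin m ⊕ Fin m where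
  toFun
    | u => .inl 0
    | v => .inl 1
    | w => .inl 2
    | x => .inl 3
    | y₁ => .inl 4
    | y₂ => .inl 5
    | y₃ => .inl 6
    | leaf j => .inr (.inl j)
    | a i => .inr (.inr (.inl i))
    | b i => .inr (.inr (.inr (.inl i)))
    | c i => .inr (.inr (.inr (.inr i)))
  invFun
    | .inl k => ![u, v, w, x, y₁, y₂, y₃] k
    | .inr (.inl j) => leaf j
    | .inr (.inr (.inl i)) => a i
    | .inr (.inr (.inr (.inl i))) => b i
    | .inr (.inr (.inr (.inr i))) => c i
  left_inv p := by cases p <;> rfl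
  right_inv := by
    rintro (k | j | i | i | i)
    · fin_cases k <;> rfl
    all_goals rfl

instance : Fintype (Vert m r) := Fintype.ofEquiv _ (equivSum m r).symm

lemma card_vert : Fintype.card (Vert m r) = 3 * m + 7 + r := by
  rw [Fintype.card_congr (equivSum m r)]
  simp only [Fintype.card_sum, Fintype.card_fin]
  ring

/-- The vertices of the triangle through a given vertex. -/
def triangle : Vert m r → Finset (Vert m r)
  | a i | b i | c i => ⟨{a i, b i, c i}, by simp⟩
  | _ => ∅

open Classical in
/-- The vertices outside all triangles, and the vertices of the triangles meeting `P`. -/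
noncomputable def closure (P : Finset (Vert m r)) : Finset (Vert m r) :=
  {u, v, w, x, y₁, y₂, y₃} ∪ Finset.univ.image leaf ∪ P.biUnion triangle

lemma card_closure_le (P : Finset (Vert m r)) : (closure P).card ≤ 7 + r + 3 * P.card := by
  classical
  have h₁ : ({u, v, w, x, y₁, y₂, y₃} : Finset (Vert m r)).card ≤ 7 := by
    refine (Finset.card_insert_le _ _).trans (Nat.succ_le_succ Finset.card_le_six)
  have h₂ : (Finset.univ.image (leaf : Fin r → Vert m r)).card ≤ r :=
    Finset.card_image_le.trans (by simp)
  have h₃ : (P.biUnion triangle).card ≤ P.card * 3 :=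
    Finset.card_biUnion_le_card_mul _ _ _ fun p _ => by cases p <;> simp [triangle]
  have h₄ := Finset.card_union_le
    (({u, v, w, x, y₁, y₂, y₃} : Finset (Vert m r)) ∪ Finset.univ.image leaf) (P.biUnion triangle)
  have h₅ := Finset.card_union_le
    ({u, v, w, x, y₁, y₂, y₃} : Finset (Vert m r)) (Finset.univ.image leaf)
  have h₆ : closure P = {u, v, w, x, y₁, y₂, y₃} ∪ Finset.univ.image leaf ∪ P.biUnion triangle := by
    unfold closure
    congr!
  rw [h₆]
  omega

lemma mem_closure {P : Finset (Vert m r)} {q : Vert m r} :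
    q ∈ closure P ↔ triangle q = ∅ ∨ ∃ p ∈ P, q ∈ triangle p := by
  have h : (q = u ∨ q = v ∨ q = w ∨ q = x ∨ q = y₁ ∨ q = y₂ ∨ q = y₃) ∨ (∃ j, leaf j = q) ↔
      triangle q = ∅ := by
    cases q <;> simp [triangle, ← Finset.val_eq_zero]
  simp only [closure, Finset.mem_union, Finset.mem_biUnion, Finset.mem_insert,
    Finset.mem_singleton, Finset.mem_image, Finset.mem_univ, true_and, h]

lemma b_mem_closure {P : Finset (Vert m r)} {i : Fin m} : b i ∈ closure P ↔ a i ∈ closure P := by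
  rw [mem_closure, mem_closure]
  refine or_congr (by simp [triangle]) (exists_congr fun p => and_congr_right fun _ => ?_)
  cases p <;> simp [triangle, ← Finset.mem_val]

lemma c_mem_closure {P : Finset (Vert m r)} {i : Fin m} : c i ∈ closure P ↔ a i ∈ closure P := by
  rw [mem_closure, mem_closure]
  refine or_congr (by simp [triangle]) (exists_congr fun p => and_congr_right fun _ => ?_)
  cases p <;> simp [triangle, ← Finset.mem_val]

lemma subset_closure (P : Finset (Vert m r)) : P ⊆ closure P := by
  intro p hp
  rw [mem_closure]
  by_cases h : triangle p = ∅
  · exact .inl h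
  · refine .inr ⟨p, hp, ?_⟩
    cases p <;> simp_all [triangle, ← Finset.mem_val]

lemma closure_mono {P Q : Finset (Vert m r)} (h : P ⊆ Q) : closure P ⊆ closure Q := by
  intro q
  rw [mem_closure, mem_closure]
  exact Or.imp_right fun ⟨p, hp, hq⟩ => ⟨p, h hp, hq⟩

section Extension

variable {G : SimpleGraph (Vert m r)} {col : Sym2 (Vert m r) → ℕ}

lemma adj_ua (hG : base m r ≤ G) (k : Fin m) : G.Adj u (a k) := hG (.inl (.ua k))
lemma adj_va (hG : base m r ≤ G) (k : Fin m) : G.Adj v (a k) := hG (.inl (.va k))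
lemma adj_vb (hG : base m r ≤ G) (k : Fin m) : G.Adj v (b k) := hG (.inl (.vb k))
lemma adj_vc (hG : base m r ≤ G) (k : Fin m) : G.Adj v (c k) := hG (.inl (.vc k))
lemma adj_ab (hG : base m r ≤ G) (k : Fin m) : G.Adj (a k) (b k) := hG (.inl (.ab k))
lemma adj_ac (hG : base m r ≤ G) (k : Fin m) : G.Adj (a k) (c k) := hG (.inl (.ac k))
lemma adj_bc (hG : base m r ≤ G) (k : Fin m) : G.Adj (b k) (c k) := hG (.inl (.bc k))
lemma adj_uw (hG : base m r ≤ G) : G.Adj u w := hG (.inl .uw)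
lemma adj_ux (hG : base m r ≤ G) : G.Adj u x := hG (.inl .ux)
lemma adj_wx (hG : base m r ≤ G) : G.Adj w x := hG (.inl .wx)
lemma adj_wy₁ (hG : base m r ≤ G) : G.Adj w y₁ := hG (.inl .wy₁)
lemma adj_wy₂ (hG : base m r ≤ G) : G.Adj w y₂ := hG (.inl .wy₂)
lemma adj_wy₃ (hG : base m r ≤ G) : G.Adj w y₃ := hG (.inl .wy₃)
lemma adj_vy₁ (hG : base m r ≤ G) : G.Adj v y₁ := hG (.inl .vy₁)
lemma adj_vy₂ (hG : base m r ≤ G) : G.Adj v y₂ := hG (.inl .vy₂)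
lemma adj_vy₃ (hG : base m r ≤ G) : G.Adj v y₃ := hG (.inl .vy₃)
lemma adj_wl (hG : base m r ≤ G) (j : Fin r) : G.Adj w (leaf j) := hG (.inl (.wl j))

/-- Some triangle avoids given vertices and has no given color on its edges to `u` and `v`. -/
lemma exists_fresh (h : Good G col) (hG : base m r ≤ G) (T : List ℕ) (P : List (Vert m r))
    (hm : 2 * T.length + P.length < m) :
    ∃ l : Fin m, (a l ∉ P ∧ b l ∉ P ∧ c l ∉ P) ∧ col s(u, a l) ∉ T ∧ col s(v, a l) ∉ T ∧
      col s(v, b l) ∉ T ∧ col s(v, c l) ∉ T := by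
  classical
  obtain ⟨Q, hQ, hcol⟩ := h.exists_hits {u, v} T.toFinset
  have hcard : (Q ∪ P.toFinset).card < m := by
    have h₁ := Finset.card_union_le Q P.toFinset
    have h₂ := T.toFinset_card_le
    have h₃ := P.toFinset_card_le
    have h₄ : ({u, v} : Finset (Vert m r)).card = 2 := by simp
    rw [h₄] at hQ
    omega
  let idx : Vert m r → Option (Fin m)
    | a i | b i | c i => some i
    | _ => none
  have hlt : ((Q ∪ P.toFinset).image idx).card <
      (Finset.univ.image (some : Fin m → Option (Fin m))).card := by
    rw [Finset.card_image_of_injective _ (Option.some_injective _), Finset.card_univ,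
      Fintype.card_fin]
    exact Finset.card_image_le.trans_lt hcard
  obtain ⟨o, ho, hno⟩ := Finset.exists_mem_notMem_of_card_lt_card hlt
  obtain ⟨l, -, rfl⟩ := Finset.mem_image.1 ho
  have hl (p : Vert m r) (hp : idx p = some l) : p ∉ Q ∧ p ∉ P := by
    rw [← hp] at hno
    have := fun hmem => hno (Finset.mem_image_of_mem idx hmem)
    simpa [not_or] using this
  have hu : (u : Vert m r) ∈ ({u, v} : Finset (Vert m r)) := by simp
  have hv : (v : Vert m r) ∈ ({u, v} : Finset (Vert m r)) := by simp
  have key := fun p hp q hq hq' => mt List.mem_toFinset.2 (hcol p hp q hq hq')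
  exact ⟨l, ⟨(hl (a l) rfl).2, (hl (b l) rfl).2, (hl (c l) rfl).2⟩,
    key u hu _ (adj_ua hG l) (hl (a l) rfl).1, key v hv _ (adj_va hG l) (hl (a l) rfl).1,
    key v hv _ (adj_vb hG l) (hl (b l) rfl).1, key v hv _ (adj_vc hG l) (hl (c l) rfl).1⟩

/-- No path of length four from `v` to `u` is rainbow. -/
lemma not_rainbow_path_four (h : Good G col) (hG : base m r ≤ G) (hm : 100 ≤ m) {p q s : Vert m r}
    (h₁ : G.Adj v p) (h₂ : G.Adj p q) (h₃ : G.Adj q s) (h₄ : G.Adj u s)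
    (hn : [v, p, q, s, u].Nodup) :
    col s(v, p) = col s(q, s) ∨ col s(v, p) = col s(u, s) ∨ col s(p, q) = col s(u, s) := by
  by_contra! hc
  obtain ⟨l, ⟨hl, -, -⟩, hul, hvl, -, -⟩ := exists_fresh h hG
    [col s(v, p), col s(p, q), col s(q, s), col s(u, s)] [p, q, s] (by simp; omega)
  have e₁ := h.ne h₁.symm h₂ (by rintro rfl; simp at hn)
  have e₂ := h.ne h₂.symm h₃ (by rintro rfl; simp at hn)
  have e₃ := h.ne h₃.symm h₄.symm (by rintro rfl; simp at hn)
  have e₄ := h.ne (adj_ua hG l).symm (adj_va hG l).symm (by simp)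
  rw [Sym2.eq_swap (a := p) (b := v)] at e₁
  rw [Sym2.eq_swap (a := q) (b := p)] at e₂
  rw [Sym2.eq_swap (a := s) (b := q), Sym2.eq_swap (a := s) (b := u)] at e₃
  rw [Sym2.eq_swap (a := a l) (b := u), Sym2.eq_swap (a := a l) (b := v)] at e₄
  refine h.2 (hasRainbowCycle_six h₁ h₂ h₃ h₄.symm (adj_ua hG l) (adj_va hG l).symm ?_ ?_)
  · simp at hn hl ⊢
    grind
  · rw [Sym2.eq_swap (a := s) (b := u), Sym2.eq_swap (a := a l) (b := v)]
    simp at hul hvl ⊢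
    grind

/-- The colors of the edges of the fixed part that matter for forcing. -/
def coreColors (col : Sym2 (Vert m r) → ℕ) : List ℕ :=
  [col s(u, w), col s(w, y₁), col s(w, y₂), col s(w, y₃), col s(v, y₁), col s(v, y₂), col s(v, y₃)]

/-- The color pattern forced on almost all triangles. -/
structure Typed (col : Sym2 (Vert m r) → ℕ) (k : Fin m) (B C : Vert m r) : Prop where
  mem : B = b k ∧ C = c k ∨ B = c k ∧ C = b k
  hub : col s(u, a k) = col s(v, B)
  side : col s(a k, B) = col s(v, C)
  const : col s(a k, C) = col s(u, w)

lemma adj_of_mem (hG : base m r ≤ G) {k : Fin m} {B C : Vert m r}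
    (hBC : B = b k ∧ C = c k ∨ B = c k ∧ C = b k) :
    G.Adj v B ∧ G.Adj v C ∧ G.Adj (a k) B ∧ G.Adj (a k) C ∧ G.Adj B C := by
  rcases hBC with ⟨rfl, rfl⟩ | ⟨rfl, rfl⟩
  · exact ⟨adj_vb hG k, adj_vc hG k, adj_ab hG k, adj_ac hG k, adj_bc hG k⟩
  · exact ⟨adj_vc hG k, adj_vb hG k, adj_ac hG k, adj_ab hG k, (adj_bc hG k).symm⟩

/-- The colors on three paths `w y v` determine the color of `uw`. -/
lemma eq_of_fan {s f g o₁ o₂ o₃ t₁ t₂ t₃ σ : ℕ} (hfg : f ≠ g) (hsf : s ≠ f) (hsg : s ≠ g)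
    (hf₁ : f ≠ o₁) (hf₂ : f ≠ o₂) (hf₃ : f ≠ o₃)
    (ho₁₂ : o₁ ≠ o₂) (ho₁₃ : o₁ ≠ o₃) (ho₂₃ : o₂ ≠ o₃) (ht₁₂ : t₁ ≠ t₂) (ht₁₃ : t₁ ≠ t₃)
    (ht₂₃ : t₂ ≠ t₃) (h₁ : t₁ = f ∨ t₁ = g ∨ o₁ = g) (h₂ : t₂ = f ∨ t₂ = g ∨ o₂ = g)
    (h₃ : t₃ = f ∨ t₃ = g ∨ o₃ = g) (g₁ : s = t₁ ∨ σ = s ∨ σ = o₁ ∨ σ = t₁)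
    (g₂ : s = t₂ ∨ σ = s ∨ σ = o₂ ∨ σ = t₂) (g₃ : s = t₃ ∨ σ = s ∨ σ = o₃ ∨ σ = t₃) :
    σ = s := by
  rcases h₁ with rfl | rfl | rfl <;> rcases h₂ with rfl | rfl | rfl <;>
    rcases h₃ with rfl | rfl | rfl <;> simp_all <;> grind

/-- If `w y v` is a path then a path `u a B v` through a triangle closes a six-cycle. -/
lemma middle_color_cases (h : Good G col) (hG : base m r ≤ G) {k : Fin m} {B y : Vert m r}
    (hvB : G.Adj v B) (haB : G.Adj (a k) B) (hy : G.Adj v y) (hw : G.Adj w y)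
    (hu : col s(u, a k) ∉ coreColors col) (hv : col s(v, B) ∉ coreColors col)
    (hne : col s(u, a k) ≠ col s(v, B)) (hyc : col s(v, y) ∈ coreColors col)
    (hwc : col s(w, y) ∈ coreColors col) (hn : [u, w, y, v, B, a k].Nodup) :
    col s(u, w) = col s(v, y) ∨ col s(a k, B) = col s(u, w) ∨ col s(a k, B) = col s(w, y) ∨
      col s(a k, B) = col s(v, y) := by
  by_contra! hc
  have e₁ := h.ne (adj_uw hG).symm hw (by rintro rfl; simp at hn)
  have e₂ := h.ne hw.symm hy.symm (by simp)
  have e₄ := h.ne haB (adj_ua hG k).symm (by rintro rfl; simp at hn)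
  have e₅ := h.ne haB.symm hvB.symm (by simp)
  have e₆ : col s(u, w) ∈ coreColors col := by simp [coreColors]
  refine h.2 (hasRainbowCycle_six (adj_uw hG) hw hy.symm hvB haB.symm (adj_ua hG k).symm hn ?_)
  rw [Sym2.eq_swap (a := w) (b := u)] at e₁
  rw [Sym2.eq_swap (a := y) (b := w), Sym2.eq_swap (a := y) (b := v)] at e₂
  rw [Sym2.eq_swap (a := a k) (b := u)] at e₄
  rw [Sym2.eq_swap (a := B) (b := v), Sym2.eq_swap (a := B) (b := a k)] at e₅
  rw [Sym2.eq_swap (a := y) (b := v), Sym2.eq_swap (a := B) (b := a k),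
    Sym2.eq_swap (a := a k) (b := u)]
  generalize coreColors col = T at *
  simp only [List.nodup_cons, List.mem_cons, List.not_mem_nil]
  grind

/-- A path `u a B v` through a triangle has the color of `uw` in its middle, unless a color is
repeated on it. -/
lemma middle_color (h : Good G col) (hG : base m r ≤ G) (hm : 100 ≤ m) {k : Fin m}
    {B C : Vert m r} (hBC : B = b k ∧ C = c k ∨ B = c k ∧ C = b k)
    (hu : col s(u, a k) ∉ coreColors col) (hv : col s(v, B) ∉ coreColors col)
    (hne : col s(u, a k) ≠ col s(v, B)) : col s(a k, B) = col s(u, w) := by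
  obtain ⟨hvB, -, haB, -, -⟩ := adj_of_mem hG hBC
  have path_four {y : Vert m r} (hy : G.Adj v y) (hw : G.Adj w y)
      (hn : [v, y, w, x, u].Nodup) : col s(v, y) = col s(w, x) ∨ col s(v, y) = col s(u, x) ∨
        col s(w, y) = col s(u, x) := by
    have := not_rainbow_path_four h hG hm hy hw.symm (adj_wx hG) (adj_ux hG) hn
    rwa [Sym2.eq_swap (a := y)] at this
  have hBne : B ≠ u ∧ B ≠ w ∧ B ≠ y₁ ∧ B ≠ y₂ ∧ B ≠ y₃ ∧ B ≠ v ∧ B ≠ a k := by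
    rcases hBC with ⟨rfl, -⟩ | ⟨rfl, -⟩ <;> simp
  have hwu := (adj_uw hG).symm
  have hxw := (adj_wx hG).symm
  have hsf := h.ne hwu (adj_wx hG) (by simp)
  have hfg := h.ne hxw (adj_ux hG).symm (by simp)
  rw [Sym2.eq_swap (a := w) (b := u)] at hsf
  rw [Sym2.eq_swap (a := x) (b := u), Sym2.eq_swap (a := x) (b := w)] at hfg
  refine eq_of_fan hfg hsf (h.ne (adj_uw hG) (adj_ux hG) (by simp))
    (h.ne (adj_wx hG) (adj_wy₁ hG) (by simp)) (h.ne (adj_wx hG) (adj_wy₂ hG) (by simp))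
    (h.ne (adj_wx hG) (adj_wy₃ hG) (by simp)) (h.ne (adj_wy₁ hG) (adj_wy₂ hG) (by simp))
    (h.ne (adj_wy₁ hG) (adj_wy₃ hG) (by simp)) (h.ne (adj_wy₂ hG) (adj_wy₃ hG) (by simp))
    (h.ne (adj_vy₁ hG) (adj_vy₂ hG) (by simp)) (h.ne (adj_vy₁ hG) (adj_vy₃ hG) (by simp))
    (h.ne (adj_vy₂ hG) (adj_vy₃ hG) (by simp)) (path_four (adj_vy₁ hG) (adj_wy₁ hG) (by simp))
    (path_four (adj_vy₂ hG) (adj_wy₂ hG) (by simp)) (path_four (adj_vy₃ hG) (adj_wy₃ hG) (by simp))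
    (middle_color_cases h hG hvB haB (adj_vy₁ hG) (adj_wy₁ hG) hu hv hne ?_ ?_ ?_)
    (middle_color_cases h hG hvB haB (adj_vy₂ hG) (adj_wy₂ hG) hu hv hne ?_ ?_ ?_)
    (middle_color_cases h hG hvB haB (adj_vy₃ hG) (adj_wy₃ hG) hu hv hne ?_ ?_ ?_)
  all_goals first
    | simp [coreColors]; done
    | (simp; tauto)

lemma Typed.of_hub_eq (h : Good G col) (hG : base m r ≤ G) (hm : 100 ≤ m) {k : Fin m}
    {B C : Vert m r} (hBC : B = b k ∧ C = c k ∨ B = c k ∧ C = b k)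
    (hu : col s(u, a k) ∉ coreColors col) (hv : col s(v, C) ∉ coreColors col)
    (heq : col s(u, a k) = col s(v, B)) : Typed col k B C := by
  obtain ⟨hvB, hvC, haB, haC, hBC'⟩ := adj_of_mem hG hBC
  have hd := h.ne hvB hvC hBC'.ne
  refine ⟨hBC, heq, ?_, middle_color h hG hm (B := C) (C := B) (by tauto) hu hv (heq ▸ hd)⟩
  have key := not_rainbow_path_four h hG hm hvC hBC'.symm haB.symm (adj_ua hG k) (by
    rcases hBC with ⟨rfl, rfl⟩ | ⟨rfl, rfl⟩ <;> simp)
  have e := h.ne hvB.symm hBC' (by rcases hBC with ⟨rfl, rfl⟩ | ⟨rfl, rfl⟩ <;> simp)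
  rw [Sym2.eq_swap (a := B) (b := v)] at e
  rw [Sym2.eq_swap (a := C) (b := B), Sym2.eq_swap (a := B) (b := a k), heq] at key
  rcases key with key | key | key
  · exact key.symm
  · exact absurd key.symm hd
  · exact absurd key.symm e

lemma exists_typed (h : Good G col) (hG : base m r ≤ G) (hm : 100 ≤ m) {k : Fin m}
    (hu : col s(u, a k) ∉ coreColors col) (hb : col s(v, b k) ∉ coreColors col)
    (hc : col s(v, c k) ∉ coreColors col) : ∃ B C, Typed col k B C := by
  by_cases h₁ : col s(u, a k) = col s(v, b k)
  · exact ⟨_, _, .of_hub_eq h hG hm (.inl ⟨rfl, rfl⟩) hu hc h₁⟩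
  by_cases h₂ : col s(u, a k) = col s(v, c k)
  · exact ⟨_, _, .of_hub_eq h hG hm (.inr ⟨rfl, rfl⟩) hu hb h₂⟩
  have e₁ := middle_color h hG hm (.inl ⟨rfl, rfl⟩) hu hb h₁
  have e₂ := middle_color h hG hm (.inr ⟨rfl, rfl⟩) hu hc h₂
  exact absurd (e₁.trans e₂.symm) (h.ne (adj_ab hG k) (adj_ac hG k) (by simp))

/-- Every rainbow path of length three from `v` to `u` contains the color of `uw`. -/
lemma rainbow_path_three (h : Good G col) (hG : base m r ≤ G) (hm : 100 ≤ m) {p q : Vert m r}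
    (h₁ : G.Adj v p) (h₂ : G.Adj p q) (h₃ : G.Adj u q) (hn : [v, p, q, u].Nodup) :
    col s(v, p) = col s(u, q) ∨ col s(v, p) = col s(u, w) ∨ col s(p, q) = col s(u, w) ∨
      col s(u, q) = col s(u, w) := by
  by_contra! hne
  obtain ⟨l, ⟨hla, hlb, hlc⟩, hua, -, hvb, hvc⟩ := exists_fresh h hG
    (coreColors col ++ [col s(v, p), col s(p, q), col s(u, q)]) [p, q]
    (by simp [coreColors]; omega)
  simp only [List.mem_append, not_or] at hua hvb hvc
  obtain ⟨B, C, hT⟩ := exists_typed h hG hm hua.1 hvb.1 hvc.1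
  obtain ⟨hvB, hvC, haB, haC, -⟩ := adj_of_mem hG hT.mem
  have hC : col s(v, C) ∉ coreColors col ∧ col s(v, C) ∉ [col s(v, p), col s(p, q), col s(u, q)] ∧
      C ∉ [p, q] ∧ C ≠ u ∧ C ≠ v := by
    rcases hT.mem with ⟨-, rfl⟩ | ⟨-, rfl⟩ <;> simp_all
  have e₁ := h.ne h₁.symm h₂ (by rintro rfl; simp at hn)
  have e₂ := h.ne h₂.symm h₃.symm (by rintro rfl; simp at hn)
  have e₃ := h.ne hvB hvC (by rcases hT.mem with ⟨rfl, rfl⟩ | ⟨rfl, rfl⟩ <;> simp)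
  have e₄ : col s(u, w) ∈ coreColors col := by simp [coreColors]
  have e₅ := hT.hub
  have e₆ := hT.const
  have e₇ := haC.ne
  rw [Sym2.eq_swap (a := p) (b := v)] at e₁
  rw [Sym2.eq_swap (a := q) (b := p), Sym2.eq_swap (a := q) (b := u)] at e₂
  refine h.2 (hasRainbowCycle_six h₁ h₂ h₃.symm (adj_ua hG l) haC hvC.symm ?_ ?_)
  · simp only [List.nodup_cons, List.mem_cons, List.not_mem_nil] at hn hla hC ⊢
    grind
  · rw [Sym2.eq_swap (a := q) (b := u), Sym2.eq_swap (a := C) (b := v)]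
    simp only [List.nodup_cons, List.mem_cons, List.not_mem_nil] at hua hC ⊢
    grind

end Extension

section Confinement

variable {G : SimpleGraph (Vert m r)} {col : Sym2 (Vert m r) → ℕ}

lemma Typed.cases {k : Fin m} {B C p : Vert m r} (hT : Typed col k B C)
    (hp : p = a k ∨ p = b k ∨ p = c k) : p = a k ∨ p = B ∨ p = C := by
  rcases hT.mem with ⟨rfl, rfl⟩ | ⟨rfl, rfl⟩ <;> tauto

lemma adj_v_of_eq (hG : base m r ≤ G) {k : Fin m} {p : Vert m r}
    (hp : p = a k ∨ p = b k ∨ p = c k) : G.Adj v p := by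
  rcases hp with rfl | rfl | rfl
  exacts [adj_va hG k, adj_vb hG k, adj_vc hG k]

/-- The color of `uw` does not occur between `v` and a typed triangle. -/
lemma Typed.ne_const (h : Good G col) (hG : base m r ≤ G) {k : Fin m} {B C p : Vert m r}
    (hT : Typed col k B C) (hp : p = a k ∨ p = b k ∨ p = c k) : col s(v, p) ≠ col s(u, w) := by
  obtain ⟨hvB, hvC, haB, haC, hBC⟩ := adj_of_mem hG hT.mem
  rcases hT.cases hp with rfl | rfl | rfl
  · have e := h.ne (adj_va hG k).symm haC (by rcases hT.mem with ⟨-, rfl⟩ | ⟨-, rfl⟩ <;> simp)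
    rwa [hT.const, Sym2.eq_swap] at e
  · rw [← hT.hub]
    exact h.ne (adj_ua hG k) (adj_uw hG) (by simp)
  · rw [← hT.side, ← hT.const]
    exact h.ne haB haC hBC.ne

/-- In a typed triangle only `a k` is adjacent to `u`. -/
lemma Typed.not_adj_u (h : Good G col) (hG : base m r ≤ G) (hm : 100 ≤ m) {k : Fin m}
    {B C : Vert m r} (hT : Typed col k B C) : ¬ G.Adj u B ∧ ¬ G.Adj u C := by
  obtain ⟨hvB, hvC, haB, haC, hBC⟩ := adj_of_mem hG hT.mem
  have hB : B = a k ∨ B = b k ∨ B = c k := by have := hT.mem; tauto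
  have hC : C = a k ∨ C = b k ∨ C = c k := by have := hT.mem; tauto
  have hBw : B ≠ w ∧ C ≠ w ∧ B ≠ u ∧ C ≠ u := by
    rcases hT.mem with ⟨rfl, rfl⟩ | ⟨rfl, rfl⟩ <;> simp
  have e₀ := h.ne hBC.symm haC.symm haB.ne'
  rw [Sym2.eq_swap (a := C) (b := a k), hT.const] at e₀
  have e₁ := hT.ne_const h hG hB
  have e₂ := hT.ne_const h hG hC
  constructor
  · intro hu
    have e₃ := h.ne hu (adj_uw hG) hBw.1
    have e₄ := h.ne haB.symm hu.symm (by simp)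
    rw [Sym2.eq_swap (a := B), hT.side, Sym2.eq_swap (a := B)] at e₄
    have := rainbow_path_three h hG hm hvC hBC.symm hu (by
      have := hvB.ne'; have := hvC.ne'; have := hBC.ne'; simp; tauto)
    tauto
  · intro hu
    have e₃ := h.ne hu (adj_uw hG) hBw.2.1
    have e₄ := h.ne (adj_ua hG k) hu haC.ne
    rw [hT.hub] at e₄
    rw [Sym2.eq_swap] at e₀
    have := rainbow_path_three h hG hm hvB hBC hu (by
      have := hvB.ne'; have := hvC.ne'; have := hBC.ne; simp; tauto)
    tauto

/-- A neighbor of `v` outside a typed triangle can only be joined to the vertex `C` of that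
triangle, and only by an edge of one particular color. -/
lemma Typed.color_eq (h : Good G col) (hG : base m r ≤ G) (hm : 100 ≤ m) {k : Fin m}
    {B C p q : Vert m r} (hT : Typed col k B C) (hvp : G.Adj v p) (hpu : p ≠ u)
    (hp : ¬ (p = a k ∨ p = b k ∨ p = c k)) (hc : col s(v, p) ≠ col s(u, w))
    (hpq : G.Adj p q) (hq : q = a k ∨ q = b k ∨ q = c k) :
    q = C ∧ col s(p, q) = col s(u, a k) := by
  obtain ⟨hvB, hvC, haB, haC, hBC⟩ := adj_of_mem hG hT.mem
  have hBw : B ≠ u ∧ C ≠ u ∧ p ≠ a k ∧ p ≠ B ∧ p ≠ C ∧ p ≠ v := by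
    have := hvp.ne'
    rcases hT.mem with ⟨rfl, rfl⟩ | ⟨rfl, rfl⟩ <;> simp <;> tauto
  have e₁ := h.ne hvp hvB (by tauto)
  have e₂ := h.ne hvp hvC (by tauto)
  have n₁ := hvB.ne
  have n₂ := hvC.ne
  have n₃ := haB.ne
  have n₄ := haC.ne
  rcases hT.cases hq with rfl | rfl | rfl
  · exfalso
    have e₃ := h.ne hpq.symm haC (by tauto)
    have e₄ := h.ne (adj_ua hG k) (adj_uw hG) (by simp)
    rw [hT.const, Sym2.eq_swap] at e₃
    have := rainbow_path_three h hG hm hvp hpq (adj_ua hG k) (by simp; tauto)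
    rw [hT.hub] at this e₄
    tauto
  · exfalso
    have e₃ := h.ne hpq.symm hvB.symm (by tauto)
    rw [Sym2.eq_swap, Sym2.eq_swap (b := v)] at e₃
    have := not_rainbow_path_four h hG hm hvp hpq haB.symm (adj_ua hG k) (by simp; tauto)
    rw [hT.hub, Sym2.eq_swap (b := a k), hT.side] at this
    tauto
  · refine ⟨rfl, ?_⟩
    have := not_rainbow_path_four h hG hm hvp hpq haC.symm (adj_ua hG k) (by simp; tauto)
    rw [Sym2.eq_swap (b := a k), hT.const] at this
    rw [hT.hub] at this ⊢
    tauto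

/-- Distinct typed triangles are not joined by an edge. -/
lemma Typed.not_adj (h : Good G col) (hG : base m r ≤ G) (hm : 100 ≤ m) {j k : Fin m}
    {B C B' C' p q : Vert m r} (hT : Typed col j B C) (hT' : Typed col k B' C') (hjk : j ≠ k)
    (hp : p = a j ∨ p = b j ∨ p = c j) (hq : q = a k ∨ q = b k ∨ q = c k) : ¬ G.Adj p q := by
  intro hpq
  have hne : p ≠ u ∧ q ≠ u ∧ ¬ (p = a k ∨ p = b k ∨ p = c k) ∧
      ¬ (q = a j ∨ q = b j ∨ q = c j) := by
    rcases hp with rfl | rfl | rfl <;> rcases hq with rfl | rfl | rfl <;> simp [hjk, hjk.symm]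
  have e₁ := (hT'.color_eq h hG hm (adj_v_of_eq hG hp) hne.1 hne.2.2.1 (hT.ne_const h hG hp)
    hpq hq).2
  have e₂ := (hT.color_eq h hG hm (adj_v_of_eq hG hq) hne.2.1 hne.2.2.2 (hT'.ne_const h hG hq)
    hpq.symm hp).2
  rw [Sym2.eq_swap] at e₂
  exact h.ne (adj_ua hG j) (adj_ua hG k) (by simpa using hjk) (e₂.symm.trans e₁)

lemma exists_of_notMem_closure {P : Finset (Vert m r)} {p : Vert m r} (hp : p ∉ closure P) :
    ∃ k, (p = a k ∨ p = b k ∨ p = c k) ∧ a k ∉ closure P := by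
  cases p with
  | a k => exact ⟨k, by simp, hp⟩
  | b k => exact ⟨k, by simp, fun h => hp (b_mem_closure.2 h)⟩
  | c k => exact ⟨k, by simp, fun h => hp (c_mem_closure.2 h)⟩
  | _ => exact absurd (mem_closure.2 (.inl rfl)) hp

/-- A vertex whose edges to `W` have colors not seen in `W` is adjacent to no vertex of `W` except
possibly `u` and `v`. -/
lemma not_adj_of_mem_closure (h : Good G col) (hG : base m r ≤ G) (hm : 100 ≤ m)
    {P : Finset (Vert m r)} {p q : Vert m r} (hp : p ∉ closure P) (hvp : G.Adj v p)
    (hcol : ∀ s ∈ closure P, G.Adj s p → ∀ s₁ ∈ closure P, ∀ s₂ ∈ closure P,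
      col s(s, p) ≠ col s(s₁, s₂))
    (hq : q ∈ closure P) (hqu : q ≠ u) (hqv : q ≠ v) : ¬ G.Adj p q := by
  intro hpq
  have core {s : Vert m r} (hs : triangle s = ∅) : s ∈ closure P := mem_closure.2 (.inl hs)
  have hu : u ∈ closure P := core rfl
  have hv : v ∈ closure P := core rfl
  have hw : w ∈ closure P := core rfl
  have hne : ∀ s ∈ closure P, p ≠ s := fun s hs he => hp (he ▸ hs)
  have detour {s : Vert m r} (hs : s ∈ closure P) (hqs : G.Adj q s) (hus : G.Adj u s)
      (hsv : s ≠ v) : False := by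
    have e₁ := hcol v hv hvp q hq s hs
    have e₂ := hcol v hv hvp u hu s hs
    have e₃ := hcol q hq hpq.symm u hu s hs
    rw [Sym2.eq_swap] at e₃
    rcases not_rainbow_path_four h hG hm hvp hpq hqs hus (by
      simp [hne u hu, (hne v hv).symm, hne q hq, hne s hs, hqs.ne, hus.ne', hqu, Ne.symm hqv,
        hsv.symm]) with e | e | e
    exacts [e₁ e, e₂ e, e₃ e]
  cases q with
  | u => exact hqu rfl
  | v => exact hqv rfl
  | w => exact detour (core rfl) (adj_wx hG) (adj_ux hG) (by simp)
  | x => exact detour hw (adj_wx hG).symm (adj_uw hG) (by simp)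
  | y₁ => exact detour hw (adj_wy₁ hG).symm (adj_uw hG) (by simp)
  | y₂ => exact detour hw (adj_wy₂ hG).symm (adj_uw hG) (by simp)
  | y₃ => exact detour hw (adj_wy₃ hG).symm (adj_uw hG) (by simp)
  | leaf j => exact detour hw (adj_wl hG j).symm (adj_uw hG) (by simp)
  | b i => exact detour (b_mem_closure.1 hq) (adj_ab hG i).symm (adj_ua hG i) (by simp)
  | c i => exact detour (c_mem_closure.1 hq) (adj_ac hG i).symm (adj_ua hG i) (by simp)
  | a i =>
    have e₁ := hcol v hv hvp u hu _ hq
    have e₂ := hcol v hv hvp u hu w hw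
    have e₃ := hcol (a i) hq hpq.symm u hu w hw
    rw [Sym2.eq_swap] at e₃
    have e₄ := h.ne (adj_ua hG i) (adj_uw hG) (by simp)
    rcases rainbow_path_three h hG hm hvp hpq (adj_ua hG i) (by
      simp [hne u hu, (hne v hv).symm, hne _ hq]) with e | e | e | e
    exacts [e₁ e, e₂ e, e₃ e, e₄ e]

lemma base_adj_of_triangle {k : Fin m} {p q : Vert m r} (hp : p = a k ∨ p = b k ∨ p = c k)
    (hq : q = a k ∨ q = b k ∨ q = c k) (hne : p ≠ q) : (base m r).Adj p q := by
  have hab : (base m r).Adj (a k) (b k) := adj_ab le_rfl k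
  have hac : (base m r).Adj (a k) (c k) := adj_ac le_rfl k
  have hbc : (base m r).Adj (b k) (c k) := adj_bc le_rfl k
  rcases hp with rfl | rfl | rfl <;> rcases hq with rfl | rfl | rfl
  exacts [absurd rfl hne, hab, hac, hab.symm, absurd rfl hne, hbc, hac.symm, hbc.symm,
    absurd rfl hne]

/-- All edges added to the base graph lie within a set of bounded size. -/
lemma exists_confinement (h : Good G col) (hG : base m r ≤ G) (hm : 100 ≤ m) (hr : r ≤ 2) :
    ∃ S : Finset (Vert m r), S.card ≤ 400000 ∧
      ∀ p q, G.Adj p q → p ∉ S → (base m r).Adj p q := by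
  classical
  obtain ⟨P₁, hP₁, hcol₁⟩ := h.exists_hits {u, v} (coreColors col).toFinset
  have core {P : Finset (Vert m r)} {s : Vert m r} (hs : triangle s = ∅) : s ∈ closure P :=
    mem_closure.2 (.inl hs)
  have typed (k : Fin m) (hk : a k ∉ closure P₁) : ∃ B C, Typed col k B C := by
    have hb := mt b_mem_closure.1 hk
    have hc := mt c_mem_closure.1 hk
    have sub := fun p hp => mt (@subset_closure m r P₁ p) hp
    have key := fun p hp q hq hq' => mt List.mem_toFinset.2 (hcol₁ p hp q hq hq')
    exact exists_typed h hG hm (key u (by simp) _ (adj_ua hG k) (sub _ hk))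
      (key v (by simp) _ (adj_vb hG k) (sub _ hb)) (key v (by simp) _ (adj_vc hG k) (sub _ hc))
  obtain ⟨P₂, hP₂, hcol₂⟩ := h.exists_hits (closure P₁)
    ((closure P₁ ×ˢ closure P₁).image fun t => col s(t.1, t.2))
  refine ⟨closure (P₁ ∪ P₂), ?_, ?_⟩
  · have h₁ : P₁.card ≤ 14 := by
      have h₂ : ({u, v} : Finset (Vert m r)).card = 2 := by simp
      have h₃ : (coreColors col).toFinset.card ≤ 7 := (coreColors col).toFinset_card_le
      rw [h₂] at hP₁
      omega
    have h₂ : (closure P₁).card ≤ 51 := (card_closure_le _).trans (by omega)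
    have h₃ : P₂.card ≤ 51 * (51 * 51) := hP₂.trans (Nat.mul_le_mul h₂ (Finset.card_image_le.trans
      ((Finset.card_product _ _).trans_le (Nat.mul_le_mul h₂ h₂))))
    have h₄ := Finset.card_union_le P₁ P₂
    exact (card_closure_le _).trans (by omega)
  · intro p q hpq hp
    have sub : closure P₁ ⊆ closure (P₁ ∪ P₂) := closure_mono Finset.subset_union_left
    have hp₁ : p ∉ closure P₁ := fun hp' => hp (sub hp')
    have hp₂ : p ∉ P₂ := fun hp' => hp (subset_closure _ (Finset.mem_union_right _ hp'))
    obtain ⟨k, hk, hak⟩ := exists_of_notMem_closure hp₁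
    obtain ⟨B, C, hT⟩ := typed k hak
    by_cases hq : q ∈ closure P₁
    · by_cases hqv : q = v
      · rw [hqv]
        exact (adj_v_of_eq le_rfl hk).symm
      by_cases hqu : q = u
      · subst hqu
        rcases hT.cases hk with rfl | rfl | rfl
        · exact (adj_ua le_rfl k).symm
        · exact absurd hpq.symm (hT.not_adj_u h hG hm).1
        · exact absurd hpq.symm (hT.not_adj_u h hG hm).2
      refine absurd hpq (not_adj_of_mem_closure h hG hm hp₁ (adj_v_of_eq hG hk) ?_ hq hqu hqv)
      intro s hs hsp s₁ hs₁ s₂ hs₂ he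
      exact hcol₂ s hs p hsp hp₂ (Finset.mem_image.2 ⟨(s₁, s₂), by simp [hs₁, hs₂], he.symm⟩)
    · obtain ⟨j, hj, haj⟩ := exists_of_notMem_closure hq
      obtain ⟨B', C', hT'⟩ := typed j haj
      by_cases hjk : k = j
      · subst hjk
        exact base_adj_of_triangle hk hj hpq.ne
      · exact absurd hpq (hT.not_adj h hG hm hT' hjk hk hj)

end Confinement

lemma ncard_base_le : (base m r).edgeSet.ncard ≤ 7 * m + 9 + r := by
  let list : Fin 7 × Fin m ⊕ Fin 9 ⊕ Fin r → Sym2 (Vert m r)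
    | .inl (t, i) => ![s(u, a i), s(v, a i), s(v, b i), s(v, c i), s(a i, b i), s(a i, c i),
        s(b i, c i)] t
    | .inr (.inl t) => ![s(u, w), s(u, x), s(w, x), s(w, y₁), s(w, y₂), s(w, y₃), s(v, y₁),
        s(v, y₂), s(v, y₃)] t
    | .inr (.inr j) => s(w, leaf j)
  have key {p q : Vert m r} (h : Edge p q) : s(p, q) ∈ Set.range list := by
    cases h with
    | ua i => exact ⟨.inl (0, i), rfl⟩
    | va i => exact ⟨.inl (1, i), rfl⟩
    | vb i => exact ⟨.inl (2, i), rfl⟩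
    | vc i => exact ⟨.inl (3, i), rfl⟩
    | ab i => exact ⟨.inl (4, i), rfl⟩
    | ac i => exact ⟨.inl (5, i), rfl⟩
    | bc i => exact ⟨.inl (6, i), rfl⟩
    | uw => exact ⟨.inr (.inl 0), rfl⟩
    | ux => exact ⟨.inr (.inl 1), rfl⟩
    | wx => exact ⟨.inr (.inl 2), rfl⟩
    | wy₁ => exact ⟨.inr (.inl 3), rfl⟩
    | wy₂ => exact ⟨.inr (.inl 4), rfl⟩
    | wy₃ => exact ⟨.inr (.inl 5), rfl⟩
    | vy₁ => exact ⟨.inr (.inl 6), rfl⟩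
    | vy₂ => exact ⟨.inr (.inl 7), rfl⟩
    | vy₃ => exact ⟨.inr (.inl 8), rfl⟩
    | wl j => exact ⟨.inr (.inr j), rfl⟩
  have sub : (base m r).edgeSet ⊆ Set.range list := by
    intro e
    induction e with
    | _ p q =>
      rintro (h | h)
      · exact key h
      · exact Sym2.eq_swap ▸ key h
  refine (Set.ncard_le_ncard sub (Set.finite_range _)).trans ?_
  rw [← Set.image_univ]
  refine (Set.ncard_image_le Set.finite_univ).trans_eq ?_
  simp only [Set.ncard_univ, Nat.card_eq_fintype_card, Fintype.card_sum, Fintype.card_prod,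
    Fintype.card_fin]
  ring

lemma ncard_edgeSet_le {G : SimpleGraph (Vert m r)} {col : Sym2 (Vert m r) → ℕ} (h : Good G col)
    (hG : base m r ≤ G) (hm : 100 ≤ m) (hr : r ≤ 2) :
    G.edgeSet.ncard ≤ 7 * m + 9 + r + 400000 * 400000 := by
  classical
  obtain ⟨S, hS, hconf⟩ := exists_confinement h hG hm hr
  have sub : G.edgeSet ⊆
      (base m r).edgeSet ∪ ((S ×ˢ S).image fun t => s(t.1, t.2) : Finset (Sym2 (Vert m r))) := by
    intro e
    induction e with
    | _ p q =>
      intro hpq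
      by_cases hp : p ∈ S
      · by_cases hq : q ∈ S
        · exact .inr (Finset.mem_coe.2 (Finset.mem_image.2 ⟨(p, q), by simp [hp, hq], rfl⟩))
        · exact .inl (hconf q p (SimpleGraph.Adj.symm hpq) hq).symm
      · exact .inl (hconf p q hpq hp)
  refine (Set.ncard_le_ncard sub (Set.toFinite _)).trans ((Set.ncard_union_le _ _).trans ?_)
  refine Nat.add_le_add ncard_base_le ?_
  rw [Set.ncard_coe_finset]
  exact Finset.card_image_le.trans
    ((Finset.card_product _ _).trans_le (Nat.mul_le_mul hS hS))

end Vert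

/-- A maximal graph with a good coloring is rainbow saturated. -/
lemma rainbowSat_of_maximal {V : Type*} {G : SimpleGraph V}
    (h : Maximal (fun H => ∃ col, Good H col) G) : RainbowSat G 6 := by
  refine ⟨h.prop, fun x y hxy hadj col hcol => ?_⟩
  by_contra hcyc
  have hle := h.le_of_ge ⟨col, hcol, hcyc⟩ le_sup_left
  exact hadj (hle (.inr (by simp [hxy])))

lemma ProperEdgeColoring.comap {V W : Type*} {G : SimpleGraph V} {col : Sym2 V → ℕ}
    (h : ProperEdgeColoring G col) (f : W ≃ V) :
    ProperEdgeColoring (G.comap f) (col ∘ Sym2.map f) := by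
  rw [properEdgeColoring_iff] at h ⊢
  exact fun p q s hq hs hne => h _ _ _ hq hs (f.injective.ne hne)

lemma HasRainbowCycle.of_comap {V W : Type*} {G : SimpleGraph V} {col : Sym2 V → ℕ} {k : ℕ}
    (f : W ≃ V) (h : HasRainbowCycle (G.comap f) (col ∘ Sym2.map f) k) :
    HasRainbowCycle G col k := by
  obtain ⟨g, hg, hadj, hcol⟩ := h
  exact ⟨f ∘ g, f.injective.comp hg, hadj, hcol⟩

lemma RainbowSat.comap {V W : Type*} {G : SimpleGraph V} {k : ℕ} (h : RainbowSat G k)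
    (f : W ≃ V) : RainbowSat (G.comap f) k := by
  obtain ⟨⟨col, hcol, hcyc⟩, hsat⟩ := h
  refine ⟨⟨_, hcol.comap f, fun h => hcyc (h.of_comap f)⟩, fun x y hxy hadj col hcol => ?_⟩
  have e : (G.comap f ⊔ SimpleGraph.fromEdgeSet {s(x, y)}).comap f.symm =
      G ⊔ SimpleGraph.fromEdgeSet {s(f x, f y)} := by
    ext p q
    simp [Equiv.symm_apply_eq]
  refine HasRainbowCycle.of_comap f.symm ?_
  rw [e]
  refine hsat (f x) (f y) (f.injective.ne hxy) hadj _ ?_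
  rw [← e]
  exact hcol.comap f.symm

/-- There are constants `C` and `n₀` such that for all `n ≥ n₀` there exists an
`n`-vertex rainbow `C₆`-saturated graph with at most `7n/3 + C` edges. -/
theorem rainbow_sat_C6_upper : ∃ (C : ℝ) (n₀ : ℕ), ∀ n : ℕ, n₀ ≤ n →
    ∃ G : SimpleGraph (Fin n), RainbowSat G 6 ∧
      (G.edgeSet.ncard : ℝ) ≤ 7 / 3 * n + C := by
  refine ⟨400000 * 400000, 307, fun n hn => ?_⟩
  obtain ⟨m, r, hm, hr, hmr⟩ : ∃ m r, 100 ≤ m ∧ r ≤ 2 ∧ 3 * m + 7 + r = n :=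
    ⟨(n - 7) / 3, (n - 7) % 3, by omega, by omega, by omega⟩
  obtain ⟨G, hG, hmax⟩ := (Set.toFinite {H | ∃ col, Good H col}).exists_le_maximal
    (a := Vert.base m r) ⟨_, Vert.baseColoring_proper, Vert.baseColoring_rainbow_free⟩
  obtain ⟨col, hcol⟩ := hmax.prop
  let f : Fin n ≃ Vert m r := (Fintype.equivFinOfCardEq (Vert.card_vert.trans hmr)).symm
  refine ⟨G.comap f, (rainbowSat_of_maximal hmax).comap f, ?_⟩
  have hcard : (G.comap f).edgeSet.ncard = G.edgeSet.ncard := by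
    rw [← Nat.card_coe_set_eq, ← Nat.card_coe_set_eq]
    exact Nat.card_congr (SimpleGraph.Iso.mapEdgeSet (SimpleGraph.Iso.comap f G))
  have hle : (G.edgeSet.ncard : ℝ) ≤ 7 * m + 9 + r + 400000 * 400000 := by
    exact_mod_cast Vert.ncard_edgeSet_le hcol hG hm hr
  have hn' : (n : ℝ) = 3 * m + 7 + r := by exact_mod_cast hmr.symm
  have hr' : (0 : ℝ) ≤ r := r.cast_nonneg
  rw [hcard, hn']
  linarith
end
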